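/- Assume the standing assumptions (B). Let u^ε ∈ C(Q̄) ∩ C^{2,1}(Q) be classical solutions of (QL) with the boundary condition (BC). Suppose there exist sequences {μ_k}, {λ_k} ⊂ (0,∞) and {ε_k} ⊂ (0,1) and constants 0 < a₁ < a₂ and β₁, β₂ ∈ I_g such that ε_k → 0 and, for all k, a₁ ≤ μ_k < λ_k ≤ a₂, u^{ε_k}(0, exp(μ_k/ε_k)) = β₁ and u^{ε_k}(0, exp(λ_k/ε_k)) = β₂. If β₁ < β₂, then G⁺(β₂) ≥ β₂; and if β₂ < β₁, then G⁻(β₂) ≤ β₂. -/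

import Mathlib

open Set Filter Metric Topology
open scoped ENNReal

noncomputable section

/-- `n`-dimensional Euclidean space. -/
abbrev Eu (n : ℕ) := EuclideanSpace ℝ (Fin n)

variable {n : ℕ}

/-- Euclidean dot product. -/
def dotp (x y : Eu n) : ℝ := ∑ i, x i * y i

/-- The quadratic form `A p · p` of a matrix `A`. -/
def mquad (A : Matrix (Fin n) (Fin n) ℝ) (p : Eu n) : ℝ := ∑ i, ∑ j, A i j * p i * p j

/-- `A ∈ 𝕊ⁿ(θ)`: symmetric with `θ I ≤ A ≤ θ⁻¹ I`. -/
def memS (θ : ℝ) (A : Matrix (Fin n) (Fin n) ℝ) : Prop :=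
  A.IsSymm ∧ ∀ p : Eu n, θ * ‖p‖ ^ 2 ≤ mquad A p ∧ mquad A p ≤ θ⁻¹ * ‖p‖ ^ 2

/-- order of symmetric matrices (via quadratic forms). -/
def mle (A B : Matrix (Fin n) (Fin n) ℝ) : Prop := ∀ p : Eu n, mquad A p ≤ mquad B p

/-- trace of the product `A·H`. -/
def trMul (A H : Matrix (Fin n) (Fin n) ℝ) : ℝ := ∑ i, ∑ j, A i j * H j i

/-- the Pucci maximal operator associated with `𝕊ⁿ(θ)`. -/
def pucci (θ : ℝ) (X : Matrix (Fin n) (Fin n) ℝ) : ℝ :=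
  sSup ((fun A => trMul A X) '' {A | memS θ A})

/-- time derivative of `u(x,t)`. -/
def tD (u : Eu n → ℝ → ℝ) (x : Eu n) (t : ℝ) : ℝ := deriv (u x) t

/-- spatial gradient of `u(x,t)`. -/
def sG (u : Eu n → ℝ → ℝ) (x : Eu n) (t : ℝ) : Eu n := gradient (fun y => u y t) x

/-- spatial Hessian matrix of `u(x,t)`. -/
def sH (u : Eu n → ℝ → ℝ) (x : Eu n) (t : ℝ) : Matrix (Fin n) (Fin n) ℝ :=
  fun i j => fderiv ℝ (fun y => sG u y t i) x (EuclideanSpace.single j 1)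

/-- Hessian matrix of a static function. -/
def hessS (v : Eu n → ℝ) (x : Eu n) : Matrix (Fin n) (Fin n) ℝ :=
  fun i j => fderiv ℝ (fun y => gradient v y i) x (EuclideanSpace.single j 1)

/-- closed parabolic cylinder `Q̄_T = closure Ω × [0,T]` (with `T ∈ (0,∞]`). -/
def cylC (Ω : Set (Eu n)) (T : ℝ≥0∞) : Set (Eu n × ℝ) :=
  {p | p.1 ∈ closure Ω ∧ 0 ≤ p.2 ∧ ENNReal.ofReal p.2 ≤ T}

/-- open parabolic cylinder `Q_T = Ω × (0,T)`. -/
def cylO (Ω : Set (Eu n)) (T : ℝ≥0∞) : Set (Eu n × ℝ) :=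
  {p | p.1 ∈ Ω ∧ 0 < p.2 ∧ ENNReal.ofReal p.2 < T}

/-- `u ∈ C^{2,1}(Q_T)`. -/
def C21 (u : Eu n → ℝ → ℝ) (Ω : Set (Eu n)) (T : ℝ≥0∞) : Prop :=
  (∀ x ∈ Ω, ∀ t : ℝ, 0 < t → ENNReal.ofReal t < T →
     ContDiffAt ℝ 2 (fun y => u y t) x ∧ DifferentiableAt ℝ (u x) t) ∧
  ContinuousOn (fun p : Eu n × ℝ => tD u p.1 p.2) (cylO Ω T) ∧
  ContinuousOn (fun p : Eu n × ℝ => sH u p.1 p.2) (cylO Ω T)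

/-- `u ∈ C(Q̄_T) ∩ C^{2,1}(Q_T)`. -/
def Classical21 (u : Eu n → ℝ → ℝ) (Ω : Set (Eu n)) (T : ℝ≥0∞) : Prop :=
  ContinuousOn (fun p : Eu n × ℝ => u p.1 p.2) (cylC Ω T) ∧ C21 u Ω T

/-- a coefficient field in `C(Q̄_T; 𝕊ⁿ(θ))`. -/
def MatC (θ : ℝ) (A : Eu n → ℝ → Matrix (Fin n) (Fin n) ℝ) (Ω : Set (Eu n))
    (T : ℝ≥0∞) : Prop :=
  ContinuousOn (fun p : Eu n × ℝ => A p.1 p.2) (cylC Ω T) ∧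
  ∀ p ∈ cylC Ω T, memS θ (A p.1 p.2)

/-- `u` is a classical solution of `u_t = ε tr[A D²u] + b·Du` in `Q_T`. -/
def SolveL (ε : ℝ) (A : Eu n → ℝ → Matrix (Fin n) (Fin n) ℝ) (b : Eu n → Eu n)
    (u : Eu n → ℝ → ℝ) (Ω : Set (Eu n)) (T : ℝ≥0∞) : Prop :=
  ∀ x ∈ Ω, ∀ t : ℝ, 0 < t → ENNReal.ofReal t < T →
    tD u x t = ε * trMul (A x t) (sH u x t) + dotp (b x) (sG u x t)

/-- `u` is a classical subsolution of `(L)` in `Q_T`. -/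
def SubsolL (ε : ℝ) (A : Eu n → ℝ → Matrix (Fin n) (Fin n) ℝ) (b : Eu n → Eu n)
    (u : Eu n → ℝ → ℝ) (Ω : Set (Eu n)) (T : ℝ≥0∞) : Prop :=
  ∀ x ∈ Ω, ∀ t : ℝ, 0 < t → ENNReal.ofReal t < T →
    tD u x t ≤ ε * trMul (A x t) (sH u x t) + dotp (b x) (sG u x t)

/-- `u` is a classical supersolution of `(L)` in `Q_T`. -/
def SupersolL (ε : ℝ) (A : Eu n → ℝ → Matrix (Fin n) (Fin n) ℝ) (b : Eu n → Eu n)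
    (u : Eu n → ℝ → ℝ) (Ω : Set (Eu n)) (T : ℝ≥0∞) : Prop :=
  ∀ x ∈ Ω, ∀ t : ℝ, 0 < t → ENNReal.ofReal t < T →
    ε * trMul (A x t) (sH u x t) + dotp (b x) (sG u x t) ≤ tD u x t

/-- viscosity subsolution of `H(x,Du) = 0` on `A`. -/
def ViscSub (H : Eu n → Eu n → ℝ) (A : Set (Eu n)) (u : Eu n → ℝ) : Prop :=
  ∀ φ : Eu n → ℝ, ContDiff ℝ 1 φ → ∀ x ∈ A,
    IsLocalMaxOn (fun y => u y - φ y) A x → H x (gradient φ x) ≤ 0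

/-- viscosity supersolution of `H(x,Du) = 0` on `A`. -/
def ViscSup (H : Eu n → Eu n → ℝ) (A : Set (Eu n)) (u : Eu n → ℝ) : Prop :=
  ∀ φ : Eu n → ℝ, ContDiff ℝ 1 φ → ∀ x ∈ A,
    IsLocalMinOn (fun y => u y - φ y) A x → 0 ≤ H x (gradient φ x)

/-- the Hamiltonian `H_α(x,p) = α(x) p·p + b(x)·p`. -/
def Ham (α : Eu n → Matrix (Fin n) (Fin n) ℝ) (b : Eu n → Eu n) (x p : Eu n) : ℝ :=
  mquad (α x) p + dotp (b x) p

/-- the quasi-potential `V_α`: the pointwise supremum (= maximal element) of all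
Lipschitz viscosity subsolutions of `H_α(x,Du)=0` in `Ω` vanishing at the origin. -/
def Vq (α : Eu n → Matrix (Fin n) (Fin n) ℝ) (b : Eu n → Eu n) (Ω : Set (Eu n))
    (x : Eu n) : ℝ :=
  sSup {r | ∃ u : Eu n → ℝ, (∃ K : NNReal, LipschitzOnWith K u (closure Ω)) ∧
    u 0 = 0 ∧ ViscSub (Ham α b) Ω u ∧ r = u x}

/-- `M_α = min_{∂Ω} V_α`. -/
def Mq (α : Eu n → Matrix (Fin n) (Fin n) ℝ) (b : Eu n → Eu n) (Ω : Set (Eu n)) : ℝ :=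
  sInf (Vq α b Ω '' frontier Ω)

/-- `argmin (V_α | ∂Ω)`. -/
def argminV (α : Eu n → Matrix (Fin n) (Fin n) ℝ) (b : Eu n → Eu n)
    (Ω : Set (Eu n)) : Set (Eu n) :=
  {x ∈ frontier Ω | ∀ y ∈ frontier Ω, Vq α b Ω x ≤ Vq α b Ω y}

/-- `Σ_α^m = {x ∈ Ω̄ : V_α(x) ≤ m}`. -/
def SigmaM (α : Eu n → Matrix (Fin n) (Fin n) ℝ) (b : Eu n → Eu n) (Ω : Set (Eu n))
    (m : ℝ) : Set (Eu n) :=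
  {x ∈ closure Ω | Vq α b Ω x ≤ m}

/-- `Ω` is a bounded `C¹` domain with outward unit normal `ν`. -/
def IsBdC1With (Ω : Set (Eu n)) (ν : Eu n → Eu n) : Prop :=
  IsOpen Ω ∧ Bornology.IsBounded Ω ∧
  ∃ ρ : Eu n → ℝ, ContDiff ℝ 1 ρ ∧ Ω = {x | ρ x < 0} ∧
    ∀ x ∈ frontier Ω, gradient ρ x ≠ 0 ∧ ν x = ‖gradient ρ x‖⁻¹ • gradient ρ x

/-- `X` is the flow of `b`, and the origin is globally asymptotically stable. -/
def GAS (b : Eu n → Eu n) (X : ℝ → Eu n → Eu n) : Prop :=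
  (∀ x, X 0 x = x) ∧ (∀ x t, HasDerivAt (fun s => X s x) (b (X t x)) t) ∧
  (∀ x, Tendsto (fun t => X t x) atTop (nhds 0)) ∧
  (∀ ε > (0:ℝ), ∃ δ > (0:ℝ), ∀ x : Eu n, ‖x‖ < δ → ∀ t ≥ (0:ℝ), ‖X t x‖ < ε)

/-- `Ω_δ = {x ∈ Ω : dist(x,∂Ω) > δ}`. -/
def Omd (Ω : Set (Eu n)) (δ : ℝ) : Set (Eu n) := {x ∈ Ω | δ < infDist x (frontier Ω)}

/-- `Ω^Π_δ = {x ∈ Ω̄ : dist(x, ∂Ω \ Π) > δ}`. -/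
def OmPid (Ω Pset : Set (Eu n)) (δ : ℝ) : Set (Eu n) :=
  {x ∈ closure Ω | δ < infDist x (frontier Ω \ Pset)}

/-- the standing assumptions (B). -/
structure SettingB (n : ℕ) where
  Ω : Set (Eu n)
  ν : Eu n → Eu n
  g : Eu n → ℝ
  θ₀ : ℝ
  a : Eu n → ℝ → Matrix (Fin n) (Fin n) ℝ
  b : Eu n → Eu n
  b₀ : ℝ
  r₀ : ℝ
  θ₀_mem : θ₀ ∈ Set.Ioc (0 : ℝ) 1
  domain : IsBdC1With Ω ν
  zero_mem : (0 : Eu n) ∈ Ω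
  g_cont : ContinuousOn g (closure Ω)
  a_cont : ContinuousOn (fun p : Eu n × ℝ => a p.1 p.2) (closure Ω ×ˢ Set.univ)
  a_mem : ∀ x ∈ closure Ω, ∀ c : ℝ, memS θ₀ (a x c)
  b_lip : ∃ K : NNReal, LipschitzWith K b
  b_zero : b 0 = 0
  b_gas : ∃ X : ℝ → Eu n → Eu n, GAS b X
  b_inward : ∀ x ∈ frontier Ω, dotp (b x) (ν x) < 0
  b₀_pos : 0 < b₀
  r₀_pos : 0 < r₀
  ball_sub : closedBall (0 : Eu n) r₀ ⊆ Ω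
  b_coerc : ∀ x ∈ ball (0 : Eu n) r₀, dotp (b x) x ≤ -b₀ * ‖x‖ ^ 2

namespace SettingB

variable (S : SettingB n)

/-- the quasi-potential `V^c` associated with `(a(·,c), b)`. -/
def Vc (c : ℝ) : Eu n → ℝ := Vq (fun x => S.a x c) S.b S.Ω

/-- `M(c) = min_{∂Ω} V^c`. -/
def M (c : ℝ) : ℝ := sInf (S.Vc c '' frontier S.Ω)

/-- `G(c) = {g(x) : x ∈ argmin(V^c|∂Ω)}`. -/
def Gset (c : ℝ) : Set ℝ := S.g '' argminV (fun x => S.a x c) S.b S.Ω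

/-- `G⁺(c) = max G(c)`. -/
def Gp (c : ℝ) : ℝ := sSup (S.Gset c)

/-- `G⁻(c) = min G(c)`. -/
def Gm (c : ℝ) : ℝ := sInf (S.Gset c)

/-- `c₀ = g(0)`. -/
def c0 : ℝ := S.g 0

/-- `g_min = min_{Ω̄} g`. -/
def gmin : ℝ := sInf (S.g '' closure S.Ω)

/-- `g_max = max_{Ω̄} g`. -/
def gmax : ℝ := sSup (S.g '' closure S.Ω)

/-- the crossing value `c₁`. -/
def c1 : ℝ :=
  if S.c0 ≤ S.Gp S.c0 then sInf {c | S.c0 ≤ c ∧ S.Gm c ≤ c}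
  else sSup {c | c ≤ S.c0 ∧ c ≤ S.Gp c}

/-- the function `c̄ : (0,∞) → I_g`. -/
def cbar (l : ℝ) : ℝ :=
  if l < S.M S.c0 ∨ S.c1 = S.c0 then S.c0
  else if S.c0 < S.c1 then min S.c1 (sInf {c | c ∈ Set.Icc S.c0 S.c1 ∧ S.M c = l})
  else max S.c1 (sSup {c | c ∈ Set.Icc S.c1 S.c0 ∧ S.M c = l})

/-- assumption (FK13): `G⁺(c₀) = G⁻(c₀)`. -/
def FK13 : Prop := S.Gp S.c0 = S.Gm S.c0

/-- assumption (FK12). -/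
def FK12 : Prop :=
  ∀ δ₀ > (0:ℝ), ∃ δ ∈ Set.Ioc (0:ℝ) δ₀,
    (S.c1 ≤ S.c0 ∧ S.gmin < S.c1 → S.c1 - δ < S.Gm (S.c1 - δ)) ∧
    (S.c0 ≤ S.c1 ∧ S.c1 < S.gmax → S.Gp (S.c1 + δ) < S.c1 + δ)

/-- `u` is a classical (`C(Q̄) ∩ C^{2,1}(Q)`) solution of the quasi-linear equation (QL). -/
def SolvesQL (ε : ℝ) (u : Eu n → ℝ → ℝ) : Prop :=
  Classical21 u S.Ω ⊤ ∧ SolveL ε (fun x t => S.a x (u x t)) S.b u S.Ω ⊤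

/-- the boundary condition (BC): `u = g` on the parabolic boundary of `Q`. -/
def BC (u : Eu n → ℝ → ℝ) : Prop :=
  (∀ x ∈ closure S.Ω, u x 0 = S.g x) ∧ ∀ x ∈ frontier S.Ω, ∀ t > (0:ℝ), u x t = S.g x

end SettingB


open Set Filter Metric Topology
open scoped ENNReal

noncomputable section
variable {n : ℕ}

lemma dotp_eq (x y : Eu n) : dotp x y = inner ℝ x y := by
  simp [dotp, PiLp.inner_apply, mul_comm]

/-- matrix times vector. -/
def mv (A : Matrix (Fin n) (Fin n) ℝ) (p : Eu n) : Eu n := WithLp.toLp 2 (fun i => ∑ j, A i j * p j)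

@[simp] lemma mv_apply (A : Matrix (Fin n) (Fin n) ℝ) (p : Eu n) (i : Fin n) :
    mv A p i = ∑ j, A i j * p j := rfl

lemma mquad_eq (A : Matrix (Fin n) (Fin n) ℝ) (p : Eu n) : mquad A p = inner ℝ (mv A p) p := by
  rw [← dotp_eq]
  simp only [mquad, dotp, mv_apply, Finset.sum_mul]
  refine Finset.sum_congr rfl fun i _ => Finset.sum_congr rfl fun j _ => by ring

lemma mv_add (A : Matrix (Fin n) (Fin n) ℝ) (p q : Eu n) : mv A (p + q) = mv A p + mv A q := by
  ext i; simp [mul_add, Finset.sum_add_distrib]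

lemma mv_smul (A : Matrix (Fin n) (Fin n) ℝ) (c : ℝ) (q : Eu n) : mv A (c • q) = c • mv A q := by
  ext i; simp [Finset.mul_sum]; refine Finset.sum_congr rfl fun j _ => by ring

lemma mv_symm {A : Matrix (Fin n) (Fin n) ℝ} (hA : A.IsSymm) (p q : Eu n) :
    inner ℝ (mv A p) q = inner ℝ (mv A q) p := by
  rw [← dotp_eq, ← dotp_eq]
  simp only [dotp, mv_apply, Finset.sum_mul]
  rw [Finset.sum_comm]
  refine Finset.sum_congr rfl fun i _ => Finset.sum_congr rfl fun j _ => ?_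
  have := hA.apply i j
  rw [← this]; ring

lemma mquad_add {A : Matrix (Fin n) (Fin n) ℝ} (hA : A.IsSymm) (p q : Eu n) :
    mquad A (p + q) = mquad A p + 2 * inner ℝ (mv A p) q + mquad A q := by
  simp only [mquad_eq, mv_add, inner_add_left, inner_add_right]
  rw [mv_symm hA q p]; ring

lemma mquad_smul (A : Matrix (Fin n) (Fin n) ℝ) (c : ℝ) (q : Eu n) :
    mquad A (c • q) = c ^ 2 * mquad A q := by
  simp only [mquad_eq, mv_smul, inner_smul_left, inner_smul_right]
  simp; ring

/-- decomposition of a positive semidefinite matrix. -/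
def Dec (A : Matrix (Fin n) (Fin n) ℝ) (B : Fin n → Eu n) : Prop :=
  ∀ i j, A i j = ∑ k, B k i * B k j

open scoped MatrixOrder Matrix.Norms.L2Operator in
lemma exists_conj_mul_of_posSemidef {A : Matrix (Fin n) (Fin n) ℝ} (hp : A.PosSemidef) :
    ∃ B : Matrix (Fin n) (Fin n) ℝ, A = star B * B :=
  CStarAlgebra.nonneg_iff_eq_star_mul_self.mp hp.nonneg

lemma exists_dec {A : Matrix (Fin n) (Fin n) ℝ} (hA : A.IsSymm) (h : ∀ p : Eu n, 0 ≤ mquad A p) :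
    ∃ B, Dec A B := by
  have hp : A.PosSemidef := by
    refine Matrix.PosSemidef.of_dotProduct_mulVec_nonneg ?_ ?_
    · rw [Matrix.IsHermitian, Matrix.conjTranspose_eq_transpose_of_trivial]; exact hA
    · intro x
      have := h (WithLp.toLp 2 x)
      rw [mquad_eq, ← dotp_eq] at this
      simpa [dotProduct, dotp, Matrix.mulVec, mul_comm] using this
  obtain ⟨B, hB⟩ := exists_conj_mul_of_posSemidef hp
  refine ⟨fun k => WithLp.toLp 2 (B k), fun i j => ?_⟩
  rw [hB]; simp [Matrix.mul_apply, Matrix.star_eq_conjTranspose]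

lemma memS.exists_dec {θ : ℝ} (hθ : 0 ≤ θ) {A : Matrix (Fin n) (Fin n) ℝ} (h : memS θ A) : ∃ B, Dec A B :=
  _root_.exists_dec h.1 fun p => le_trans (by positivity) (h.2 p).1

lemma Dec.trMul_eq {A : Matrix (Fin n) (Fin n) ℝ} {B : Fin n → Eu n} (h : Dec A B)
    (H : Matrix (Fin n) (Fin n) ℝ) : trMul A H = ∑ k, mquad H (B k) := by
  simp only [_root_.trMul, mquad]
  calc ∑ i, ∑ j, A i j * H j i = ∑ i, ∑ j, ∑ k, H j i * B k j * B k i := by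
        refine Finset.sum_congr rfl fun i _ => Finset.sum_congr rfl fun j _ => ?_
        rw [h i j, Finset.sum_mul]
        refine Finset.sum_congr rfl fun k _ => by ring
    _ = ∑ j, ∑ i, ∑ k, H j i * B k j * B k i := Finset.sum_comm
    _ = ∑ j, ∑ k, ∑ i, H j i * B k j * B k i := by
        refine Finset.sum_congr rfl fun i _ => Finset.sum_comm
    _ = _ := Finset.sum_comm

lemma Dec.quad {A : Matrix (Fin n) (Fin n) ℝ} {B : Fin n → Eu n} (h : Dec A B) (p : Eu n) :
    ∑ k, (inner ℝ p (B k)) ^ 2 = mquad A p := by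
  have : trMul A (Matrix.of fun i j => p i * p j) = mquad A p := by
    simp only [_root_.trMul, mquad, Matrix.of_apply]
    refine Finset.sum_congr rfl fun i _ => Finset.sum_congr rfl fun j _ => by ring
  rw [← this, h.trMul_eq]
  refine Finset.sum_congr rfl fun k _ => ?_
  rw [← dotp_eq, dotp, sq, Finset.sum_mul_sum, mquad]
  refine Finset.sum_congr rfl fun i _ => Finset.sum_congr rfl fun j _ => ?_
  simp; ring

lemma Dec.norm {A : Matrix (Fin n) (Fin n) ℝ} {B : Fin n → Eu n} (h : Dec A B) :
    ∑ k, ‖B k‖ ^ 2 = ∑ i, A i i := by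
  simp only [EuclideanSpace.real_norm_sq_eq]
  rw [Finset.sum_comm]
  refine Finset.sum_congr rfl fun i _ => ?_
  rw [h i i]
  refine Finset.sum_congr rfl fun k _ => by ring

lemma mquad_single (A : Matrix (Fin n) (Fin n) ℝ) (i : Fin n) :
    mquad A (EuclideanSpace.single i 1) = A i i := by
  simp [mquad]

lemma memS.diag_sum {θ : ℝ} {A : Matrix (Fin n) (Fin n) ℝ} (h : memS θ A) :
    ∑ i, A i i ≤ n * θ⁻¹ := by
  have : ∀ i ∈ Finset.univ, A i i ≤ θ⁻¹ := fun i _ => by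
    have := (h.2 (EuclideanSpace.single i 1)).2
    rw [mquad_single] at this; simpa using this
  simpa using Finset.sum_le_sum this

lemma memS.diag_nonneg {θ : ℝ} (hθ : 0 ≤ θ) {A : Matrix (Fin n) (Fin n) ℝ} (h : memS θ A) :
    0 ≤ ∑ i, A i i := by
  refine Finset.sum_nonneg fun i _ => ?_
  have := (h.2 (EuclideanSpace.single i 1)).1
  rw [mquad_single] at this
  exact le_trans (by positivity) this

/-- second order differentiability at `0` of a function of one variable. -/
def Der2 (f : ℝ → ℝ) (a1 a2 : ℝ) : Prop :=
  ∃ f' : ℝ → ℝ, (∀ᶠ s in 𝓝 (0:ℝ), HasDerivAt f (f' s) s) ∧ f' 0 = a1 ∧ HasDerivAt f' a2 0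

lemma Der2.congr_val {f : ℝ → ℝ} {a1 a2 b1 b2 : ℝ} (h : Der2 f a1 a2) (h1 : a1 = b1) (h2 : a2 = b2) :
    Der2 f b1 b2 := by subst h1 h2; exact h

lemma Der2.congr {f g : ℝ → ℝ} {a1 a2 : ℝ} (h : Der2 f a1 a2) (hg : g =ᶠ[𝓝 0] f) : Der2 g a1 a2 := by
  obtain ⟨f', h1, h2, h3⟩ := h
  refine ⟨f', ?_, h2, h3⟩
  filter_upwards [h1, hg.eventually_nhds] with s hs hg
  exact hs.congr_of_eventuallyEq hg

lemma Der2.const (c : ℝ) : Der2 (fun _ => c) 0 0 :=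
  ⟨fun _ => 0, Eventually.of_forall fun s => hasDerivAt_const s c, rfl, hasDerivAt_const _ _⟩

lemma Der2.add {f g : ℝ → ℝ} {a1 a2 b1 b2 : ℝ} (h : Der2 f a1 a2) (k : Der2 g b1 b2) :
    Der2 (fun s => f s + g s) (a1 + b1) (a2 + b2) := by
  obtain ⟨f', h1, h2, h3⟩ := h
  obtain ⟨g', k1, k2, k3⟩ := k
  refine ⟨fun s => f' s + g' s, ?_, by simp [h2, k2], h3.add k3⟩
  filter_upwards [h1, k1] with s hs ks
  exact hs.add ks

lemma Der2.const_mul {f : ℝ → ℝ} {a1 a2 : ℝ} (c : ℝ) (h : Der2 f a1 a2) :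
    Der2 (fun s => c * f s) (c * a1) (c * a2) := by
  obtain ⟨f', h1, h2, h3⟩ := h
  refine ⟨fun s => c * f' s, ?_, by simp [h2], h3.const_mul c⟩
  filter_upwards [h1] with s hs
  exact hs.const_mul c

lemma Der2.neg {f : ℝ → ℝ} {a1 a2 : ℝ} (h : Der2 f a1 a2) :
    Der2 (fun s => -f s) (-a1) (-a2) := by
  simpa using h.const_mul (-1)

lemma Der2.sub {f g : ℝ → ℝ} {a1 a2 b1 b2 : ℝ} (h : Der2 f a1 a2) (k : Der2 g b1 b2) :
    Der2 (fun s => f s - g s) (a1 - b1) (a2 - b2) := by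
  simpa [sub_eq_add_neg] using h.add k.neg

lemma Der2.mul {f g : ℝ → ℝ} {a1 a2 b1 b2 : ℝ} (h : Der2 f a1 a2) (k : Der2 g b1 b2) :
    Der2 (fun s => f s * g s) (a1 * g 0 + f 0 * b1) (a2 * g 0 + 2 * a1 * b1 + f 0 * b2) := by
  obtain ⟨f', h1, h2, h3⟩ := h
  obtain ⟨g', k1, k2, k3⟩ := k
  refine ⟨fun s => f' s * g s + f s * g' s, ?_, by simp [h2, k2], ?_⟩
  · filter_upwards [h1, k1] with s hs ks
    exact hs.mul ks
  · have := (h3.mul k1.self_of_nhds).add (h1.self_of_nhds.mul k3)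
    refine this.congr_deriv ?_
    rw [h2, k2]; ring

/-- composition with a scalar function. -/
lemma Der2.comp {f : ℝ → ℝ} {a1 a2 : ℝ} (h : Der2 f a1 a2) {G G' : ℝ → ℝ} {c2 : ℝ}
    (hG : ∀ᶠ y in 𝓝 (f 0), HasDerivAt G (G' y) y) (hG2 : HasDerivAt G' c2 (f 0)) :
    Der2 (fun s => G (f s)) (G' (f 0) * a1) (c2 * a1 ^ 2 + G' (f 0) * a2) := by
  obtain ⟨f', h1, h2, h3⟩ := h
  have hc : ContinuousAt f 0 := h1.self_of_nhds.continuousAt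
  refine ⟨fun s => G' (f s) * f' s, ?_, by simp [h2], ?_⟩
  · filter_upwards [h1, hc.eventually hG] with s hs ks
    exact ks.comp s hs
  · have := (hG2.comp (0:ℝ) h1.self_of_nhds).mul h3
    refine this.congr_deriv ?_
    rw [h2]; simp; ring

lemma Der2.exp {f : ℝ → ℝ} {a1 a2 : ℝ} (h : Der2 f a1 a2) :
    Der2 (fun s => Real.exp (f s)) (Real.exp (f 0) * a1) (Real.exp (f 0) * (a1 ^ 2 + a2)) :=
  (h.comp (G := Real.exp) (G' := Real.exp) (Eventually.of_forall fun y => Real.hasDerivAt_exp y)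
    (Real.hasDerivAt_exp _)).congr_val rfl (by ring)

lemma Der2.locMax {f : ℝ → ℝ} {a1 a2 : ℝ} (h : Der2 f a1 a2) (hm : IsLocalMax f 0) :
    a1 = 0 ∧ a2 ≤ 0 := by
  obtain ⟨f', h1, h2, h3⟩ := h
  have e1 : a1 = 0 := by
    rw [← h2]; exact hm.hasDerivAt_eq_zero h1.self_of_nhds
  refine ⟨e1, ?_⟩
  by_contra hc
  push Not at hc
  -- f' s > 0 for small s>0
  have hd : deriv f =ᶠ[𝓝 0] f' := by
    filter_upwards [h1] with s hs using hs.deriv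
  have hpos : ∀ᶠ s in 𝓝[>] (0:ℝ), 0 < f' s := by
    have := h3.tendsto_slope
    have h4 : ∀ᶠ s in 𝓝[≠] (0:ℝ), 0 < slope f' 0 s := this.eventually (lt_mem_nhds hc)
    have h5 : ∀ᶠ s in 𝓝[>] (0:ℝ), 0 < slope f' 0 s :=
      h4.filter_mono (nhdsWithin_mono _ fun x hx => ne_of_gt hx)
    filter_upwards [h5, self_mem_nhdsWithin] with s hs hs0
    rw [slope_def_field, h2, e1] at hs
    simp at hs
    have : 0 < s := hs0
    exact (div_pos_iff_of_pos_right this).1 hs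
  obtain ⟨d1, hd1, hd1'⟩ := Metric.eventually_nhds_iff.1 h1
  obtain ⟨d2, hd2, hd2'⟩ := Metric.eventually_nhds_iff.1 hm
  obtain ⟨d3, hd3, hd3'⟩ := mem_nhdsGT_iff_exists_Ioo_subset.1 hpos
  set r := min (min d1 d2) d3 / 2
  have hr : 0 < r := by have : 0 < d3 := hd3; positivity
  have hr1 : r < d1 := by
    have : min (min d1 d2) d3 ≤ d1 := (min_le_left _ _).trans (min_le_left _ _)
    simp only [r] at *; linarith
  have hr2 : r < d2 := by
    have : min (min d1 d2) d3 ≤ d2 := (min_le_left _ _).trans (min_le_right _ _)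
    simp only [r] at *; linarith
  have hr3 : r < d3 := by
    have : min (min d1 d2) d3 ≤ d3 := (min_le_right _ _)
    simp only [r] at *; linarith
  have hdf : ∀ s ∈ Icc 0 r, HasDerivAt f (f' s) s := fun s hs => hd1' (by
    simp [abs_of_nonneg hs.1]; linarith [hs.2])
  obtain ⟨c, hc1, hc2⟩ := exists_hasDerivAt_eq_slope f f' hr
    (fun s hs => (hdf s hs).continuousAt.continuousWithinAt) (fun s hs => hdf s ⟨hs.1.le, hs.2.le⟩)
  have hp : 0 < f' c := hd3' ⟨hc1.1, hc1.2.trans hr3⟩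
  have : f r ≤ f 0 := hd2' (by simp [abs_of_pos hr]; exact hr2)
  rw [hc2] at hp
  have := (div_pos_iff_of_pos_right (by linarith : 0 < r - 0)).1 hp
  linarith

lemma Der2.affine (c d : ℝ) : Der2 (fun s => c + s * d) d 0 :=
  ⟨fun _ => d, Eventually.of_forall fun s => by
    simpa using ((hasDerivAt_id s).mul_const d).const_add c, rfl, hasDerivAt_const _ _⟩

lemma Der2.inner_line (p x ξ : Eu n) : Der2 (fun s => inner ℝ p (x + s • ξ)) (inner ℝ p ξ) 0 := by
  have := Der2.affine (inner ℝ p x) (inner ℝ p ξ)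
  refine this.congr (Eventually.of_forall fun s => ?_)
  simp [inner_add_right, inner_smul_right]

lemma Der2.normsq_line (x ξ : Eu n) :
    Der2 (fun s => ‖x + s • ξ‖ ^ 2) (2 * inner ℝ x ξ) (2 * ‖ξ‖ ^ 2) := by
  refine ⟨fun s => 2 * inner ℝ x ξ + 2 * s * ‖ξ‖ ^ 2, Eventually.of_forall fun s => ?_, by simp, ?_⟩
  · have : (fun s : ℝ => ‖x + s • ξ‖ ^ 2) = fun s => ‖x‖ ^ 2 + s * (2 * inner ℝ x ξ) + s ^ 2 * ‖ξ‖ ^ 2 := by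
      ext s
      rw [norm_add_sq_real, inner_smul_right, norm_smul, mul_pow]; simp; ring
    rw [this]
    have := (((hasDerivAt_id s).mul_const (2 * inner ℝ x ξ)).const_add (‖x‖^2)).add
      ((hasDerivAt_pow 2 s).mul_const (‖ξ‖ ^ 2))
    refine this.congr_deriv ?_
    simp
  · have := (((hasDerivAt_id (0:ℝ)).const_mul 2).mul_const (‖ξ‖ ^ 2)).const_add (2 * inner ℝ x ξ)
    simpa using this

end

open Set Filter Metric Topology
open scoped ENNReal

noncomputable section
variable {n : ℕ}

lemma der2_line_of_contDiffAt {f : Eu n → ℝ} {x : Eu n} (hf : ContDiffAt ℝ 2 f x) (ξ : Eu n) :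
    Der2 (fun s => f (x + s • ξ)) (inner ℝ (gradient f x) ξ) (mquad (hessS f x) ξ) := by
  have hline : ∀ s : ℝ, HasDerivAt (fun s : ℝ => x + s • ξ) ξ s := fun s => by
    simpa using ((hasDerivAt_id s).smul_const ξ).const_add x
  have hx0 : x + (0:ℝ) • ξ = x := by simp
  have hev : ∀ᶠ y in 𝓝 x, ContDiffAt ℝ 2 f y := hf.eventually (by simp)
  have hev2 : ∀ᶠ s in 𝓝 (0:ℝ), ContDiffAt ℝ 2 f (x + s • ξ) := by
    have hc : Tendsto (fun s : ℝ => x + s • ξ) (𝓝 0) (𝓝 x) := by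
      have := (hline 0).continuousAt.tendsto
      rwa [hx0] at this
    exact hc.eventually hev
  refine ⟨fun s => inner ℝ (gradient f (x + s • ξ)) ξ, ?_, by simp, ?_⟩
  · filter_upwards [hev2] with s hs
    have hd : DifferentiableAt ℝ f (x + s • ξ) := hs.differentiableAt (by simp)
    have := hd.hasGradientAt.hasFDerivAt.comp_hasDerivAt s (hline s)
    exact this.congr_deriv (by simp)
  · have hg : DifferentiableAt ℝ (gradient f) x := by
      have h1 : ContDiffAt ℝ 1 (fderiv ℝ f) x := hf.fderiv_right (by norm_num)
      have h2 : DifferentiableAt ℝ (fderiv ℝ f) x := h1.differentiableAt (by simp)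
      exact ((InnerProductSpace.toDual ℝ (Eu n)).symm.toContinuousLinearEquiv.differentiableAt).comp x h2
    have h3 : ∀ i, DifferentiableAt ℝ (fun y => gradient f y i) x := fun i =>
      ((EuclideanSpace.proj (𝕜 := ℝ) i : Eu n →L[ℝ] ℝ).differentiableAt).comp x hg
    have h4 : ∀ i, HasDerivAt (fun s : ℝ => gradient f (x + s • ξ) i)
        (fderiv ℝ (fun y => gradient f y i) x ξ) 0 := fun i => by
      have := HasFDerivAt.comp_hasDerivAt_of_eq (0:ℝ) (h3 i).hasFDerivAt (hline 0) hx0.symm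
      exact this
    have h5 : ∀ i, fderiv ℝ (fun y => gradient f y i) x ξ = ∑ j, hessS f x i j * ξ j := fun i => by
      have : ξ = ∑ j, ξ j • EuclideanSpace.single j (1:ℝ) := by
        ext k; simp [Finset.sum_apply, Pi.single_apply]
      conv_lhs => rw [this]
      simp only [map_sum, map_smul, hessS, smul_eq_mul]
      exact Finset.sum_congr rfl fun j _ => by ring
    have h6 : (fun s : ℝ => inner ℝ (gradient f (x + s • ξ)) ξ) =
        fun s => ∑ i, gradient f (x + s • ξ) i * ξ i := by
      ext s; rw [← dotp_eq]; rfl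
    rw [h6]
    have h7 := HasDerivAt.fun_sum (u := Finset.univ) fun i _ => (h4 i).mul_const (ξ i)
    refine h7.congr_deriv ?_
    simp only [h5, mquad, Finset.sum_mul]
    exact Finset.sum_congr rfl fun i _ => Finset.sum_congr rfl fun j _ => by ring

/-- pointwise subsolution property. -/
def SubAt (ε G : ℝ) (A : Matrix (Fin n) (Fin n) ℝ) (β : Eu n) (w : Eu n → ℝ → ℝ) (x : Eu n) (t : ℝ) : Prop :=
  ∃ (wt : ℝ) (p : Eu n) (H : Matrix (Fin n) (Fin n) ℝ), HasDerivAt (w x) wt t ∧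
    (∀ ξ, Der2 (fun s => w (x + s • ξ) t) (inner ℝ p ξ) (mquad H ξ)) ∧
    wt ≤ ε * trMul A H + inner ℝ β p + G

/-- subsolutions of linear equations on a time interval. -/
structure PSub (S : SettingB n) (ε G : ℝ) (A : Eu n → ℝ → Matrix (Fin n) (Fin n) ℝ)
    (w : Eu n → ℝ → ℝ) (t1 t2 : ℝ) : Prop where
  cont : ContinuousOn (fun q : Eu n × ℝ => w q.1 q.2) (closure S.Ω ×ˢ Icc t1 t2)
  mem : ∀ x ∈ S.Ω, ∀ t ∈ Ioc t1 t2, memS S.θ₀ (A x t)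
  sub : ∀ x ∈ S.Ω, ∀ t ∈ Ioc t1 t2, SubAt ε G (A x t) (S.b x) w x t

lemma PSub.mono {S : SettingB n} {ε G : ℝ} {A : Eu n → ℝ → Matrix (Fin n) (Fin n) ℝ}
    {w : Eu n → ℝ → ℝ} {t1 t2 s1 s2 : ℝ} (h : PSub S ε G A w t1 t2) (h1 : t1 ≤ s1) (h2 : s2 ≤ t2) :
    PSub S ε G A w s1 s2 :=
  ⟨h.cont.mono (prod_mono le_rfl (Icc_subset_Icc h1 h2)),
   fun x hx t ht => h.mem x hx t ⟨h1.trans_lt ht.1, ht.2.trans h2⟩,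
   fun x hx t ht => h.sub x hx t ⟨h1.trans_lt ht.1, ht.2.trans h2⟩⟩

namespace SettingB
variable (S : SettingB n)

lemma isOpen : IsOpen S.Ω := S.domain.1
lemma bdd : Bornology.IsBounded S.Ω := S.domain.2.1
lemma cpt : IsCompact (closure S.Ω) := S.bdd.isCompact_closure
lemma θpos : 0 < S.θ₀ := S.θ₀_mem.1
lemma mem_or {x : Eu n} (hx : x ∈ closure S.Ω) : x ∈ S.Ω ∨ x ∈ frontier S.Ω := by
  by_cases h : x ∈ S.Ω
  · exact Or.inl h
  · right; rw [frontier, S.isOpen.interior_eq]; exact ⟨hx, h⟩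
lemma front_sub {x : Eu n} (hx : x ∈ frontier S.Ω) : x ∈ closure S.Ω := frontier_subset_closure hx

end SettingB

/-- maximum principle. -/
theorem MP {S : SettingB n} {ε G : ℝ} (hε : 0 ≤ ε) {A : Eu n → ℝ → Matrix (Fin n) (Fin n) ℝ}
    {w : Eu n → ℝ → ℝ} {t1 t2 : ℝ} (h : PSub S ε G A w t1 t2) (Θ : Eu n → ℝ → ℝ)
    (hc : ContinuousOn (fun q : Eu n × ℝ => Θ q.1 q.2) (closure S.Ω ×ˢ Icc t1 t2))
    (hi : ∀ x ∈ closure S.Ω, w x t1 ≤ Θ x t1)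
    (hb : ∀ x ∈ frontier S.Ω, ∀ t ∈ Icc t1 t2, w x t ≤ Θ x t)
    (hl : ∀ x ∈ S.Ω, ∀ t ∈ Ioc t1 t2, Θ x t < w x t → ∃ (Θt : ℝ) (d1 d2 : Eu n → ℝ),
      HasDerivAt (Θ x) Θt t ∧ (∀ ξ, Der2 (fun s => Θ (x + s • ξ) t) (d1 ξ) (d2 ξ)) ∧
      ∀ B, Dec (A x t) B → ε * ∑ k, d2 (B k) + d1 (S.b x) + G < Θt) :
    ∀ x ∈ closure S.Ω, ∀ t ∈ Icc t1 t2, w x t ≤ Θ x t := by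
  intro x0 hx0 t0 ht0
  by_contra hcon
  push Not at hcon
  have hK : IsCompact (closure S.Ω ×ˢ Icc t1 t2) := S.cpt.prod isCompact_Icc
  obtain ⟨⟨x, t⟩, hxt, hmax⟩ := hK.exists_isMaxOn ⟨(x0, t0), hx0, ht0⟩ (h.cont.sub hc)
  have hmax' : ∀ y ∈ closure S.Ω, ∀ s ∈ Icc t1 t2, w y s - Θ y s ≤ w x t - Θ x t :=
    fun y hy s hs => hmax (show (y, s) ∈ closure S.Ω ×ˢ Icc t1 t2 from ⟨hy, hs⟩)
  have hpos : Θ x t < w x t := by have := hmax' x0 hx0 t0 ht0; linarith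
  obtain ⟨hx1, ht1⟩ := hxt
  simp only at hx1 ht1
  have hx : x ∈ S.Ω := by
    rcases S.mem_or hx1 with h1 | h1
    · exact h1
    · have := hb x h1 t ht1; linarith
  have ht : t ∈ Ioc t1 t2 := by
    refine ⟨lt_of_le_of_ne ht1.1 ?_, ht1.2⟩
    rintro rfl
    have := hi x hx1; linarith
  obtain ⟨wt, p, H, hwt, hw2, hwin⟩ := h.sub x hx t ht
  obtain ⟨Θt, d1, d2, hΘt, hΘ2, hΘin⟩ := hl x hx t ht hpos
  obtain ⟨B, hB⟩ := (h.mem x hx t ht).exists_dec S.θpos.le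
  have key := hΘin B hB
  have hsp : ∀ ξ, inner ℝ p ξ = d1 ξ ∧ mquad H ξ ≤ d2 ξ := by
    intro ξ
    have hD := (hw2 ξ).sub (hΘ2 ξ)
    have : IsLocalMax (fun s : ℝ => w (x + s • ξ) t - Θ (x + s • ξ) t) 0 := by
      have hc0 : Tendsto (fun s : ℝ => x + s • ξ) (𝓝 0) (𝓝 x) := by
        have : Continuous (fun s : ℝ => x + s • ξ) := by fun_prop
        simpa using this.tendsto 0
      filter_upwards [hc0 (S.isOpen.mem_nhds hx)] with s hs
      simpa using hmax' _ (subset_closure hs) t ht1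
    have := hD.locMax this
    constructor <;> linarith [this.1, this.2]
  have htime : 0 ≤ wt - Θt := by
    have hd := hwt.sub hΘt
    by_contra hneg
    push Not at hneg
    have h1 := hd.tendsto_slope
    have h2 : ∀ᶠ s in 𝓝[<] t, slope (w x - Θ x) t s < 0 :=
      (h1.eventually (gt_mem_nhds hneg)).filter_mono (nhdsWithin_mono _ fun s hs => ne_of_lt hs)
    have h3 : ∀ᶠ s in 𝓝[<] t, s ∈ Ioo t1 t := Ioo_mem_nhdsLT ht.1
    obtain ⟨s, hs, hs'⟩ := (h2.and h3).exists
    rw [slope_def_field] at hs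
    have h4 := hmax' x hx1 s ⟨hs'.1.le, hs'.2.le.trans ht1.2⟩
    have h5 : (w x s - Θ x s - (w x t - Θ x t)) / (s - t) < 0 := by simpa using hs
    have h6 : 0 ≤ (w x s - Θ x s - (w x t - Θ x t)) / (s - t) :=
      div_nonneg_of_nonpos (by linarith) (by linarith [hs'.2])
    linarith
  rw [hB.trMul_eq] at hwin
  have h8 : ∑ k, mquad H (B k) ≤ ∑ k, d2 (B k) := Finset.sum_le_sum fun k _ => (hsp (B k)).2
  have h9 : inner ℝ (S.b x) p = d1 (S.b x) := by rw [real_inner_comm]; exact (hsp _).1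
  have := mul_le_mul_of_nonneg_left h8 hε
  linarith

/-- maximum principle with exponential barriers. -/
theorem MP_exp {S : SettingB n} {ε G : ℝ} (hε : 0 < ε) {A : Eu n → ℝ → Matrix (Fin n) (Fin n) ℝ}
    {w : Eu n → ℝ → ℝ} {t1 t2 : ℝ} (h : PSub S ε G A w t1 t2) (v : Eu n → ℝ → ℝ) (D c : ℝ)
    (hc : ContinuousOn (fun q : Eu n × ℝ => v q.1 q.2) (closure S.Ω ×ˢ Icc t1 t2))
    (hi : ∀ x ∈ closure S.Ω, w x t1 ≤ D + c * Real.exp (v x t1 / ε))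
    (hb : ∀ x ∈ frontier S.Ω, ∀ t ∈ Icc t1 t2, w x t ≤ D + G * (t - t1) + c * Real.exp (v x t / ε))
    (hl : ∀ x ∈ S.Ω, ∀ t ∈ Ioc t1 t2, D + G * (t - t1) + c * Real.exp (v x t / ε) < w x t →
      ∃ (vt : ℝ) (p : Eu n) (κ : ℝ),
      HasDerivAt (v x) vt t ∧ (∀ ξ, Der2 (fun s => v (x + s • ξ) t) (inner ℝ p ξ) (κ * ‖ξ‖ ^ 2)) ∧
      0 < c * (vt - (mquad (A x t) p + inner ℝ (S.b x) p + ε * κ * ∑ i, A x t i i))) :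
    ∀ x ∈ closure S.Ω, ∀ t ∈ Icc t1 t2, w x t ≤ D + G * (t - t1) + c * Real.exp (v x t / ε) := by
  refine MP hε.le h (fun x t => D + G * (t - t1) + c * Real.exp (v x t / ε)) ?_ ?_ hb ?_
  · refine ContinuousOn.add (Continuous.continuousOn (by fun_prop)) ?_
    exact continuousOn_const.mul (Real.continuous_exp.comp_continuousOn (hc.div_const ε))
  · intro x hx; have := hi x hx; simpa using this
  · intro x hx t ht hlt
    obtain ⟨vt, p, κ, h1, h2, h3⟩ := hl x hx t ht hlt
    set E := Real.exp (v x t / ε) with hE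
    refine ⟨G + c * (E * (vt / ε)), fun ξ => c * (E * (ε⁻¹ * inner ℝ p ξ)),
      fun ξ => c * (E * ((ε⁻¹ * inner ℝ p ξ) ^ 2 + ε⁻¹ * (κ * ‖ξ‖ ^ 2))), ?_, ?_, ?_⟩
    · have e1 := (((hasDerivAt_id t).sub_const t1).const_mul G).const_add D
      have e2 := ((h1.div_const ε).exp).const_mul c
      refine (e1.add e2).congr_deriv ?_
      simp [hE]
    · intro ξ
      have e1 := (((h2 ξ).const_mul ε⁻¹).exp.const_mul c).add (Der2.const (D + G * (t - t1)))
      refine (e1.congr (Eventually.of_forall fun s => ?_)).congr_val ?_ ?_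
      · simp only [div_eq_inv_mul]; ring
      · simp [hE, div_eq_inv_mul]
      · simp [hE, div_eq_inv_mul]
    · intro B hB
      have e1 : ∑ k, c * (E * ((ε⁻¹ * inner ℝ p (B k)) ^ 2 + ε⁻¹ * (κ * ‖B k‖ ^ 2))) =
          c * E * (ε⁻¹ ^ 2 * mquad (A x t) p + ε⁻¹ * κ * ∑ i, A x t i i) := by
        rw [← hB.quad, ← hB.norm, Finset.mul_sum, Finset.mul_sum, ← Finset.sum_add_distrib,
          Finset.mul_sum]
        refine Finset.sum_congr rfl fun k _ => by ring
      show ε * (∑ k, c * (E * ((ε⁻¹ * inner ℝ p (B k)) ^ 2 + ε⁻¹ * (κ * ‖B k‖ ^ 2)))) +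
        c * (E * (ε⁻¹ * inner ℝ p (S.b x))) + G < _
      rw [e1, real_inner_comm]
      have hEp : 0 < E / ε := by positivity
      have := mul_pos hEp h3
      have e3 : G + c * (E * (vt / ε)) - (ε * (c * E * (ε⁻¹ ^ 2 * mquad (A x t) p + ε⁻¹ * κ * ∑ i, A x t i i))
        + c * (E * (ε⁻¹ * inner ℝ (S.b x) p)) + G) = E / ε * (c * (vt - (mquad (A x t) p +
          inner ℝ (S.b x) p + ε * κ * ∑ i, A x t i i))) := by
        field_simp; ring
      linarith

/-- basic comparison with an affine in time barrier -/
theorem MP_const {S : SettingB n} {ε G : ℝ} (hε : 0 ≤ ε) {A : Eu n → ℝ → Matrix (Fin n) (Fin n) ℝ}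
    {w : Eu n → ℝ → ℝ} {t1 t2 D : ℝ} (hG : 0 ≤ G) (h : PSub S ε G A w t1 t2)
    (hi : ∀ x ∈ closure S.Ω, w x t1 ≤ D)
    (hb : ∀ x ∈ frontier S.Ω, ∀ t ∈ Icc t1 t2, w x t ≤ D) :
    ∀ x ∈ closure S.Ω, ∀ t ∈ Icc t1 t2, w x t ≤ D + G * (t - t1) := by
  intro x hx t ht
  refine le_of_forall_pos_le_add fun η hη => ?_
  have hpt : 0 < η / (1 + (t2 - t1)) := div_pos hη (by linarith [ht.1, ht.2])
  have := MP hε h (fun x t => D + (G + η / (1 + (t2 - t1))) * (t - t1)) (Continuous.continuousOn (by fun_prop))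
    (fun x hx => by simpa using hi x hx) (fun x hx t ht => by
      have := hb x hx t ht
      have : 0 ≤ (G + η / (1 + (t2 - t1))) * (t - t1) := mul_nonneg (by linarith) (by linarith [ht.1])
      linarith) (fun x hx t ht _ => by
      refine ⟨G + η / (1 + (t2 - t1)), fun _ => 0, fun _ => 0, ?_, fun ξ => Der2.const _, fun B _ => ?_⟩
      · have e1 := (((hasDerivAt_id t).sub_const t1).const_mul (G + η / (1 + (t2 - t1)))).const_add D
        refine e1.congr_deriv (by ring)
      · simp; linarith) x hx t ht
  have h2 : η / (1 + (t2 - t1)) * (t - t1) ≤ η := by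
    rw [div_mul_eq_mul_div, div_le_iff₀ (by linarith [ht.1, ht.2])]
    nlinarith [ht.1, ht.2]
  linarith

namespace SettingB
variable {S : SettingB n} {ε : ℝ} {u : Eu n → ℝ → ℝ}

lemma SolvesQL.cont (h : S.SolvesQL ε u) :
    ContinuousOn (fun q : Eu n × ℝ => u q.1 q.2) (closure S.Ω ×ˢ Ici 0) :=
  h.1.1.mono fun q hq => ⟨hq.1, hq.2, le_top⟩

lemma SolvesQL.toSub (h : S.SolvesQL ε u) {t1 t2 : ℝ} (ht1 : 0 ≤ t1) :
    PSub S ε 0 (fun x t => S.a x (u x t)) u t1 t2 := by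
  refine ⟨h.cont.mono (prod_mono le_rfl fun t ht => ht1.trans ht.1),
    fun x hx t ht => S.a_mem x (subset_closure hx) _, fun x hx t ht => ?_⟩
  have htp : 0 < t := ht1.trans_lt ht.1
  obtain ⟨h1, h2⟩ := h.1.2.1 x hx t htp ENNReal.ofReal_lt_top
  refine ⟨tD u x t, sG u x t, sH u x t, h2.hasDerivAt, fun ξ => der2_line_of_contDiffAt h1 ξ, ?_⟩
  rw [← dotp_eq]
  have := h.2 x hx t htp ENNReal.ofReal_lt_top
  rw [this]; simp

lemma mquad_neg (H : Matrix (Fin n) (Fin n) ℝ) (ξ : Eu n) : mquad (-H) ξ = - mquad H ξ := by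
  simp [mquad]

lemma trMul_neg (A H : Matrix (Fin n) (Fin n) ℝ) : trMul A (-H) = - trMul A H := by
  simp [trMul]

lemma SolvesQL.toSub_neg (h : S.SolvesQL ε u) {t1 t2 : ℝ} (ht1 : 0 ≤ t1) :
    PSub S ε 0 (fun x t => S.a x (u x t)) (fun x t => - u x t) t1 t2 := by
  refine ⟨(h.cont.mono (prod_mono le_rfl fun t ht => ht1.trans ht.1)).neg,
    fun x hx t ht => S.a_mem x (subset_closure hx) _, fun x hx t ht => ?_⟩
  have htp : 0 < t := ht1.trans_lt ht.1
  obtain ⟨h1, h2⟩ := h.1.2.1 x hx t htp ENNReal.ofReal_lt_top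
  refine ⟨-tD u x t, -sG u x t, -sH u x t, h2.hasDerivAt.neg, fun ξ => ?_, ?_⟩
  · exact ((der2_line_of_contDiffAt h1 ξ).neg).congr_val (by rw [inner_neg_left]; rfl) (by rw [mquad_neg]; rfl)
  rw [← dotp_eq, trMul_neg]
  have := h.2 x hx t htp ENNReal.ofReal_lt_top
  rw [this]; simp [dotp, Finset.sum_neg_distrib]

lemma g_bdd (S : SettingB n) : ∃ C, 0 < C ∧ ∀ x ∈ closure S.Ω, |S.g x| ≤ C := by
  obtain ⟨C, hC⟩ := S.cpt.exists_bound_of_continuousOn S.g_cont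
  exact ⟨max C 1, by positivity, fun x hx => (hC x hx).trans (le_max_left _ _)⟩

lemma BC.front (hb : S.BC u) {x : Eu n} (hx : x ∈ frontier S.Ω) {t : ℝ} (ht : 0 ≤ t) : u x t = S.g x := by
  rcases ht.eq_or_lt with h | h
  · rw [← h]; exact hb.1 x (S.front_sub hx)
  · exact hb.2 x hx t h

lemma SolvesQL.le_of (hε : 0 ≤ ε) (h : S.SolvesQL ε u) (hb : S.BC u) {C : ℝ} (hC : ∀ x ∈ closure S.Ω, S.g x ≤ C)
    {x : Eu n} (hx : x ∈ closure S.Ω) {t : ℝ} (ht : 0 ≤ t) : u x t ≤ C := by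
  have := MP_const hε le_rfl (h.toSub (t1 := 0) (t2 := t) le_rfl) (D := C)
    (fun x hx => by rw [hb.1 x hx]; exact hC x hx)
    (fun x hx t ht => by rw [hb.front hx ht.1]; exact hC x (S.front_sub hx)) x hx t ⟨ht, le_rfl⟩
  simpa using this

lemma SolvesQL.ge_of (hε : 0 ≤ ε) (h : S.SolvesQL ε u) (hb : S.BC u) {C : ℝ} (hC : ∀ x ∈ closure S.Ω, C ≤ S.g x)
    {x : Eu n} (hx : x ∈ closure S.Ω) {t : ℝ} (ht : 0 ≤ t) : C ≤ u x t := by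
  have := MP_const hε le_rfl (h.toSub_neg (t1 := 0) (t2 := t) le_rfl) (D := -C)
    (fun x hx => by rw [hb.1 x hx]; exact neg_le_neg (hC x hx))
    (fun x hx t ht => by rw [hb.front hx ht.1]; exact neg_le_neg (hC x (S.front_sub hx))) x hx t ⟨ht, le_rfl⟩
  simp at this
  exact this

lemma SolvesQL.abs_bd (hε : 0 ≤ ε) (h : S.SolvesQL ε u) (hb : S.BC u) {C : ℝ} (hC : ∀ x ∈ closure S.Ω, |S.g x| ≤ C)
    {x : Eu n} (hx : x ∈ closure S.Ω) {t : ℝ} (ht : 0 ≤ t) : |u x t| ≤ C :=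
  _root_.abs_le.2 ⟨h.ge_of hε hb (fun x hx => (_root_.abs_le.1 (hC x hx)).1) hx ht,
    h.le_of hε hb (fun x hx => (_root_.abs_le.1 (hC x hx)).2) hx ht⟩

end SettingB
end

open Set Filter Metric Topology
open scoped ENNReal

noncomputable section
variable {n : ℕ}

namespace SettingB
variable (S : SettingB n)

/-- Lipschitz constant of the drift. -/
def K : NNReal := Classical.choose S.b_lip
lemma hK : LipschitzWith S.K S.b := Classical.choose_spec S.b_lip
/-- the flow. -/
def X : ℝ → Eu n → Eu n := Classical.choose S.b_gas
lemma hX : GAS S.b S.X := Classical.choose_spec S.b_gas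
/-- a defining function. -/
def ρ : Eu n → ℝ := Classical.choose S.domain.2.2
lemma hρ : ContDiff ℝ 1 S.ρ ∧ S.Ω = {x | S.ρ x < 0} ∧
    ∀ x ∈ frontier S.Ω, gradient S.ρ x ≠ 0 ∧ S.ν x = ‖gradient S.ρ x‖⁻¹ • gradient S.ρ x :=
  Classical.choose_spec S.domain.2.2

lemma b_bound (x y : Eu n) : ‖S.b x - S.b y‖ ≤ S.K * ‖x - y‖ := by
  simpa [dist_eq_norm] using S.hK.dist_le_mul x y

lemma b_cont : Continuous S.b := S.hK.continuous

lemma X_zero (x : Eu n) : S.X 0 x = x := S.hX.1 x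
lemma X_deriv (x : Eu n) (t : ℝ) : HasDerivAt (fun s => S.X s x) (S.b (S.X t x)) t := S.hX.2.1 x t
lemma X_contt (x : Eu n) : Continuous (fun s => S.X s x) :=
  continuous_iff_continuousAt.2 fun t => (S.X_deriv x t).continuousAt

lemma X_add (s t : ℝ) (x : Eu n) : S.X s (S.X t x) = S.X (s + t) x := by
  have := ODE_solution_unique_univ (v := fun _ => S.b) (s := fun _ => univ) (K := S.K)
    (f := fun s => S.X s (S.X t x)) (g := fun s => S.X (s + t) x) (t₀ := 0)
    (fun _ => S.hK.lipschitzOnWith) (fun s => ⟨S.X_deriv _ s, trivial⟩)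
    (fun s => ⟨(S.X_deriv x (s + t)).comp_add_const s t, trivial⟩) (by simp [S.X_zero])
  exact congrFun this s

lemma X_origin (t : ℝ) : S.X t 0 = 0 := by
  have := ODE_solution_unique_univ (v := fun _ => S.b) (s := fun _ => univ) (K := S.K)
    (f := fun s => S.X s 0) (g := fun _ => 0) (t₀ := 0)
    (fun _ => S.hK.lipschitzOnWith) (fun s => ⟨S.X_deriv _ s, trivial⟩)
    (fun s => ⟨by simpa [S.b_zero] using hasDerivAt_const s (0 : Eu n), trivial⟩) (by simp [S.X_zero])
  exact congrFun this t

lemma X_lip {t : ℝ} (ht : 0 ≤ t) (x y : Eu n) :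
    ‖S.X t x - S.X t y‖ ≤ Real.exp (S.K * t) * ‖x - y‖ := by
  have := dist_le_of_trajectories_ODE (v := fun _ => S.b) (K := S.K) (f := fun s => S.X s x)
    (g := fun s => S.X s y) (a := 0) (b := t) (δ := dist x y) (fun _ => S.hK)
    (S.X_contt x).continuousOn (fun s _ => (S.X_deriv x s).hasDerivWithinAt)
    (S.X_contt y).continuousOn (fun s _ => (S.X_deriv y s).hasDerivWithinAt)
    (by simp [S.X_zero]) t ⟨ht, le_rfl⟩
  simpa [dist_eq_norm, mul_comm] using this

lemma X_disp {t : ℝ} (ht : 0 ≤ t) (x y : Eu n) :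
    ‖S.X t x - S.X t y - (x - y)‖ ≤ S.K * t * Real.exp (S.K * t) * ‖x - y‖ := by
  have := norm_image_sub_le_of_norm_deriv_le_segment' (a := 0) (b := t)
    (f := fun s => S.X s x - S.X s y) (f' := fun s => S.b (S.X s x) - S.b (S.X s y))
    (C := S.K * Real.exp (S.K * t) * ‖x - y‖)
    (fun s _ => ((S.X_deriv x s).sub (S.X_deriv y s)).hasDerivWithinAt)
    (fun s hs => by
      refine (S.b_bound _ _).trans ?_
      rw [mul_assoc]
      refine mul_le_mul_of_nonneg_left ((S.X_lip hs.1 x y).trans ?_) S.K.2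
      gcongr
      exact hs.2.le) t ⟨ht, le_rfl⟩
  simp only [S.X_zero, sub_zero] at this
  refine this.trans (le_of_eq (by ring))

lemma X_contx {t : ℝ} (ht : 0 ≤ t) : Continuous (S.X t) := by
  have : LipschitzWith (Real.toNNReal (Real.exp (S.K * t))) (S.X t) :=
    LipschitzWith.of_dist_le_mul fun x y => by
      rw [Real.coe_toNNReal _ (Real.exp_pos _).le, dist_eq_norm, dist_eq_norm]
      exact S.X_lip ht x y
  exact this.continuous

lemma X_contOn : ContinuousOn (fun q : ℝ × Eu n => S.X q.1 q.2) (Ici 0 ×ˢ univ) := by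
  rintro ⟨t, x⟩ ⟨ht, -⟩
  simp only [mem_Ici] at ht
  rw [ContinuousWithinAt, tendsto_iff_norm_sub_tendsto_zero]
  refine squeeze_zero' (g := fun q : ℝ × Eu n => Real.exp (S.K * q.1) * ‖q.2 - x‖ + ‖S.X q.1 x - S.X t x‖)
    (Eventually.of_forall fun _ => norm_nonneg _) ?_ ?_
  · filter_upwards [self_mem_nhdsWithin] with q hq
    calc ‖S.X q.1 q.2 - S.X t x‖ = ‖(S.X q.1 q.2 - S.X q.1 x) + (S.X q.1 x - S.X t x)‖ := by simp
      _ ≤ _ := (norm_add_le _ _).trans (by gcongr; exact S.X_lip hq.1 _ _)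
  · have hc : Continuous (fun q : ℝ × Eu n => Real.exp (S.K * q.1) * ‖q.2 - x‖ + ‖S.X q.1 x - S.X t x‖) := by
      have := (S.X_contt x).comp (continuous_fst (X := ℝ) (Y := Eu n))
      have h2 : Continuous (fun q : ℝ × Eu n => S.X q.1 x) := this
      fun_prop
    have := (hc.tendsto (t, x)).mono_left (nhdsWithin_le_nhds (s := Ici 0 ×ˢ univ))
    simpa using this

lemma ρ_cont : Continuous S.ρ := S.hρ.1.continuous
lemma mem_iff {x : Eu n} : x ∈ S.Ω ↔ S.ρ x < 0 := by
  have := S.hρ.2.1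
  constructor
  · intro h; rw [this] at h; exact h
  · intro h; rw [this]; exact h
lemma ρ_closure {x : Eu n} (hx : x ∈ closure S.Ω) : S.ρ x ≤ 0 := by
  have : closure S.Ω ⊆ {x | S.ρ x ≤ 0} :=
    closure_minimal (fun x hx => (S.mem_iff.1 hx).le) (isClosed_le S.ρ_cont continuous_const)
  exact this hx
lemma not_mem_of_front {x : Eu n} (hx : x ∈ frontier S.Ω) : x ∉ S.Ω := by
  rw [frontier, S.isOpen.interior_eq] at hx; exact hx.2
lemma ρ_front {x : Eu n} (hx : x ∈ frontier S.Ω) : S.ρ x = 0 := by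
  refine le_antisymm (S.ρ_closure (S.front_sub hx)) ?_
  have := S.not_mem_of_front hx
  rw [S.mem_iff] at this; linarith

lemma ρ_grad (x : Eu n) : HasFDerivAt S.ρ (fderiv ℝ S.ρ x) x :=
  (S.hρ.1.differentiable (by simp) x).hasFDerivAt

lemma ρ_inward {x : Eu n} (hx : x ∈ frontier S.Ω) : fderiv ℝ S.ρ x (S.b x) < 0 := by
  have h1 := S.b_inward x hx
  obtain ⟨h2, h3⟩ := S.hρ.2.2 x hx
  rw [h3, dotp_eq, inner_smul_right] at h1
  have h4 : inner ℝ (S.b x) (gradient S.ρ x) = fderiv ℝ S.ρ x (S.b x) := by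
    rw [real_inner_comm]; simp [gradient]
  rw [h4] at h1
  have : 0 < ‖gradient S.ρ x‖⁻¹ := by positivity
  by_contra hc
  push Not at hc
  have := mul_nonneg this.le hc
  linarith

/-- inward cone property. -/
lemma cone {z : Eu n} (hz : z ∈ frontier S.Ω) : ∃ r > 0, ∃ c > 0, ∃ L > 0, ∀ x ∈ ball z r, ∀ y ∈ ball z r,
    ∀ s ≥ (0:ℝ), S.ρ y - S.ρ x ≤ -c * s + L * ‖y - x - s • S.b z‖ := by
  have hc : Continuous (fderiv ℝ S.ρ) := S.hρ.1.continuous_fderiv (by simp)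
  set c0 := - fderiv ℝ S.ρ z (S.b z) with hc0
  have hc0p : 0 < c0 := by have := S.ρ_inward hz; linarith
  have h1 : ∀ᶠ y in 𝓝 z, fderiv ℝ S.ρ y (S.b z) < -(c0/2) := by
    have : ContinuousAt (fun y => fderiv ℝ S.ρ y (S.b z)) z := by fun_prop
    exact this.eventually (gt_mem_nhds (by show fderiv ℝ S.ρ z (S.b z) < _; linarith))
  have h2 : ∀ᶠ y in 𝓝 z, ‖fderiv ℝ S.ρ y‖ < ‖fderiv ℝ S.ρ z‖ + 1 := by
    have : ContinuousAt (fun y => ‖fderiv ℝ S.ρ y‖) z := by fun_prop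
    exact this.eventually (gt_mem_nhds (by simp))
  obtain ⟨r, hr, hr'⟩ := Metric.eventually_nhds_iff_ball.1 (h1.and h2)
  refine ⟨r, hr, c0/2, by linarith, ‖fderiv ℝ S.ρ z‖ + 1, by positivity, fun x hx y hy s hs => ?_⟩
  obtain ⟨ξ, hξ, he⟩ := domain_mvt (f := S.ρ) (f' := fderiv ℝ S.ρ) (s := ball z r)
    (fun x _ => (S.ρ_grad x).hasFDerivWithinAt) (convex_ball z r) hx hy
  have hξr : ξ ∈ ball z r := (convex_ball z r).segment_subset hx hy hξ
  obtain ⟨h3, h4⟩ := hr' ξ hξr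
  rw [he]
  have e1 : y - x = s • S.b z + (y - x - s • S.b z) := by abel
  have e2 : fderiv ℝ S.ρ ξ (y - x) = s * fderiv ℝ S.ρ ξ (S.b z) + fderiv ℝ S.ρ ξ (y - x - s • S.b z) := by
    conv_lhs => rw [e1]
    rw [map_add, map_smul, smul_eq_mul]
  rw [e2]
  have e3 : fderiv ℝ S.ρ ξ (y - x - s • S.b z) ≤ (‖fderiv ℝ S.ρ z‖ + 1) * ‖y - x - s • S.b z‖ := by
    refine (Real.le_norm_self _).trans ((ContinuousLinearMap.le_opNorm _ _).trans ?_)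
    gcongr
  have e4 : s * fderiv ℝ S.ρ ξ (S.b z) ≤ s * (-(c0/2)) := mul_le_mul_of_nonneg_left h3.le hs
  linarith

lemma X_ρ_deriv (x : Eu n) (t : ℝ) :
    HasDerivAt (fun s => S.ρ (S.X s x)) (fderiv ℝ S.ρ (S.X t x) (S.b (S.X t x))) t :=
  (S.ρ_grad (S.X t x)).comp_hasDerivAt t (S.X_deriv x t)

lemma X_closure {x : Eu n} (hx : x ∈ closure S.Ω) {t : ℝ} (ht : 0 ≤ t) : S.X t x ∈ closure S.Ω := by
  have hcl : IsClosed ({s | S.X s x ∈ closure S.Ω} ∩ Icc 0 t) :=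
    (isClosed_closure.preimage (S.X_contt x)).inter isClosed_Icc
  refine hcl.Icc_subset_of_forall_exists_gt (by simpa [S.X_zero] using hx) ?_ ⟨ht, le_rfl⟩
  rintro s ⟨hs, hst⟩ y hy
  have hev : ∀ᶠ τ in 𝓝[>] s, S.X τ x ∈ S.Ω := by
    rcases S.mem_or hs with h | h
    · have : ∀ᶠ τ in 𝓝 s, S.X τ x ∈ S.Ω := (S.X_contt x).continuousAt.eventually_mem (S.isOpen.mem_nhds h)
      exact this.filter_mono nhdsWithin_le_nhds
    · have hd := S.X_ρ_deriv x s
      have hn := S.ρ_inward h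
      have h1 := hd.tendsto_slope
      have h2 : ∀ᶠ τ in 𝓝[>] s, slope (fun s => S.ρ (S.X s x)) s τ < 0 :=
        (h1.eventually (gt_mem_nhds hn)).filter_mono (nhdsWithin_mono _ fun τ hτ => ne_of_gt hτ)
      filter_upwards [h2, self_mem_nhdsWithin] with τ h3 h4
      rw [slope_def_field, S.ρ_front h, sub_zero] at h3
      rw [S.mem_iff]
      by_contra hc
      push Not at hc
      have : 0 ≤ S.ρ (S.X τ x) / (τ - s) := div_nonneg hc (sub_nonneg.2 (le_of_lt h4))
      linarith
  obtain ⟨τ, h1, h2⟩ := (hev.and (Ioo_mem_nhdsGT hy)).exists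
  exact ⟨τ, subset_closure h1, h2.1, h2.2.le⟩

lemma X_mem {x : Eu n} (hx : x ∈ closure S.Ω) {t : ℝ} (ht : 0 < t) : S.X t x ∈ S.Ω := by
  rcases S.mem_or (S.X_closure hx ht.le) with h | h
  · exact h
  · exfalso
    have hd := S.X_ρ_deriv x t
    have hn := S.ρ_inward h
    have h1 := hd.tendsto_slope
    have h2 : ∀ᶠ τ in 𝓝[<] t, slope (fun s => S.ρ (S.X s x)) t τ < 0 :=
      (h1.eventually (gt_mem_nhds hn)).filter_mono (nhdsWithin_mono _ fun τ hτ => ne_of_lt hτ)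
    obtain ⟨τ, h3, h4⟩ := (h2.and (Ioo_mem_nhdsLT ht)).exists
    rw [slope_def_field, S.ρ_front h, sub_zero] at h3
    have h5 := S.ρ_closure (S.X_closure hx h4.1.le)
    have : 0 ≤ S.ρ (S.X τ x) / (τ - t) := div_nonneg_of_nonpos h5 (by linarith [h4.2])
    linarith

lemma X_mem' {x : Eu n} (hx : x ∈ S.Ω) {t : ℝ} (ht : 0 ≤ t) : S.X t x ∈ S.Ω := by
  rcases ht.eq_or_lt with h | h
  · rw [← h, S.X_zero]; exact hx
  · exact S.X_mem (subset_closure hx) h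

lemma X_attract {C : Set (Eu n)} (hC : IsCompact C) {r : ℝ} (hr : 0 < r) :
    ∃ T > 0, ∀ t ≥ T, ∀ x ∈ C, ‖S.X t x‖ < r := by
  obtain ⟨δ, hδ, hst⟩ := S.hX.2.2.2 r hr
  have hcov : C ⊆ ⋃ k : ℕ, {x | ‖S.X k x‖ < δ} := by
    intro x _
    have h1 : ∀ᶠ t in atTop, ‖S.X t x‖ < δ := by
      have := (S.hX.2.2.1 x).norm
      rw [norm_zero] at this
      exact this.eventually (gt_mem_nhds hδ)
    obtain ⟨k, hk⟩ := (tendsto_natCast_atTop_atTop.eventually h1).exists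
    exact mem_iUnion.2 ⟨k, hk⟩
  obtain ⟨F, hF⟩ := hC.elim_finite_subcover _ (fun k : ℕ =>
    isOpen_lt (S.X_contx (Nat.cast_nonneg k)).norm continuous_const) hcov
  refine ⟨(F.sup id : ℕ) + 1, by positivity, fun t ht x hx => ?_⟩
  have := hF hx
  simp only [mem_iUnion, exists_prop] at this
  obtain ⟨k, hkF, hk⟩ := this
  have hkt : (k:ℝ) ≤ (F.sup id : ℕ) := by exact_mod_cast Finset.le_sup (f := id) hkF
  have := hst (S.X k x) hk (t - k) (by linarith)
  rwa [S.X_add, sub_add_cancel] at this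

lemma Ω_preconn : IsPreconnected S.Ω := by
  refine isPreconnected_of_forall 0 fun y hy => ?_
  obtain ⟨T, hT, hT'⟩ := S.X_attract (isCompact_singleton (x := y)) S.r₀_pos
  refine ⟨closedBall 0 S.r₀ ∪ (fun t => S.X t y) '' Icc 0 T, ?_, ?_, ?_, ?_⟩
  · refine union_subset S.ball_sub ?_
    rintro _ ⟨t, ht, rfl⟩
    exact S.X_mem' hy ht.1
  · left; simp [S.r₀_pos.le]
  · right; exact ⟨0, ⟨le_rfl, hT.le⟩, S.X_zero y⟩
  · refine IsPreconnected.union (S.X T y) ?_ ?_ (convex_closedBall _ _).isPreconnected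
      (isPreconnected_Icc.image _ (S.X_contt y).continuousOn)
    · simpa using (hT' T le_rfl y rfl).le
    · exact ⟨T, ⟨hT.le, le_rfl⟩, rfl⟩

/-- bound of the drift on the closure. -/
lemma b_bdd : ∃ C > 0, ∀ x ∈ closure S.Ω, ‖S.b x‖ ≤ C := by
  obtain ⟨C, hC⟩ := S.cpt.exists_bound_of_continuousOn S.b_cont.continuousOn
  exact ⟨max C 1, by positivity, fun x hx => (hC x hx).trans (le_max_left _ _)⟩

lemma zero_cl : (0 : Eu n) ∈ closure S.Ω := subset_closure S.zero_mem

end SettingB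
end

open Set Filter Metric Topology
open scoped ENNReal

noncomputable section
variable {n : ℕ}

/-- entrywise closeness of matrices. -/
def MClose (ϖ : ℝ) (A B : Matrix (Fin n) (Fin n) ℝ) : Prop := ∀ i j, |A i j - B i j| ≤ ϖ

lemma MClose.mono {ϖ ϖ' : ℝ} {A B : Matrix (Fin n) (Fin n) ℝ} (h : MClose ϖ A B) (hh : ϖ ≤ ϖ') :
    MClose ϖ' A B := fun i j => (h i j).trans hh

lemma MClose.trans {ϖ ϖ' : ℝ} {A B C : Matrix (Fin n) (Fin n) ℝ} (h : MClose ϖ A B) (h' : MClose ϖ' B C) :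
    MClose (ϖ + ϖ') A C := fun i j => by
  have := abs_sub_le (A i j) (B i j) (C i j)
  linarith [h i j, h' i j]

lemma MClose.symm {ϖ : ℝ} {A B : Matrix (Fin n) (Fin n) ℝ} (h : MClose ϖ A B) :
    MClose ϖ B A := fun i j => by rw [abs_sub_comm]; exact h i j

lemma MClose.nonneg_or {ϖ : ℝ} {A B : Matrix (Fin n) (Fin n) ℝ} (h : MClose ϖ A B) (i : Fin n) : 0 ≤ ϖ :=
  (abs_nonneg _).trans (h i i)

lemma sum_abs_le (p : Eu n) : (∑ i, |p i|) ^ 2 ≤ n * ‖p‖ ^ 2 := by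
  have := sq_sum_le_card_mul_sum_sq (s := (Finset.univ : Finset (Fin n))) (f := fun i => |p i|)
  simpa [EuclideanSpace.real_norm_sq_eq] using this

lemma MClose.quad {ϖ : ℝ} (hϖ : 0 ≤ ϖ) {A B : Matrix (Fin n) (Fin n) ℝ} (h : MClose ϖ A B) (p : Eu n) :
    |mquad A p - mquad B p| ≤ ϖ * (n * ‖p‖ ^ 2) := by
  have e : mquad A p - mquad B p = ∑ i, ∑ j, (A i j - B i j) * p i * p j := by
    simp [mquad, ← Finset.sum_sub_distrib, sub_mul]
  rw [e]
  calc |∑ i, ∑ j, (A i j - B i j) * p i * p j| ≤ ∑ i, ∑ j, |(A i j - B i j) * p i * p j| :=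
        (Finset.abs_sum_le_sum_abs _ _).trans (Finset.sum_le_sum fun i _ => Finset.abs_sum_le_sum_abs _ _)
    _ ≤ ∑ i, ∑ j, ϖ * (|p i| * |p j|) := by
        refine Finset.sum_le_sum fun i _ => Finset.sum_le_sum fun j _ => ?_
        rw [abs_mul, abs_mul, mul_assoc]
        exact mul_le_mul_of_nonneg_right (h i j) (by positivity)
    _ = ϖ * (∑ i, |p i|) ^ 2 := by
        rw [sq, Finset.sum_mul_sum, Finset.mul_sum]
        refine Finset.sum_congr rfl fun i _ => by rw [Finset.mul_sum]
    _ ≤ _ := mul_le_mul_of_nonneg_left (sum_abs_le p) hϖ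

lemma MClose.mv {ϖ : ℝ} (hϖ : 0 ≤ ϖ) {A B : Matrix (Fin n) (Fin n) ℝ} (h : MClose ϖ A B) (p : Eu n) :
    ‖mv A p - mv B p‖ ≤ ϖ * (n * ‖p‖) := by
  refine le_of_sq_le_sq ?_ (by positivity)
  rw [EuclideanSpace.real_norm_sq_eq]
  have : ∀ i, ((_root_.mv A p - _root_.mv B p) i) ^ 2 ≤ ϖ ^ 2 * (n * ‖p‖ ^ 2) := fun i => by
    have e : (_root_.mv A p - _root_.mv B p) i = ∑ j, (A i j - B i j) * p j := by
      simp [← Finset.sum_sub_distrib, sub_mul]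
    rw [e]
    have h1 : |∑ j, (A i j - B i j) * p j| ≤ ϖ * ∑ j, |p j| := by
      refine (Finset.abs_sum_le_sum_abs _ _).trans ?_
      rw [Finset.mul_sum]
      refine Finset.sum_le_sum fun j _ => ?_
      rw [abs_mul]; exact mul_le_mul_of_nonneg_right (h i j) (by positivity)
    calc (∑ j, (A i j - B i j) * p j) ^ 2 = |∑ j, (A i j - B i j) * p j| ^ 2 := (sq_abs _).symm
      _ ≤ (ϖ * ∑ j, |p j|) ^ 2 := by gcongr
      _ = ϖ ^ 2 * (∑ j, |p j|) ^ 2 := by ring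
      _ ≤ _ := by gcongr; exact sum_abs_le p
  refine (Finset.sum_le_sum fun i _ => this i).trans (le_of_eq ?_)
  simp; ring

/-- running cost upper bound. -/
def rate (θ : ℝ) (A : Matrix (Fin n) (Fin n) ℝ) (β p q : Eu n) : ℝ :=
  inner ℝ p q - mquad A p - inner ℝ β p + ‖q - (2:ℝ) • mv A p - β‖ ^ 2 / (4 * θ)

lemma le_rate {θ : ℝ} (hθ : 0 < θ) {A : Matrix (Fin n) (Fin n) ℝ} (hA : memS θ A) (β p q p' : Eu n) :
    inner ℝ p' q - mquad A p' - inner ℝ β p' ≤ rate θ A β p q := by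
  obtain ⟨d, rfl⟩ : ∃ d, p' = p + d := ⟨p' - p, by abel⟩
  rw [rate, mquad_add hA.1]
  set e := q - (2:ℝ) • mv A p - β with he
  have hq : q = e + (2:ℝ) • mv A p + β := by rw [he]; abel
  have h1 := (hA.2 d).1
  have h2 : inner ℝ d e ≤ ‖d‖ * ‖e‖ := real_inner_le_norm d e
  have h3 : inner ℝ d q = inner ℝ d e + 2 * inner ℝ (mv A p) d + inner ℝ β d := by
    rw [hq]; simp only [inner_add_right, inner_smul_right]
    rw [real_inner_comm (mv A p) d, real_inner_comm β d]
  have h4 : ‖d‖ * ‖e‖ ≤ θ * ‖d‖ ^ 2 + ‖e‖ ^ 2 / (4 * θ) := by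
    have : θ * ‖d‖ ^ 2 + ‖e‖ ^ 2 / (4 * θ) - ‖d‖ * ‖e‖ = (2 * θ * ‖d‖ - ‖e‖) ^ 2 / (4 * θ) := by
      field_simp; ring
    have h5 : 0 ≤ (2 * θ * ‖d‖ - ‖e‖) ^ 2 / (4 * θ) := by positivity
    linarith
  rw [inner_add_left, inner_add_right, h3]
  linarith

lemma rate_nonneg {θ : ℝ} (hθ : 0 < θ) {A : Matrix (Fin n) (Fin n) ℝ} (hA : memS θ A) (β p q : Eu n) :
    0 ≤ rate θ A β p q := by
  have := le_rate hθ hA β p q 0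
  simpa [mquad] using this

lemma rate_zero (θ : ℝ) (A : Matrix (Fin n) (Fin n) ℝ) (β q : Eu n) :
    rate θ A β 0 q = ‖q - β‖ ^ 2 / (4 * θ) := by
  have : mv A (0 : Eu n) = 0 := by ext i; simp
  simp [rate, mquad, this]

lemma rate_near {θ : ℝ} (hθ : 0 < θ) {A A' : Matrix (Fin n) (Fin n) ℝ} {β β' p q' : Eu n} {ϖ P : ℝ}
    (hϖ : 0 ≤ ϖ) (hc : MClose ϖ A A') (hp : ‖p‖ ≤ P) (h1 : ‖β - β'‖ ≤ ϖ)
    (h2 : ‖q' - ((2:ℝ) • mv A' p + β')‖ ≤ ϖ) :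
    rate θ A β p q' ≤ mquad A' p + (P * ϖ + ϖ * (n * P ^ 2) + P * ϖ + (2 * ϖ + 2 * (ϖ * (n * P))) ^ 2 / (4 * θ)) := by
  have hP : 0 ≤ P := (norm_nonneg p).trans hp
  have a1 : inner ℝ p (q' - ((2:ℝ) • mv A' p + β')) ≤ P * ϖ :=
    (real_inner_le_norm _ _).trans (by gcongr)
  have a2 : inner ℝ p (q' - ((2:ℝ) • mv A' p + β')) = inner ℝ p q' - 2 * mquad A' p - inner ℝ β' p := by
    rw [inner_sub_right, inner_add_right, inner_smul_right, mquad_eq, real_inner_comm (mv A' p) p,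
      real_inner_comm β' p]; ring
  have a3 : mquad A' p - mquad A p ≤ ϖ * (n * P ^ 2) := by
    have := (abs_le.1 (hc.quad hϖ p)).1
    have h3 : ϖ * (n * ‖p‖ ^ 2) ≤ ϖ * (n * P ^ 2) := by gcongr
    linarith
  have a4 : - inner ℝ (β - β') p ≤ P * ϖ := by
    have := abs_real_inner_le_norm (β - β') p
    have h4 : ‖β - β'‖ * ‖p‖ ≤ ϖ * P := by gcongr
    linarith [neg_le_abs (inner ℝ (β - β') p)]
  rw [inner_sub_left] at a4
  have a5 : ‖q' - (2:ℝ) • mv A p - β‖ ≤ 2 * ϖ + 2 * (ϖ * (n * P)) := by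
    have e : q' - (2:ℝ) • mv A p - β = (q' - ((2:ℝ) • mv A' p + β')) - (2:ℝ) • (mv A p - mv A' p) - (β - β') := by
      rw [smul_sub]; abel
    rw [e]
    have h5 : ‖(2:ℝ) • (mv A p - mv A' p)‖ ≤ 2 * (ϖ * (n * P)) := by
      rw [norm_smul]; simp only [Real.norm_ofNat]
      have := hc.mv hϖ p
      have h6 : ϖ * (n * ‖p‖) ≤ ϖ * (n * P) := by gcongr
      linarith
    have := norm_sub_le ((q' - ((2:ℝ) • mv A' p + β')) - (2:ℝ) • (mv A p - mv A' p)) (β - β')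
    have := norm_sub_le (q' - ((2:ℝ) • mv A' p + β')) ((2:ℝ) • (mv A p - mv A' p))
    linarith
  have a6 : ‖q' - (2:ℝ) • mv A p - β‖ ^ 2 / (4 * θ) ≤ (2 * ϖ + 2 * (ϖ * (n * P))) ^ 2 / (4 * θ) := by gcongr
  rw [rate]
  linarith

/-- admissible coefficient fields. -/
structure Coef (S : SettingB n) (α : Eu n → Matrix (Fin n) (Fin n) ℝ) : Prop where
  mem : ∀ x ∈ closure S.Ω, memS S.θ₀ (α x)
  cont : ContinuousOn α (closure S.Ω)

lemma SettingB.coef (S : SettingB n) (c : ℝ) : Coef S (fun x => S.a x c) := by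
  refine ⟨fun x hx => S.a_mem x hx c, ?_⟩
  have : ContinuousOn (fun x : Eu n => (x, c)) (closure S.Ω) := by fun_prop
  exact S.a_cont.comp this fun x hx => ⟨hx, trivial⟩

lemma mat_unif {T : Type*} [PseudoMetricSpace T] {C : Set T} (hC : IsCompact C) {f : T → Matrix (Fin n) (Fin n) ℝ}
    (hf : ContinuousOn f C) {e : ℝ} (he : 0 < e) :
    ∃ d > 0, ∀ x ∈ C, ∀ z ∈ C, dist x z ≤ d → MClose e (f x) (f z) := by
  have h1 : ContinuousOn (fun x => (fun i j => f x i j : Fin n → Fin n → ℝ)) C := hf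
  have h2 := hC.uniformContinuousOn_of_continuous h1
  obtain ⟨d, hd, h⟩ := Metric.uniformContinuousOn_iff.1 h2 e he
  refine ⟨d / 2, by linarith, fun x hx z hz hxz i j => ?_⟩
  have h3 := (h x hx z hz (by linarith)).le
  have := (dist_pi_le_iff he.le).1 ((dist_pi_le_iff he.le).1 h3 i) j
  rwa [Real.dist_eq] at this

lemma rate_near_unif {S : SettingB n} {α : Eu n → Matrix (Fin n) (Fin n) ℝ} (hα : Coef S α) (P : ℝ) {σ : ℝ}
    (hσ : 0 < σ) : ∃ d > 0, ∀ x ∈ closure S.Ω, ∀ z ∈ closure S.Ω, ‖x - z‖ ≤ d → ∀ A, MClose d A (α z) →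
      ∀ p : Eu n, ‖p‖ ≤ P → ∀ q', ‖q' - ((2:ℝ) • mv (α x) p + S.b x)‖ ≤ d →
      rate S.θ₀ A (S.b z) p q' ≤ mquad (α x) p + σ := by
  have hθ := S.θpos
  have : ∃ ϖ > 0, P * ϖ + ϖ * (n * P ^ 2) + P * ϖ + (2 * ϖ + 2 * (ϖ * (n * P))) ^ 2 / (4 * S.θ₀) ≤ σ := by
    have hc : Continuous (fun ϖ : ℝ => P * ϖ + ϖ * (n * P ^ 2) + P * ϖ + (2 * ϖ + 2 * (ϖ * (n * P))) ^ 2 / (4 * S.θ₀)) := by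
      fun_prop
    have h0 := hc.tendsto 0
    have h1 : ∀ᶠ ϖ in 𝓝[>] (0:ℝ), P * ϖ + ϖ * (n * P ^ 2) + P * ϖ + (2 * ϖ + 2 * (ϖ * (n * P))) ^ 2 / (4 * S.θ₀) < σ := by
      refine (h0.eventually (gt_mem_nhds ?_)).filter_mono nhdsWithin_le_nhds
      simpa using hσ
    obtain ⟨ϖ, h2, h3⟩ := (h1.and self_mem_nhdsWithin).exists
    exact ⟨ϖ, h3, h2.le⟩
  obtain ⟨ϖ, hϖ, hle⟩ := this
  obtain ⟨d, hd, hu⟩ := mat_unif S.cpt hα.cont (half_pos hϖ)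
  have hK1 : (0:ℝ) < S.K + 1 := by have := S.K.2; positivity
  refine ⟨min (min d (ϖ / 2)) (ϖ / (S.K + 1)), by positivity, fun x hx z hz hxz A hA p hp q' hq => ?_⟩
  have d1 : min (min d (ϖ / 2)) (ϖ / (S.K + 1)) ≤ d := (min_le_left _ _).trans (min_le_left _ _)
  have d2 : min (min d (ϖ / 2)) (ϖ / (S.K + 1)) ≤ ϖ / 2 := (min_le_left _ _).trans (min_le_right _ _)
  have d3 : min (min d (ϖ / 2)) (ϖ / (S.K + 1)) ≤ ϖ / (S.K + 1) := min_le_right _ _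
  have hzx := hu x hx z hz (by rw [dist_eq_norm]; linarith)
  have := rate_near hθ hϖ.le (((hA.mono d2).trans hzx.symm).mono (by linarith)) hp
    (β := S.b z) (β' := S.b x) (q' := q') ?_ (by linarith)
  · linarith
  · refine (S.b_bound z x).trans ?_
    rw [norm_sub_rev]
    calc (S.K:ℝ) * ‖x - z‖ ≤ (S.K + 1) * (ϖ / (S.K + 1)) := by
          gcongr
          · linarith
          · linarith
      _ = ϖ := by field_simp
end

open Set Filter Metric Topology
open scoped ENNReal

noncomputable section
variable {n : ℕ}

/-- one admissible straight step with cost rate `ℓ`. -/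
def Step (S : SettingB n) (α : Eu n → Matrix (Fin n) (Fin n) ℝ) (x q : Eu n) (h ℓ : ℝ) : Prop :=
  0 < h ∧ ∃ p : Eu n, ∃ r > 0, ∃ ϖ > 0, ∀ s ∈ Icc 0 h, ∀ z : Eu n, ‖z - (x + s • q)‖ ≤ r →
    z ∈ S.Ω ∧ ∀ A, memS S.θ₀ A → MClose ϖ A (α z) → rate S.θ₀ A (S.b z) p q ≤ ℓ

/-- chains of steps starting from the origin. -/
inductive Chain (S : SettingB n) (α : Eu n → Matrix (Fin n) (Fin n) ℝ) : Eu n → ℝ → Prop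
  | zero : Chain S α 0 0
  | step {x q : Eu n} {h ℓ c : ℝ} : Chain S α x c → Step S α x q h ℓ → Chain S α (x + h • q) (c + h * ℓ)

lemma MClose.refl {ϖ : ℝ} (h : 0 ≤ ϖ) (A : Matrix (Fin n) (Fin n) ℝ) : MClose ϖ A A := fun i j => by simpa using h

variable {S : SettingB n} {α : Eu n → Matrix (Fin n) (Fin n) ℝ}

lemma Step.memL {x q : Eu n} {h ℓ : ℝ} (hs : Step S α x q h ℓ) : x ∈ S.Ω := by
  obtain ⟨h0, p, r, hr, ϖ, hϖ, H⟩ := hs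
  exact (H 0 ⟨le_rfl, h0.le⟩ x (by simpa using hr.le)).1

lemma Step.memR {x q : Eu n} {h ℓ : ℝ} (hs : Step S α x q h ℓ) : x + h • q ∈ S.Ω := by
  obtain ⟨h0, p, r, hr, ϖ, hϖ, H⟩ := hs
  exact (H h ⟨h0.le, le_rfl⟩ _ (by simpa using hr.le)).1

lemma Step.nonneg (hα : Coef S α) {x q : Eu n} {h ℓ : ℝ} (hs : Step S α x q h ℓ) : 0 ≤ ℓ := by
  have hx := hs.memL
  obtain ⟨h0, p, r, hr, ϖ, hϖ, H⟩ := hs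
  have := (H 0 ⟨le_rfl, h0.le⟩ x (by simpa using hr.le)).2 (α x) (hα.mem x (subset_closure hx)) (MClose.refl hϖ.le _)
  exact (rate_nonneg S.θpos (hα.mem x (subset_closure hx)) _ _ _).trans this

lemma Chain.mem {x : Eu n} {c : ℝ} (h : Chain S α x c) : x ∈ S.Ω := by
  cases h with
  | zero => exact S.zero_mem
  | step _ hs => exact hs.memR

lemma Chain.nonneg (hα : Coef S α) {x : Eu n} {c : ℝ} (h : Chain S α x c) : 0 ≤ c := by
  induction h with
  | zero => exact le_rfl
  | step _ hs ih => exact add_nonneg ih (mul_nonneg hs.1.le (hs.nonneg hα))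

/-- cost of unit speed motion -/
def C0 (S : SettingB n) : ℝ := (1 + Classical.choose S.b_bdd) ^ 2 / (4 * S.θ₀)

lemma C0_nonneg (S : SettingB n) : 0 ≤ C0 S := by have := S.θpos; unfold C0; positivity

lemma C0_spec {z q : Eu n} (hz : z ∈ closure S.Ω) (hq : ‖q‖ ≤ 1) : ‖q - S.b z‖ ^ 2 / (4 * S.θ₀) ≤ C0 S := by
  have h := (Classical.choose_spec S.b_bdd).2 z hz
  have h0 := (Classical.choose_spec S.b_bdd).1
  have := S.θpos
  have h1 := norm_sub_le q (S.b z)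
  unfold C0
  gcongr
  linarith

lemma Chain.seg (α : Eu n → Matrix (Fin n) (Fin n) ℝ) {x y : Eu n} {c : ℝ} (h : Chain S α x c) (hxy : segment ℝ x y ⊆ S.Ω) :
    Chain S α y (c + C0 S * ‖y - x‖) := by
  by_cases hne : y = x
  · subst hne; simpa using h
  have hd : 0 < ‖y - x‖ := norm_pos_iff.2 (sub_ne_zero.2 hne)
  have hst : Step S α x (‖y - x‖⁻¹ • (y - x)) ‖y - x‖ (C0 S) := by
    have hcomp : IsCompact (segment ℝ x y) := by
      rw [segment_eq_image']
      exact isCompact_Icc.image (by fun_prop)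
    obtain ⟨r, hr, hsub⟩ := hcomp.exists_cthickening_subset_open S.isOpen hxy
    refine ⟨hd, 0, r, hr, 1, one_pos, fun s hs z hz => ?_⟩
    have hzΩ : z ∈ S.Ω := by
      apply hsub
      refine mem_cthickening_of_dist_le z (x + s • ‖y - x‖⁻¹ • (y - x)) r _ ?_ (by rwa [dist_eq_norm])
      rw [segment_eq_image']
      refine ⟨s * ‖y - x‖⁻¹, ⟨mul_nonneg hs.1 (by positivity), ?_⟩, by simp [smul_smul]⟩
      rw [← div_eq_mul_inv]; exact (div_le_one hd).2 hs.2
    refine ⟨hzΩ, fun A _ _ => ?_⟩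
    rw [rate_zero]
    refine C0_spec (subset_closure hzΩ) ?_
    rw [norm_smul, norm_inv, norm_norm, inv_mul_cancel₀ hd.ne']
  have := Chain.step h hst
  rw [smul_smul, mul_inv_cancel₀ hd.ne', one_smul, mul_comm] at this
  simpa using this

lemma exists_chain (α : Eu n → Matrix (Fin n) (Fin n) ℝ) {x : Eu n} (hx : x ∈ S.Ω) : ∃ c, Chain S α x c := by
  have key : S.Ω ⊆ {x | ∃ c, Chain S α x c} := by
    refine S.Ω_preconn.subset_of_closure_inter_subset ?_ ⟨0, S.zero_mem, 0, Chain.zero⟩ ?_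
    · rw [Metric.isOpen_iff]
      rintro y ⟨c, hc⟩
      obtain ⟨r, hr, hb⟩ := Metric.isOpen_iff.1 S.isOpen y hc.mem
      refine ⟨r, hr, fun z hz => ⟨_, hc.seg α (y := z) ?_⟩⟩
      exact ((convex_ball y r).segment_subset (mem_ball_self hr) hz).trans hb
    · rintro y ⟨hy, hyΩ⟩
      obtain ⟨r, hr, hb⟩ := Metric.isOpen_iff.1 S.isOpen y hyΩ
      obtain ⟨z, ⟨c, hc⟩, hz⟩ := Metric.mem_closure_iff.1 hy r hr
      refine ⟨_, hc.seg α (y := y) ?_⟩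
      exact ((convex_ball y r).segment_subset (by rwa [mem_ball, dist_comm]) (mem_ball_self hr)).trans hb
  exact key hx

/-- chain potential -/
def Wc (S : SettingB n) (α : Eu n → Matrix (Fin n) (Fin n) ℝ) (x : Eu n) : ℝ := sInf {c | Chain S α x c}

lemma Wc_le (hα : Coef S α) {x : Eu n} {c : ℝ} (h : Chain S α x c) : Wc S α x ≤ c :=
  csInf_le ⟨0, fun _ hc => Chain.nonneg hα hc⟩ h

lemma Wc_nonneg (hα : Coef S α) {x : Eu n} : 0 ≤ Wc S α x :=
  Real.sInf_nonneg fun _ hc => Chain.nonneg hα hc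

lemma Wc_approx {x : Eu n} (hx : x ∈ S.Ω) {κ : ℝ} (hκ : 0 < κ) :
    ∃ c, Chain S α x c ∧ c < Wc S α x + κ := by
  obtain ⟨c, hc, h⟩ := exists_lt_of_csInf_lt (exists_chain α hx) (show sInf {c | Chain S α x c} < Wc S α x + κ by
    rw [Wc]; linarith)
  exact ⟨c, hc, h⟩

lemma Wc_step (hα : Coef S α) {x q : Eu n} {h ℓ : ℝ} (hs : Step S α x q h ℓ) :
    Wc S α (x + h • q) ≤ Wc S α x + h * ℓ := by
  refine le_of_forall_pos_le_add fun κ hκ => ?_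
  obtain ⟨c, hc, h1⟩ := Wc_approx (α := α) hs.memL hκ
  have := Wc_le hα (hc.step hs)
  linarith

lemma Wc_seg (hα : Coef S α) {x y : Eu n} (hxy : segment ℝ x y ⊆ S.Ω) :
    Wc S α y ≤ Wc S α x + C0 S * ‖y - x‖ := by
  refine le_of_forall_pos_le_add fun κ hκ => ?_
  obtain ⟨c, hc, h1⟩ := Wc_approx (α := α) (hxy (left_mem_segment ℝ x y)) hκ
  have := Wc_le hα (hc.seg α hxy)
  linarith

lemma Wc_locLip (hα : Coef S α) {z : Eu n} (hz : z ∈ closure S.Ω) :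
    ∃ r > 0, ∃ L : ℝ, 0 ≤ L ∧ ∀ x ∈ ball z r ∩ S.Ω, ∀ y ∈ ball z r ∩ S.Ω, Wc S α y ≤ Wc S α x + L * ‖y - x‖ := by
  rcases S.mem_or hz with hz | hz
  · obtain ⟨r, hr, hb⟩ := Metric.isOpen_iff.1 S.isOpen z hz
    exact ⟨r, hr, C0 S, C0_nonneg S, fun x hx y hy =>
      Wc_seg hα (((convex_ball z r).segment_subset hx.1 hy.1).trans hb)⟩
  obtain ⟨r, hr, c, hc, L, hL, H⟩ := S.cone hz
  set B := ‖S.b z‖ with hB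
  have hB0 : 0 ≤ B := norm_nonneg _
  set D := 2 * L / c with hD
  have hD0 : 0 < D := by positivity
  set r' := r / (3 + 4 * D * B) with hr'
  have hden : 0 < 3 + 4 * D * B := by positivity
  have hr'0 : 0 < r' := by positivity
  have hrr : r' * (3 + 4 * D * B) = r := by rw [hr']; field_simp
  refine ⟨r', hr'0, C0 S * (2 * D * B + 1), by have := C0_nonneg S; positivity, fun x hx y hy => ?_⟩
  obtain ⟨hx, hxΩ⟩ := hx
  obtain ⟨hy, hyΩ⟩ := hy
  rw [mem_ball, dist_eq_norm] at hx hy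
  set d := ‖y - x‖ with hd
  have hd0 : 0 ≤ d := norm_nonneg _
  have hd2 : d ≤ 2 * r' := by
    have : y - x = (y - z) - (x - z) := by abel
    rw [hd, this]; have := norm_sub_le (y - z) (x - z); linarith
  set s := D * d with hs
  have hs0 : 0 ≤ s := by positivity
  have hsB : s * B ≤ 2 * r' * D * B := by
    rw [hs]; have := mul_le_mul_of_nonneg_left hd2 (mul_nonneg hD0.le hB0); nlinarith
  -- vertical segments
  have vert : ∀ x, ‖x - z‖ < r' → x ∈ S.Ω → ∀ τ ∈ Icc 0 s, x + τ • S.b z ∈ S.Ω ∧ x + τ • S.b z ∈ ball z r := by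
    intro x hx hxΩ τ hτ
    have hb1 : x + τ • S.b z ∈ ball z r := by
      rw [mem_ball, dist_eq_norm]
      have e : x + τ • S.b z - z = (x - z) + τ • S.b z := by abel
      rw [e]
      have h1 := norm_add_le (x - z) (τ • S.b z)
      rw [norm_smul, Real.norm_of_nonneg hτ.1, ← hB] at h1
      have h2 : τ * B ≤ s * B := mul_le_mul_of_nonneg_right hτ.2 hB0
      nlinarith [mul_nonneg (mul_nonneg hr'0.le hD0.le) hB0]
    have hb2 : x ∈ ball z r := by
      rw [mem_ball, dist_eq_norm]; nlinarith [mul_nonneg (mul_nonneg hr'0.le hD0.le) hB0]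
    refine ⟨?_, hb1⟩
    have h3 := H x hb2 _ hb1 τ hτ.1
    have e : x + τ • S.b z - x - τ • S.b z = 0 := by abel
    rw [e, norm_zero, mul_zero, add_zero] at h3
    have h4 := S.mem_iff.1 hxΩ
    rw [S.mem_iff]
    nlinarith [mul_nonneg hc.le hτ.1]
  have seg1 : ∀ x, ‖x - z‖ < r' → x ∈ S.Ω → segment ℝ x (x + s • S.b z) ⊆ S.Ω := by
    intro x hx hxΩ
    rw [segment_eq_image']
    rintro _ ⟨t, ht, rfl⟩
    have := (vert x hx hxΩ (t * s) ⟨mul_nonneg ht.1 hs0, by nlinarith [ht.2]⟩).1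
    simpa [smul_smul] using this
  have seg2 : segment ℝ (x + s • S.b z) (y + s • S.b z) ⊆ S.Ω := by
    intro w hw
    have hwb : w ∈ ball z r := (convex_ball z r).segment_subset (vert x hx hxΩ s ⟨hs0, le_rfl⟩).2 (vert y hy hyΩ s ⟨hs0, le_rfl⟩).2 hw
    rw [segment_eq_image'] at hw
    obtain ⟨t, ht, rfl⟩ := hw
    have hb2 : x ∈ ball z r := by
      rw [mem_ball, dist_eq_norm]; nlinarith [mul_nonneg (mul_nonneg hr'0.le hD0.le) hB0]
    have h3 := H x hb2 _ hwb s hs0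
    have e : x + s • S.b z + t • (y + s • S.b z - (x + s • S.b z)) - x - s • S.b z = t • (y - x) := by
      rw [add_sub_add_right_eq_sub]; abel
    rw [S.mem_iff]
    show S.ρ (x + s • S.b z + t • (y + s • S.b z - (x + s • S.b z))) < 0
    replace h3 : S.ρ (x + s • S.b z + t • (y + s • S.b z - (x + s • S.b z))) - S.ρ x ≤ -c * s + L * ‖x + s • S.b z + t • (y + s • S.b z - (x + s • S.b z)) - x - s • S.b z‖ := h3
    rw [e, norm_smul, Real.norm_of_nonneg ht.1, ← hd] at h3
    have h4 := S.mem_iff.1 hxΩ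
    have h5 : c * s = 2 * L * d := by rw [hs, hD]; field_simp
    have h6 : L * (t * d) ≤ L * d := mul_le_mul_of_nonneg_left (by nlinarith [ht.2]) hL.le
    nlinarith [mul_nonneg hL.le hd0]
  have k1 := Wc_seg hα (seg1 x hx hxΩ)
  have k2 := Wc_seg hα seg2
  have k3 := Wc_seg hα (x := y + s • S.b z) (y := y) (by rw [segment_symm]; exact seg1 y hy hyΩ)
  have e1 : x + s • S.b z - x = s • S.b z := by abel
  have e2 : y + s • S.b z - (x + s • S.b z) = y - x := by abel
  have e3 : y - (y + s • S.b z) = -(s • S.b z) := by abel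
  rw [e1, norm_smul, Real.norm_of_nonneg hs0, ← hB] at k1
  rw [e2, ← hd] at k2
  rw [e3, norm_neg, norm_smul, Real.norm_of_nonneg hs0, ← hB] at k3
  have : C0 S * (2 * D * B + 1) * d = C0 S * (s * B) + C0 S * d + C0 S * (s * B) := by rw [hs]; ring
  linarith

lemma lip_of_local {Ω : Set (Eu n)} (hc : IsCompact (closure Ω)) {f : Eu n → ℝ}
    (H : ∀ z ∈ closure Ω, ∃ r > 0, ∃ L : ℝ, 0 ≤ L ∧ ∀ x ∈ ball z r ∩ Ω, ∀ y ∈ ball z r ∩ Ω, f y ≤ f x + L * ‖y - x‖) :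
    ∃ K : NNReal, LipschitzOnWith K f Ω := by
  choose! r hr L hL hf using H
  obtain ⟨t, ht, hcov⟩ := hc.elim_nhds_subcover (fun z => ball z (r z)) fun z hz => ball_mem_nhds z (hr z hz)
  obtain ⟨δ, hδ, hleb⟩ := lebesgue_number_lemma_of_metric (s := closure Ω) (c := fun i : t => ball (i : Eu n) (r i)) hc
    (fun i => isOpen_ball) (by intro x hx; have := hcov hx; simpa using this)
  obtain ⟨Lm, hLm⟩ := (t.finite_toSet.image L).bddAbove
  have hbd : ∃ M, ∀ x ∈ Ω, |f x| ≤ M := by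
    have : ∀ z ∈ t, ∃ M, ∀ x ∈ ball z (r z) ∩ Ω, |f x| ≤ M := by
      intro z hz
      obtain ⟨x0, hx0, hd⟩ := Metric.mem_closure_iff.1 (ht z hz) (r z) (hr z (ht z hz))
      refine ⟨|f x0| + L z * (2 * r z), fun x hx => ?_⟩
      have hx0' : x0 ∈ ball z (r z) ∩ Ω := ⟨by rwa [mem_ball, dist_comm], hx0⟩
      have h1 := hf z (ht z hz) x hx x0 hx0'
      have h2 := hf z (ht z hz) x0 hx0' x hx
      have h3 : ‖x - x0‖ ≤ 2 * r z := by
        rw [← dist_eq_norm]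
        have := dist_triangle x z x0
        have := hx.1
        rw [mem_ball] at this
        linarith
      have h4 := mul_le_mul_of_nonneg_left h3 (hL z (ht z hz))
      rw [norm_sub_rev] at h1
      rw [abs_le]; constructor <;> linarith [neg_abs_le (f x0), le_abs_self (f x0)]
    choose! M hM using this
    obtain ⟨Mm, hMm⟩ := (t.finite_toSet.image M).bddAbove
    refine ⟨Mm, fun x hx => ?_⟩
    obtain ⟨z, hz, hxz⟩ := mem_iUnion₂.1 (hcov (subset_closure hx))
    exact (hM z hz x ⟨hxz, hx⟩).trans (hMm ⟨z, hz, rfl⟩)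
  obtain ⟨M, hM⟩ := hbd
  refine ⟨Real.toNNReal (max Lm (2 * M / δ)), LipschitzOnWith.of_le_add_mul _ fun x hx y hy => ?_⟩
  have h0 : max Lm (2 * M / δ) ≤ (Real.toNNReal (max Lm (2 * M / δ)) : ℝ) := Real.le_coe_toNNReal _
  by_cases hxy : dist x y < δ
  · obtain ⟨i, hi⟩ := hleb x (subset_closure hx)
    have h1 := hf i (ht i i.2) y ⟨hi (by rwa [mem_ball, dist_comm]), hy⟩ x ⟨hi (mem_ball_self hδ), hx⟩
    rw [← dist_eq_norm] at h1
    have h2 : L i ≤ Lm := hLm ⟨i, i.2, rfl⟩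
    have h3 : L i * dist x y ≤ (Real.toNNReal (max Lm (2 * M / δ)) : ℝ) * dist x y :=
      mul_le_mul_of_nonneg_right ((h2.trans (le_max_left _ _)).trans h0) dist_nonneg
    linarith
  · push Not at hxy
    have h2 : 2 * M / δ * dist x y ≤ (Real.toNNReal (max Lm (2 * M / δ)) : ℝ) * dist x y :=
      mul_le_mul_of_nonneg_right ((le_max_right _ _).trans h0) dist_nonneg
    have hM0 : 0 ≤ M := (abs_nonneg _).trans (hM x hx)
    have h3 : 2 * M ≤ 2 * M / δ * dist x y := by
      rw [div_mul_eq_mul_div, le_div_iff₀ hδ]; exact mul_le_mul_of_nonneg_left hxy (by positivity)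
    have := abs_le.1 (hM x hx)
    have := abs_le.1 (hM y hy)
    linarith

lemma deriv_nonneg_right {g : ℝ → ℝ} {g' : ℝ} (hg : HasDerivAt g g' 0) (h : ∀ᶠ s in 𝓝[>] (0:ℝ), g 0 ≤ g s) : 0 ≤ g' := by
  have := (hasDerivAt_iff_tendsto_slope_zero.1 hg).mono_left (nhdsGT_le_nhdsNE 0)
  refine ge_of_tendsto this ?_
  filter_upwards [h, self_mem_nhdsWithin] with s hs hs0
  simp only [zero_add, smul_eq_mul]
  have : (0:ℝ) < s := hs0
  exact mul_nonneg (by positivity) (by linarith)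

lemma line_deriv {φ : Eu n → ℝ} {x : Eu n} (hφ : DifferentiableAt ℝ φ x) (q : Eu n) :
    HasDerivAt (fun s : ℝ => φ (x + s • q)) (inner ℝ (gradient φ x) q) 0 := by
  have h1 : HasDerivAt (fun s : ℝ => x + s • q) q 0 := by
    have := ((hasDerivAt_id (0:ℝ)).smul_const q).const_add x
    simpa using this
  have h2 : HasFDerivAt φ (fderiv ℝ φ x) (x + (0:ℝ) • q) := by simpa using hφ.hasFDerivAt
  have h3 := h2.comp_hasDerivAt (0:ℝ) h1
  have e : inner ℝ (gradient φ x) q = fderiv ℝ φ x q := by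
    rw [gradient]; simp
  rw [e]; exact h3

lemma step_local (hα : Coef S α) {x : Eu n} (hx : x ∈ S.Ω) (p : Eu n) {σ : ℝ} (hσ : 0 < σ) :
    ∃ h0 > 0, ∀ h ∈ Ioc 0 h0, ∀ y, ‖y - x‖ ≤ h0 → ∀ q, ‖q - ((2:ℝ) • mv (α x) p + S.b x)‖ ≤ h0 →
      Step S α y q h (mquad (α x) p + σ) := by
  obtain ⟨d, hd, H⟩ := rate_near_unif hα ‖p‖ hσ
  obtain ⟨r, hr, hb⟩ := Metric.isOpen_iff.1 S.isOpen x hx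
  set q0 := (2:ℝ) • mv (α x) p + S.b x with hq0
  set e := min d (r / 2) with he
  have he0 : 0 < e := lt_min hd (by linarith)
  set h0 := min d (min 1 (e / (3 * (2 + ‖q0‖)))) with hh0
  have hQ : 0 < 3 * (2 + ‖q0‖) := by positivity
  have hh00 : 0 < h0 := lt_min hd (lt_min one_pos (by positivity))
  have a1 : h0 ≤ d := min_le_left _ _
  have a2 : h0 ≤ 1 := (min_le_right _ _).trans (min_le_left _ _)
  have a3 : h0 * (3 * (2 + ‖q0‖)) ≤ e := by
    rw [← le_div_iff₀ hQ]; exact (min_le_right _ _).trans (min_le_right _ _)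
  refine ⟨h0, hh00, fun h hh y hy q hq => ⟨hh.1, p, h0, hh00, d, hd, fun s hs z hz => ?_⟩⟩
  have hqn : ‖q‖ ≤ 1 + ‖q0‖ := by
    have := norm_sub_norm_le q q0
    linarith
  have hzx : ‖x - z‖ ≤ e := by
    have e1 : x - z = -(z - (y + s • q)) - (y - x) - s • q := by abel
    rw [e1]
    have n1 := norm_sub_le (-(z - (y + s • q)) - (y - x)) (s • q)
    have n2 := norm_sub_le (-(z - (y + s • q))) (y - x)
    rw [norm_neg] at n2
    rw [norm_smul, Real.norm_of_nonneg hs.1] at n1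
    have n3 : s * ‖q‖ ≤ h0 * (1 + ‖q0‖) := mul_le_mul (hs.2.trans hh.2) hqn (norm_nonneg _) hh00.le
    have : 0 ≤ h0 * ‖q0‖ := by positivity
    nlinarith
  have hzΩ : z ∈ S.Ω := hb (by
    rw [mem_ball, dist_comm, dist_eq_norm]
    have := min_le_right d (r / 2)
    linarith)
  refine ⟨hzΩ, fun A _ hc => ?_⟩
  exact H x (subset_closure hx) z (subset_closure hzΩ) (hzx.trans (min_le_left _ _)) A hc p le_rfl q (hq.trans a1)
end

open Set Filter Metric Topology
open scoped ENNReal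

noncomputable section
variable {n : ℕ} {S : SettingB n} {α : Eu n → Matrix (Fin n) (Fin n) ℝ}

lemma Wc_ext (hα : Coef S α) : ∃ V : Eu n → ℝ, (∃ K, LipschitzWith K V) ∧ ∀ x ∈ S.Ω, V x = Wc S α x := by
  obtain ⟨K, hK⟩ := lip_of_local S.cpt (fun z hz => Wc_locLip hα hz)
  obtain ⟨V, hV, he⟩ := hK.extend_real
  exact ⟨V, ⟨K, hV⟩, fun x hx => (he hx).symm⟩

lemma Wc_visc (hα : Coef S α) {V : Eu n → ℝ} (hV : ∀ x ∈ S.Ω, V x = Wc S α x) : ViscSub (Ham α S.b) S.Ω V := by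
  intro φ hφ x hx hmax
  refine le_of_forall_pos_le_add fun σ hσ => ?_
  rw [zero_add]
  set p := gradient φ x with hp
  set q := (2:ℝ) • mv (α x) p + S.b x with hq
  obtain ⟨h0, hh0, H⟩ := step_local hα hx p hσ
  have hl := line_deriv (hφ.differentiable (by norm_num) x) (-q)
  have hg : HasDerivAt (fun s : ℝ => φ (x + s • (-q)) + s * (mquad (α x) p + σ)) (inner ℝ p (-q) + 1 * (mquad (α x) p + σ)) 0 :=
    hl.add ((hasDerivAt_id (0:ℝ)).mul_const _)
  have h1 := deriv_nonneg_right hg ?_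
  · have e : inner ℝ p q = 2 * mquad (α x) p + inner ℝ (S.b x) p := by
      rw [hq, inner_add_right, inner_smul_right, mquad_eq, real_inner_comm p (mv _ _), real_inner_comm p (S.b x)]
    rw [inner_neg_right, e] at h1
    rw [Ham, dotp_eq]
    linarith
  · have hc : Tendsto (fun s : ℝ => x + s • (-q)) (𝓝[>] 0) (𝓝 x) := by
      have : Continuous (fun s : ℝ => x + s • (-q)) := by fun_prop
      have := this.tendsto 0
      simp only [zero_smul, add_zero] at this
      exact this.mono_left nhdsWithin_le_nhds
    have hm : ∀ᶠ y in 𝓝 x, V y - φ y ≤ V x - φ x := by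
      have := hmax
      rw [IsLocalMaxOn, IsMaxFilter, S.isOpen.nhdsWithin_eq hx] at this
      exact this
    filter_upwards [hc.eventually hm, hc (S.isOpen.mem_nhds hx), hc (Metric.closedBall_mem_nhds x hh0), Ioc_mem_nhdsGT hh0] with s h2 h3 h4 h5
    have hst := H s h5 (x + s • (-q)) (by
      have : x + s • (-q) ∈ closedBall x h0 := h4
      rwa [mem_closedBall, dist_eq_norm] at this) q (by simp [hq, hh0.le])
    have h6 := Wc_step hα hst
    have e : x + s • (-q) + s • q = x := by simp
    rw [e, ← hV x hx, ← hV _ h3] at h6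
    simp only [zero_smul, add_zero, zero_mul]
    linarith

lemma visc_step (hα : Coef S α) {u : Eu n → ℝ} (hu : ContinuousOn u (closure S.Ω)) (hv : ViscSub (Ham α S.b) S.Ω u)
    {x q : Eu n} {h ℓ : ℝ} (hs : Step S α x q h ℓ) : u (x + h • q) ≤ u x + h * ℓ := by
  by_contra hcon
  push Not at hcon
  have hℓ := hs.nonneg hα
  have hxΩ := hs.memL
  have hyΩ := hs.memR
  obtain ⟨h0, p, r, hr, ϖ, hϖ, H⟩ := hs
  have hq : q ≠ 0 := by
    rintro rfl
    simp only [smul_zero, add_zero] at hcon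
    nlinarith
  have hq2 : 0 < ‖q‖ ^ 2 := by have := norm_pos_iff.2 hq; positivity
  have hqn : 0 < ‖q‖ := norm_pos_iff.2 hq
  obtain ⟨c, hc1, hc2⟩ : ∃ c, ℓ < c ∧ u x + h * c < u (x + h • q) := by
    refine ⟨ℓ + (u (x + h • q) - u x - h * ℓ) / (2 * h), ?_, ?_⟩
    · have : 0 < (u (x + h • q) - u x - h * ℓ) / (2 * h) := div_pos (by linarith) (by linarith)
      linarith
    · have : h * (ℓ + (u (x + h • q) - u x - h * ℓ) / (2 * h)) = h * ℓ + (u (x + h • q) - u x - h * ℓ) / 2 := by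
        field_simp
      rw [this]; linarith
  have hc0 : 0 < c := by linarith
  set γ := u (x + h • q) - u x - h * c with hγ
  have hγ0 : 0 < γ := by rw [hγ]; linarith
  obtain ⟨Mu, hMu⟩ := S.cpt.exists_bound_of_continuousOn hu
  have hMu0 : 0 ≤ Mu := (norm_nonneg _).trans (hMu x (subset_closure hxΩ))
  -- continuity at x
  have hcx : ContinuousAt u x := (hu.mono subset_closure).continuousAt (S.isOpen.mem_nhds hxΩ)
  obtain ⟨r1, hr1, hcx1⟩ := Metric.continuousAt_iff.1 hcx (γ / 2) (by linarith)
  set r0 := min (r / 2) (r1 / 2) with hr0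
  have hr00 : 0 < r0 := lt_min (by linarith) (by linarith)
  set r' := r / (2 * ‖q‖) with hr'
  have hr'0 : 0 < r' := by positivity
  set η := r0 ^ 2 / (2 * Mu + 1) with hη
  have hη0 : 0 < η := by positivity
  have hη1 : r0 ^ 2 / η = 2 * Mu + 1 := by rw [hη]; field_simp
  set δ := γ / 2 with hδ
  have hδ0 : 0 < δ := by rw [hδ]; linarith
  obtain ⟨Λ, hΛ0, hΛ⟩ : ∃ Λ : ℝ, 0 < Λ ∧ 2 * Mu + 1 + δ < δ * Real.exp (Λ * r') := by
    refine ⟨(2 * Mu + 1 + δ) / (δ * r'), by positivity, ?_⟩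
    have e : (2 * Mu + 1 + δ) / (δ * r') * r' = (2 * Mu + 1 + δ) / δ := by field_simp
    rw [e]
    have := Real.add_one_le_exp ((2 * Mu + 1 + δ) / δ)
    have h2 : δ * ((2 * Mu + 1 + δ) / δ + 1) ≤ δ * Real.exp ((2 * Mu + 1 + δ) / δ) := by gcongr
    have h3 : δ * ((2 * Mu + 1 + δ) / δ + 1) = 2 * Mu + 1 + δ + δ := by field_simp
    linarith
  set sc : Eu n → ℝ := fun z => inner ℝ (z - x) q / ‖q‖ ^ 2 with hsc
  set w2 : Eu n → ℝ := fun z => ‖z - x‖ ^ 2 - sc z ^ 2 * ‖q‖ ^ 2 with hw2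
  have hw2e : ∀ z, w2 z = ‖z - x - sc z • q‖ ^ 2 := by
    intro z
    rw [norm_sub_sq_real, inner_smul_right, norm_smul, mul_pow, Real.norm_eq_abs, sq_abs]
    have : inner ℝ (z - x) q = sc z * ‖q‖ ^ 2 := by simp only [hsc]; field_simp
    rw [this]; simp only [hw2]; ring
  have hsccd : ContDiff ℝ 1 sc := by
    simp only [hsc]; exact ((contDiff_id.sub contDiff_const).inner ℝ contDiff_const).div_const _
  have hw2cd : ContDiff ℝ 1 w2 := by
    simp only [hw2]; exact ((contDiff_id.sub contDiff_const).norm_sq ℝ).sub ((hsccd.pow 2).mul contDiff_const)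
  set φ : Eu n → ℝ := fun z => c * sc z + δ * Real.exp (Λ * (sc z - h)) + w2 z / η with hφ
  have hφcd : ContDiff ℝ 1 φ := by
    simp only [hφ]
    exact ((contDiff_const.mul hsccd).add (contDiff_const.mul (Real.contDiff_exp.comp (contDiff_const.mul (hsccd.sub contDiff_const))))).add (hw2cd.div_const _)
  set D : Set (Eu n) := {z | 0 ≤ sc z ∧ sc z ≤ h + r' ∧ w2 z ≤ r0 ^ 2} with hD
  have hscl : ∀ (z : Eu n) (τ : ℝ), sc (z + τ • q) = sc z + τ := by
    intro z τ
    simp only [hsc]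
    have : z + τ • q - x = (z - x) + τ • q := by abel
    rw [this, inner_add_left, inner_smul_left, real_inner_self_eq_norm_sq]
    simp only [conj_trivial]; field_simp
  have hw2l : ∀ (z : Eu n) (τ : ℝ), w2 (z + τ • q) = w2 z := by
    intro z τ
    rw [hw2e, hw2e, hscl]
    congr 2
    rw [add_smul]; abel
  have hscx : sc x = 0 := by simp [hsc]
  have hw2x : w2 x = 0 := by simp [hw2, hscx]
  have hDt : ∀ z ∈ D, ∃ s ∈ Icc 0 h, ‖z - (x + s • q)‖ ≤ r := by
    rintro z ⟨z1, z2, z3⟩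
    have hw : ‖z - x - sc z • q‖ ≤ r / 2 := by
      rw [hw2e] at z3
      have := abs_le_of_sq_le_sq z3 hr00.le
      have := min_le_left (r / 2) (r1 / 2)
      linarith [this, le_of_sq_le_sq z3 hr00.le]
    rcases le_total (sc z) h with hh | hh
    · refine ⟨sc z, ⟨z1, hh⟩, ?_⟩
      rw [← sub_sub]; linarith
    · refine ⟨h, ⟨h0.le, le_rfl⟩, ?_⟩
      have e : z - (x + h • q) = (z - x - sc z • q) + (sc z - h) • q := by rw [sub_smul]; abel
      rw [e]
      have n1 := norm_add_le (z - x - sc z • q) ((sc z - h) • q)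
      rw [norm_smul, Real.norm_of_nonneg (by linarith : 0 ≤ sc z - h)] at n1
      have n2 : (sc z - h) * ‖q‖ ≤ r' * ‖q‖ := by gcongr; linarith
      have n3 : r' * ‖q‖ = r / 2 := by rw [hr']; field_simp
      linarith
  have hDΩ : D ⊆ S.Ω := fun z hz => by
    obtain ⟨s, hs, h1⟩ := hDt z hz
    exact (H s hs z h1).1
  have hDc : IsCompact D := by
    refine S.cpt.of_isClosed_subset ?_ (hDΩ.trans subset_closure)
    have c1 := hsccd.continuous
    have c2 := hw2cd.continuous
    exact (isClosed_le continuous_const c1).inter ((isClosed_le c1 continuous_const).inter (isClosed_le c2 continuous_const))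
  have hyD : x + h • q ∈ D := by
    refine ⟨?_, ?_, ?_⟩
    · rw [hscl, hscx]; linarith
    · rw [hscl, hscx]; linarith
    · rw [hw2l, hw2x]; positivity
  obtain ⟨z0, hz0, hmax⟩ := hDc.exists_isMaxOn ⟨_, hyD⟩ (f := fun z => u z - φ z)
    ((hu.mono (hDΩ.trans subset_closure)).sub hφcd.continuous.continuousOn)
  have hge : u x + δ ≤ u z0 - φ z0 := by
    have := hmax hyD
    simp only [mem_setOf_eq] at this
    refine le_trans ?_ this
    simp only [hφ]
    rw [hscl, hscx, hw2l, hw2x]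
    simp only [zero_add, sub_self, mul_zero, Real.exp_zero, mul_one, zero_div, add_zero]
    rw [hδ]; linarith
  have hz0Ω := hDΩ hz0
  have hub := abs_le.1 (hMu z0 (subset_closure hz0Ω))
  have hux := abs_le.1 (hMu x (subset_closure hxΩ))
  have hw20 : 0 ≤ w2 z0 := by rw [hw2e]; positivity
  have hexp := Real.exp_pos (Λ * (sc z0 - h))
  have hφge : φ z0 = c * sc z0 + δ * Real.exp (Λ * (sc z0 - h)) + w2 z0 / η := rfl
  have q1 : 0 ≤ c * sc z0 := mul_nonneg hc0.le hz0.1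
  have q2 : 0 ≤ w2 z0 / η := by positivity
  have q3 : 0 ≤ δ * Real.exp (Λ * (sc z0 - h)) := by positivity
  have s1 : 0 < sc z0 := by
    refine lt_of_le_of_ne hz0.1 fun hh => ?_
    have h1 : dist z0 x < r1 := by
      rw [dist_eq_norm]
      have : ‖z0 - x‖ ^ 2 ≤ r0 ^ 2 := by
        have := hz0.2.2
        simp only [hw2, ← hh] at this
        simpa using this
      have := le_of_sq_le_sq this hr00.le
      have := min_le_right (r / 2) (r1 / 2)
      linarith
    have h2 := hcx1 h1
    rw [Real.dist_eq] at h2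
    have := (abs_lt.1 h2).2
    have : 0 < δ * Real.exp (Λ * (sc z0 - h)) := by positivity
    linarith
  have s2 : sc z0 < h + r' := by
    refine lt_of_le_of_ne hz0.2.1 fun hh => ?_
    rw [hh] at hφge
    have e : Λ * (h + r' - h) = Λ * r' := by ring
    rw [e] at hφge
    have : 0 ≤ c * (h + r') := by positivity
    linarith
  have s3 : w2 z0 < r0 ^ 2 := by
    refine lt_of_le_of_ne hz0.2.2 fun hh => ?_
    rw [hh, hη1] at hφge
    linarith
  have hloc : IsLocalMaxOn (fun y => u y - φ y) S.Ω z0 := by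
    have hDn : D ∈ 𝓝 z0 := by
      have c1 := hsccd.continuous
      have c2 := hw2cd.continuous
      filter_upwards [c1.continuousAt.eventually (lt_mem_nhds s1), c1.continuousAt.eventually (gt_mem_nhds s2),
        c2.continuousAt.eventually (gt_mem_nhds s3)] with z a1 a2 a3
      exact ⟨le_of_lt a1, le_of_lt a2, le_of_lt a3⟩
    rw [IsLocalMaxOn, IsMaxFilter]
    refine Filter.Eventually.filter_mono nhdsWithin_le_nhds ?_
    filter_upwards [hDn] with z hz
    exact hmax hz
  have hvz := hv φ hφcd z0 hz0Ω hloc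
  rw [Ham, dotp_eq] at hvz
  obtain ⟨s, hs, hzs⟩ := hDt z0 hz0
  have hmem := hα.mem z0 (subset_closure hz0Ω)
  have hrate := (H s hs z0 hzs).2 (α z0) hmem (MClose.refl hϖ.le _)
  have hle := le_rate S.θpos hmem (S.b z0) p q (gradient φ z0)
  have hline := line_deriv (hφcd.differentiable (by norm_num) z0) q
  have hline2 : HasDerivAt (fun s : ℝ => φ (z0 + s • q)) (c * 1 + δ * (Real.exp (Λ * (sc z0 + 0 - h)) * (Λ * 1)) + 0) 0 := by
    have e : (fun s : ℝ => φ (z0 + s • q)) = fun s : ℝ => c * (sc z0 + s) + δ * Real.exp (Λ * (sc z0 + s - h)) + w2 z0 / η := by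
      funext s; simp only [hφ]; rw [hscl, hw2l]
    rw [e]
    have d1 : HasDerivAt (fun s : ℝ => sc z0 + s) 1 0 := (hasDerivAt_id (0:ℝ)).const_add _
    exact ((d1.const_mul c).add (((((d1.sub_const h).const_mul Λ).exp)).const_mul δ)).add (hasDerivAt_const _ _)
  have := hline.unique hline2
  have : 0 < δ * (Real.exp (Λ * (sc z0 + 0 - h)) * (Λ * 1)) := by positivity
  linarith

theorem Vq_props (hα : Coef S α) : ∃ V : Eu n → ℝ, (∃ K, LipschitzWith K V) ∧ V 0 = 0 ∧ (∀ x ∈ closure S.Ω, 0 ≤ V x) ∧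
    (∀ x ∈ closure S.Ω, Vq α S.b S.Ω x = V x) ∧ (∀ x ∈ S.Ω, ∀ κ > 0, ∃ c, Chain S α x c ∧ c < V x + κ) ∧
    (∀ x q h ℓ, Step S α x q h ℓ → V (x + h • q) ≤ V x + h * ℓ) := by
  obtain ⟨V, ⟨K, hK⟩, hV⟩ := Wc_ext hα
  have hV0 : V 0 = 0 := by
    rw [hV 0 S.zero_mem]
    exact le_antisymm (Wc_le hα Chain.zero) (Wc_nonneg hα)
  refine ⟨V, ⟨K, hK⟩, hV0, ?_, ?_, ?_, ?_⟩
  · intro x hx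
    have : closure S.Ω ⊆ {x | 0 ≤ V x} := closure_minimal (fun y hy => by rw [mem_setOf_eq, hV y hy]; exact Wc_nonneg hα)
      (isClosed_le continuous_const hK.continuous)
    exact this hx
  · intro x hx
    refine le_antisymm (csSup_le ⟨V x, V, ⟨K, hK.lipschitzOnWith⟩, hV0, Wc_visc hα hV, rfl⟩ ?_) (le_csSup ⟨V x, ?_⟩ ⟨V, ⟨K, hK.lipschitzOnWith⟩, hV0, Wc_visc hα hV, rfl⟩)
    all_goals
      rintro _ ⟨u, ⟨K', hu⟩, hu0, hv, rfl⟩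
      have hch : ∀ y c, Chain S α y c → u y ≤ c := by
        intro y c hc
        induction hc with
        | zero => exact hu0.le
        | step _ hs ih => have := visc_step hα hu.continuousOn hv hs; linarith
      have hle : ∀ y ∈ S.Ω, u y ≤ V y := by
        intro y hy
        rw [hV y hy]
        exact le_csInf (exists_chain α hy) fun c hc => hch y c hc
      exact le_on_closure hle hu.continuousOn hK.continuous.continuousOn hx
  · intro x hx κ hκ
    rw [hV x hx]; exact Wc_approx hx hκ
  · intro x q h ℓ hs
    rw [hV _ hs.memL, hV _ hs.memR]; exact Wc_step hα hs
end

open Set Filter Metric Topology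
open scoped ENNReal

noncomputable section
variable {n : ℕ} {S : SettingB n} {α : Eu n → Matrix (Fin n) (Fin n) ℝ}

/-- quantitative exit property for a set of starting points -/
def RBase (S : SettingB n) (α : Eu n → Matrix (Fin n) (Fin n) ℝ) (U : Set (Eu n)) (m : ℝ)
    (K : Set (Eu n)) (ϖ T ε0 : ℝ) : Prop :=
  ∀ ε ∈ Ioo 0 ε0, ∀ (G γ t0 D0 : ℝ) (A : Eu n → ℝ → Matrix (Fin n) (Fin n) ℝ) (w : Eu n → ℝ → ℝ),
    0 ≤ G → 0 < γ → 0 ≤ D0 → PSub S ε G A w t0 (t0 + T) →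
    (∀ x ∈ K, ∀ t ∈ Ioc t0 (t0 + T), MClose ϖ (A x t) (α x)) →
    (∀ x ∈ frontier S.Ω, ∀ t ∈ Icc t0 (t0 + T), w x t ≤ -γ) →
    (∀ x ∈ closure S.Ω, w x t0 ≤ D0) →
    ∀ y ∈ U ∩ closure S.Ω, w y (t0 + T) ≤ D0 + G * T - γ * Real.exp (-m / ε)

lemma RBase.extend {U K : Set (Eu n)} {m ϖ T ε0 : ℝ} (h : RBase S α U m K ϖ T ε0) {T' : ℝ} (hT : 0 ≤ T) (hT' : T ≤ T') :
    RBase S α U m K ϖ T' ε0 := by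
  intro ε hε G γ t0 D0 A w hG hγ hD hw hA hb hi y hy
  have e : t0 + T' = t0 + (T' - T) + T := by ring
  have h1 := MP_const hε.1.le hG hw hi (fun x hx t ht => (hb x hx t ht).trans (by linarith))
  have := h ε hε G γ (t0 + (T' - T)) (D0 + G * (T' - T)) A w hG hγ (by have := mul_nonneg hG (sub_nonneg.2 hT'); linarith)
    (hw.mono (by linarith) (by linarith)) (fun x hx t ht => hA x hx t ⟨by linarith [ht.1], by linarith [ht.2]⟩)
    (fun x hx t ht => hb x hx t ⟨by linarith [ht.1], by linarith [ht.2]⟩)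
    (fun x hx => by
      have := h1 x hx (t0 + (T' - T)) ⟨by linarith, by linarith⟩
      have e : t0 + (T' - T) - t0 = T' - T := by ring
      rwa [e] at this) y hy
  rw [e]; linarith

def RSet (S : SettingB n) (α : Eu n → Matrix (Fin n) (Fin n) ℝ) (U : Set (Eu n)) (m : ℝ) : Prop :=
  ∃ K, IsCompact K ∧ K ⊆ S.Ω ∧ ∃ ϖ > 0, ∃ T > 0, ∃ ε0 > 0, RBase S α U m K ϖ T ε0

lemma RSet.mono {U U' : Set (Eu n)} {m m' : ℝ} (h : RSet S α U m) (hU : U' ⊆ U) (hm : m ≤ m') : RSet S α U' m' := by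
  obtain ⟨K, hK, hKΩ, ϖ, hϖ, T, hT, ε0, hε0, H⟩ := h
  refine ⟨K, hK, hKΩ, ϖ, hϖ, T, hT, ε0, hε0, ?_⟩
  intro ε hε G γ t0 D0 A w hG hγ hD hw hA hb hi y hy
  have h1 := H ε hε G γ t0 D0 A w hG hγ hD hw hA hb hi y ⟨hU hy.1, hy.2⟩
  have hε1 := hε.1
  have : γ * Real.exp (-m' / ε) ≤ γ * Real.exp (-m / ε) := by gcongr
  linarith

lemma RSet.union {U U' : Set (Eu n)} {m : ℝ} (h : RSet S α U m) (h' : RSet S α U' m) : RSet S α (U ∪ U') m := by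
  obtain ⟨K, hK, hKΩ, ϖ, hϖ, T, hT, ε0, hε0, H⟩ := h
  obtain ⟨K', hK', hKΩ', ϖ', hϖ', T', hT', ε0', hε0', H'⟩ := h'
  have H1 := H.extend hT.le (le_max_left T T')
  have H2 := H'.extend hT'.le (le_max_right T T')
  refine ⟨K ∪ K', hK.union hK', union_subset hKΩ hKΩ', min ϖ ϖ', lt_min hϖ hϖ', max T T', lt_max_of_lt_left hT,
    min ε0 ε0', lt_min hε0 hε0', ?_⟩
  intro ε hε G γ t0 D0 A w hG hγ hD hw hA hb hi y hy
  rcases hy with ⟨hy | hy, hyc⟩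
  · exact H1 ε ⟨hε.1, hε.2.trans_le (min_le_left _ _)⟩ G γ t0 D0 A w hG hγ hD hw
      (fun x hx t ht => (hA x (Or.inl hx) t ht).mono (min_le_left _ _)) hb hi y ⟨hy, hyc⟩
  · exact H2 ε ⟨hε.1, hε.2.trans_le (min_le_right _ _)⟩ G γ t0 D0 A w hG hγ hD hw
      (fun x hx t ht => (hA x (Or.inr hx) t ht).mono (min_le_right _ _)) hb hi y ⟨hy, hyc⟩

/-- exit property near a point -/
def Reach (S : SettingB n) (α : Eu n → Matrix (Fin n) (Fin n) ℝ) (x : Eu n) (m : ℝ) : Prop :=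
  ∃ ρ > 0, RSet S α (ball x ρ) m

lemma Reach.out {x : Eu n} (hx : x ∉ closure S.Ω) : Reach S α x 0 := by
  obtain ⟨r, hr, hb⟩ := Metric.isOpen_iff.1 isClosed_closure.isOpen_compl x hx
  refine ⟨r, hr, ∅, isCompact_empty, empty_subset _, 1, one_pos, 1, one_pos, 1, one_pos, ?_⟩
  intro ε hε G γ t0 D0 A w hG hγ hD hw hA hb' hi y hy
  exact absurd hy.2 (hb hy.1)

set_option maxHeartbeats 1600000 in
theorem Reach.pstep {c q : ℝ → Eu n} {h ℓ m κ r ϖ : ℝ} {K : Set (Eu n)} {p : Eu n} (hh : 0 < h)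
    (hc : ∀ s, HasDerivAt c (q s) s) (hK : IsCompact K) (hKΩ : K ⊆ S.Ω) (hr : 0 < r) (hϖ : 0 < ϖ)
    (hrate : ∀ s ∈ Icc 0 h, ∀ z ∈ S.Ω, ‖z - c s‖ ≤ r → ∀ A, memS S.θ₀ A → (z ∈ K → MClose ϖ A (α z)) →
      rate S.θ₀ A (S.b z) p (q s) ≤ ℓ) (hℓ : 0 ≤ ℓ) (hm : 0 ≤ m) (hκ : 0 < κ) (hR : Reach S α (c h) m) :
    Reach S α (c 0) (m + h * ℓ + κ) := by
  obtain ⟨ρ', hρ', K', hK', hKΩ', ϖ', hϖ', T, hT, ε0, hε0, H⟩ := hR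
  have hθ := S.θpos
  set r1 := min r ρ' with hr1
  have hr10 : 0 < r1 := lt_min hr hρ'
  -- constants; `κ` split
  set σ := h * ℓ + κ / 2 + κ / 4 with hσ
  have hσ0 : 0 < σ := by positivity
  set Q := (‖p‖ * r1 + σ) / r1 ^ 2 + 4 * (‖p‖ ^ 2 / κ) + 1 with hQ
  have hQ0 : 0 < Q := by positivity
  have hQ1 : ∀ d, r1 ≤ d → ‖p‖ * d - Q * d ^ 2 ≤ -σ := by
    intro d hd
    have hd0 : 0 < d := hr10.trans_le hd
    have a1 : (‖p‖ * r1 + σ) / r1 ^ 2 ≤ Q := by rw [hQ]; have : 0 ≤ 4 * (‖p‖ ^ 2 / κ) := by positivity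
                                                linarith
    rw [div_le_iff₀ (by positivity)] at a1
    have a2 : ‖p‖ * r1 - Q * r1 ^ 2 ≤ -σ := by linarith
    have a3 : ‖p‖ - Q * r1 ≤ 0 := by
      by_contra hcon
      push Not at hcon
      linarith [mul_pos hcon hr10]
    have a4 : (d - r1) * (‖p‖ - Q * r1) ≤ 0 := mul_nonpos_of_nonneg_of_nonpos (by linarith) a3
    have a5 : 0 ≤ Q * (d * (d - r1)) := by have : 0 ≤ d - r1 := by linarith
                                           positivity
    linarith
  have hQ2 : ‖p‖ ^ 2 / (4 * Q) ≤ κ / 16 := by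
    rw [div_le_iff₀ (by positivity)]
    have : 4 * (‖p‖ ^ 2 / κ) ≤ Q := by
      rw [hQ]; have : 0 ≤ (‖p‖ * r1 + σ) / r1 ^ 2 := by positivity
      linarith
    have h2 : κ / 16 * (4 * (4 * (‖p‖ ^ 2 / κ))) = ‖p‖ ^ 2 := by field_simp; ring
    have h3 : κ / 16 * (4 * (4 * (‖p‖ ^ 2 / κ))) ≤ κ / 16 * (4 * Q) := by gcongr
    linarith
  have hmaxv : ∀ y : Eu n, inner ℝ p y - Q * ‖y‖ ^ 2 - ‖p‖ ^ 2 / (4 * Q) ≤ 0 := by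
    intro y
    have h1 := real_inner_le_norm p y
    have h2 : ‖p‖ * ‖y‖ - Q * ‖y‖ ^ 2 - ‖p‖ ^ 2 / (4 * Q) = -(‖p‖ - 2 * Q * ‖y‖) ^ 2 / (4 * Q) := by field_simp; ring
    have h3 : 0 ≤ (‖p‖ - 2 * Q * ‖y‖) ^ 2 / (4 * Q) := by positivity
    rw [neg_div] at h2
    linarith
  set κ' := κ / (16 * h) with hκ'
  have hκ'0 : 0 < κ' := by positivity
  set ρ'' := min 1 (κ / (16 * (‖p‖ + Q))) with hρ''
  have hpQ : 0 < ‖p‖ + Q := by positivity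
  have hρ''0 : 0 < ρ'' := lt_min one_pos (by positivity)
  set ε1 := min ε0 (min (κ / 8) (κ' * S.θ₀ / (2 * Q * n + 1))) with hε1
  have hε10 : 0 < ε1 := lt_min hε0 (lt_min (by positivity) (by positivity))
  refine ⟨ρ'', hρ''0, K ∪ K', hK.union hK', union_subset hKΩ hKΩ', min ϖ ϖ', lt_min hϖ hϖ', T + h, by linarith, ε1, hε10, ?_⟩
  intro ε hε G γ t0 D0 A w hG hγ hD hw hA hb hi y hy
  have hεp := hε.1
  have hεa : ε < ε0 := hε.2.trans_le (min_le_left _ _)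
  have hεb : ε < κ / 8 := hε.2.trans_le ((min_le_right _ _).trans (min_le_left _ _))
  have hεc : ε < κ' * S.θ₀ / (2 * Q * n + 1) := hε.2.trans_le ((min_le_right _ _).trans (min_le_right _ _))
  have hεd : 2 * Q * ε * (n * S.θ₀⁻¹) < κ' := by
    rw [lt_div_iff₀ (by positivity)] at hεc
    have : 2 * Q * ε * (n * S.θ₀⁻¹) = ε * (2 * Q * n) / S.θ₀ := by field_simp
    rw [this, div_lt_iff₀ hθ]
    linarith
  set t1 := t0 + T with ht1
  have et2 : t0 + (T + h) = t1 + h := by rw [ht1]; ring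
  rw [et2] at hw hA hb ⊢
  set D1 := D0 + G * T with hD1
  have hD10 : 0 ≤ D1 := by positivity
  have hcst := MP_const hεp.le hG hw hi (fun x hx t ht => (hb x hx t ht).trans (by linarith))
  have hst := H ε ⟨hεp, hεa⟩ G γ t0 D0 A w hG hγ hD (hw.mono le_rfl (by linarith))
    (fun x hx t ht => (hA x (Or.inr hx) t ⟨ht.1, by linarith [ht.2]⟩).mono (min_le_right _ _))
    (fun x hx t ht => hb x hx t ⟨ht.1, by linarith [ht.2]⟩) hi
  have hw1 := hw.mono (s1 := t1) (by linarith) le_rfl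
  set g0 := γ * Real.exp (-m / ε) with hg0
  have hg00 : 0 < g0 := by positivity
  have hg01 : g0 ≤ γ := by
    have : Real.exp (-m / ε) ≤ 1 := Real.exp_le_one_iff.2 (div_nonpos_of_nonpos_of_nonneg (by linarith) hεp.le)
    rw [hg0]; exact mul_le_of_le_one_right hγ.le this
  set F := Real.exp (-σ / ε) with hF
  have hF0 : 0 < F := Real.exp_pos _
  set v : Eu n → ℝ → ℝ := fun x t => inner ℝ p (x - c (h - (t - t1))) - Q * ‖x - c (h - (t - t1))‖ ^ 2 - ‖p‖ ^ 2 / (4 * Q)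
    - (ℓ + κ') * (t - t1) with hv
  have hcc : Continuous c := continuous_iff_continuousAt.2 fun s => (hc s).continuousAt
  have hvle : ∀ x, ∀ t ∈ Icc t1 (t1 + h), v x t ≤ 0 := by
    intro x t ht
    have := hmaxv (x - c (h - (t - t1)))
    have h2 : 0 ≤ (ℓ + κ') * (t - t1) := mul_nonneg (by linarith) (by linarith [ht.1])
    simp only [hv]; linarith
  have hvfar : ∀ x, ∀ t ∈ Icc t1 (t1 + h), r1 ≤ ‖x - c (h - (t - t1))‖ → v x t ≤ -σ := by
    intro x t ht hx
    have := hQ1 _ hx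
    have h2 : 0 ≤ (ℓ + κ') * (t - t1) := mul_nonneg (by linarith) (by linarith [ht.1])
    have h3 := real_inner_le_norm p (x - c (h - (t - t1)))
    have h4 : 0 ≤ ‖p‖ ^ 2 / (4 * Q) := by positivity
    simp only [hv]; linarith
  have hexpfar : ∀ x, ∀ t ∈ Icc t1 (t1 + h), r1 ≤ ‖x - c (h - (t - t1))‖ → Real.exp (v x t / ε) ≤ F := by
    intro x t ht hx
    have := hvfar x t ht hx
    rw [hF]; gcongr
  have hexp1 : ∀ x, ∀ t ∈ Icc t1 (t1 + h), Real.exp (v x t / ε) ≤ 1 := fun x t ht =>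
    Real.exp_le_one_iff.2 (div_nonpos_of_nonpos_of_nonneg (hvle x t ht) hεp.le)
  have key := MP_exp hεp hw1 v (D1 + g0 * F) (-g0) ?_ ?_ ?_ ?_ y hy.2 (t1 + h) ⟨by linarith, le_rfl⟩
  · have hy1 : ‖y - c 0‖ ≤ ρ'' := by rw [← dist_eq_norm]; exact (mem_ball.1 hy.1).le
    have e1 : h - (t1 + h - t1) = 0 := by ring
    have hvy : -(h * ℓ + κ / 4) ≤ v y (t1 + h) := by
      simp only [hv]
      rw [e1]
      have a1 := abs_real_inner_le_norm p (y - c 0)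
      have a2 := (abs_le.1 a1).1
      have a3 : ρ'' ≤ 1 := min_le_left _ _
      have a4 : ρ'' * (16 * (‖p‖ + Q)) ≤ κ := by
        rw [← le_div_iff₀ (by positivity)]; exact min_le_right _ _
      have a5 : ‖p‖ * ‖y - c 0‖ ≤ ‖p‖ * ρ'' := by gcongr
      have a6 : Q * ‖y - c 0‖ ^ 2 ≤ Q * ρ'' := by
        have : ‖y - c 0‖ ^ 2 ≤ ρ'' := by 
          linarith [mul_self_le_mul_self (norm_nonneg (y - c 0)) hy1, mul_le_of_le_one_left hρ''0.le a3]
        gcongr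
      have a7 : (ℓ + κ') * (t1 + h - t1) = h * ℓ + κ / 16 := by rw [hκ']; field_simp; ring
      rw [a7]
      linarith
    have hE : Real.exp (-(h * ℓ + κ) / ε) ≤ Real.exp (v y (t1 + h) / ε) - F := by
      have b1 : Real.exp (-(h * ℓ + κ / 4) / ε) ≤ Real.exp (v y (t1 + h) / ε) := by gcongr
      have b2 : F = Real.exp (-(h * ℓ + κ / 4) / ε) * Real.exp (-(κ / 2) / ε) := by
        rw [hF, ← Real.exp_add]; congr 1; rw [hσ]; field_simp; ring
      have b3 : Real.exp (-(h * ℓ + κ) / ε) ≤ Real.exp (-(h * ℓ + κ / 4) / ε) * Real.exp (-(κ / 2) / ε) := by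
        rw [← Real.exp_add]
        apply Real.exp_le_exp.2
        rw [← add_div]; gcongr; linarith
      have b4 : Real.exp (-(κ / 2) / ε) ≤ 1 / 2 := by
        have : -(κ / 2) / ε ≤ -4 := by rw [div_le_iff₀ hεp]; linarith
        have h2 : Real.exp (-(κ / 2) / ε) ≤ Real.exp (-4) := Real.exp_le_exp.2 this
        have h3 : Real.exp (-4) ≤ 1 / 2 := by
          have := Real.add_one_le_exp (4:ℝ)
          rw [Real.exp_neg, inv_le_comm₀ (Real.exp_pos _) (by norm_num)]; linarith
        linarith
      have b5 := Real.exp_pos (-(h * ℓ + κ / 4) / ε)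
      linarith [mul_le_mul_of_nonneg_left b4 b5.le]
    have e2 : γ * Real.exp (-(m + h * ℓ + κ) / ε) = g0 * Real.exp (-(h * ℓ + κ) / ε) := by
      rw [hg0, mul_assoc, ← Real.exp_add]; congr 2; field_simp; ring
    rw [e2]
    have e3 := mul_le_mul_of_nonneg_left hE hg00.le
    have e4 : D0 + G * (T + h) = D1 + G * (t1 + h - t1) := by rw [hD1]; ring
    rw [e4]
    linarith
  · refine Continuous.continuousOn ?_
    simp only [hv]; fun_prop
  · intro x hx
    have ht1' : t1 ∈ Icc t1 (t1 + h) := ⟨le_rfl, by linarith⟩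
    have hx1 := hcst x hx t1 ⟨by linarith, by linarith⟩
    have e1 : t1 - t0 = T := by rw [ht1]; ring
    rw [e1] at hx1
    by_cases hf : r1 ≤ ‖x - c (h - (t1 - t1))‖
    · have := mul_le_mul_of_nonneg_left (hexpfar x t1 ht1' hf) hg00.le
      linarith
    · push Not at hf
      rw [sub_self, sub_zero] at hf
      have h1 := hst x ⟨by rw [mem_ball, dist_eq_norm]; exact hf.trans_le (min_le_right _ _), hx⟩
      have h2 := mul_le_mul_of_nonneg_left (hexp1 x t1 ht1') hg00.le
      have h3 : 0 < g0 * F := by positivity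
      linarith
  · intro x hx t ht
    have h1 := hb x hx t ⟨by linarith [ht.1], ht.2⟩
    have h2 := mul_le_mul_of_nonneg_left (hexp1 x t ht) hg00.le
    have h3 : 0 < g0 * F := by positivity
    have h4 : 0 ≤ G * (t - t1) := mul_nonneg hG (by linarith [ht.1])
    linarith
  · intro x hx t ht hlt
    have ht' : t ∈ Icc t1 (t1 + h) := ⟨ht.1.le, ht.2⟩
    have hnear : ‖x - c (h - (t - t1))‖ < r1 := by
      by_contra hf
      push Not at hf
      have h1 := mul_le_mul_of_nonneg_left (hexpfar x t ht' hf) hg00.le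
      have h2 := hcst x (subset_closure hx) t ⟨by linarith [ht.1], ht.2⟩
      have h3 : D0 + G * (t - t0) = D1 + G * (t - t1) := by rw [hD1, ht1]; ring
      linarith
    set s := h - (t - t1) with hs
    have hsI : s ∈ Icc 0 h := ⟨by linarith [ht.2], by linarith [ht.1]⟩
    have hmem := hw1.mem x hx t ht
    have hrt := hrate s hsI x hx (hnear.le.trans (min_le_left _ _)) (A x t) hmem
      (fun hxK => (hA x (Or.inl hxK) t ⟨by linarith [ht.1], ht.2⟩).mono (min_le_left _ _))
    have hle := le_rate hθ hmem (S.b x) p (q s) (p - (2 * Q) • (x - c s))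
    refine ⟨inner ℝ p (q s) - Q * (2 * inner ℝ (x - c s) (q s)) - 0 - (ℓ + κ') * 1, p - (2 * Q) • (x - c s), -(2 * Q), ?_, ?_, ?_⟩
    · have hcs : HasDerivAt (fun t : ℝ => x - c (h - (t - t1))) (q s) t := by
        have i1 : HasDerivAt (fun t : ℝ => h - (t - t1)) (-1) t := by
          simpa using ((hasDerivAt_id t).sub_const t1).const_sub h
        have i2 : HasDerivAt (fun t : ℝ => c (h - (t - t1))) ((-1 : ℝ) • q s) t :=
          HasDerivAt.scomp t (hc (h - (t - t1))) i1
        have := i2.const_sub x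
        simpa using this
      have j1 : HasDerivAt (fun t : ℝ => inner ℝ p (x - c (h - (t - t1)))) (inner ℝ p (q s)) t := by
        have := (hasDerivAt_const t p).inner ℝ hcs
        simpa using this
      have j2 : HasDerivAt (fun t : ℝ => ‖x - c (h - (t - t1))‖ ^ 2) (2 * inner ℝ (x - c s) (q s)) t := hcs.norm_sq
      have j3 : HasDerivAt (fun t : ℝ => (ℓ + κ') * (t - t1)) ((ℓ + κ') * 1) t :=
        ((hasDerivAt_id t).sub_const t1).const_mul _
      exact ((j1.sub (j2.const_mul Q)).sub (hasDerivAt_const _ _)).sub j3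
    · intro ξ
      have k1 := (Der2.inner_line p (x - c s) ξ).sub ((Der2.normsq_line (x - c s) ξ).const_mul Q)
      have k2 := k1.add (Der2.const (-(‖p‖ ^ 2 / (4 * Q)) - (ℓ + κ') * (t - t1)))
      refine (k2.congr (Eventually.of_forall fun τ => ?_)).congr_val ?_ ?_
      · simp only [hv, ← hs]
        have e : x + τ • ξ - c s = x - c s + τ • ξ := by abel
        rw [e]; ring
      · rw [inner_sub_left p, inner_smul_left]; simp only [conj_trivial]; ring
      · simp; ring
    · have htr := memS.diag_sum hmem
      have hloss : 2 * Q * ε * ∑ i, A x t i i ≤ 2 * Q * ε * (n * S.θ₀⁻¹) := by gcongr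
      have e1 : inner ℝ (p - (2 * Q) • (x - c s)) (q s) = inner ℝ p (q s) - Q * (2 * inner ℝ (x - c s) (q s)) := by
        rw [inner_sub_left p, inner_smul_left]; simp only [conj_trivial]; ring
      rw [e1] at hle
      have : 0 < g0 * ((mquad (A x t) (p - (2 * Q) • (x - c s)) + inner ℝ (S.b x) (p - (2 * Q) • (x - c s)) - 2 * Q * ε * ∑ i, A x t i i) - (inner ℝ p (q s) - Q * (2 * inner ℝ (x - c s) (q s)) - (ℓ + κ'))) := by
        apply mul_pos hg00; linarith
      have e2 : ε * -(2 * Q) * ∑ i, A x t i i = -(2 * Q * ε * ∑ i, A x t i i) := by ring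
      rw [e2]
      linarith
end

open Set Filter Metric Topology
open scoped ENNReal

noncomputable section
variable {n : ℕ} {S : SettingB n} {α : Eu n → Matrix (Fin n) (Fin n) ℝ}

lemma Reach.mono {x : Eu n} {m m' : ℝ} (h : Reach S α x m) (hm : m ≤ m') : Reach S α x m' := by
  obtain ⟨ρ, hρ, H⟩ := h
  exact ⟨ρ, hρ, H.mono le_rfl hm⟩

lemma line_hasDeriv (x q : Eu n) (s : ℝ) : HasDerivAt (fun s : ℝ => x + s • q) q s := by
  have := ((hasDerivAt_id s).smul_const q).const_add x
  simpa using this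

lemma Reach.chain (hα : Coef S α) {x : Eu n} {c : ℝ} (hc : Chain S α x c) : ∀ {m κ : ℝ}, 0 ≤ m → 0 < κ →
    Reach S α x m → Reach S α 0 (m + c + κ) := by
  induction hc with
  | zero => intro m κ hm hκ h; exact h.mono (by linarith)
  | @step x q h ℓ c hch hs ih =>
    intro m κ hm hκ hR
    have hℓ := hs.nonneg hα
    obtain ⟨hh, p, r, hr, ϖ, hϖ, H⟩ := hs
    set K : Set (Eu n) := (fun z : ℝ × Eu n => x + z.1 • q + z.2) '' (Icc 0 h ×ˢ closedBall 0 r) with hK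
    have hKc : IsCompact K := (isCompact_Icc.prod (isCompact_closedBall _ _)).image (by fun_prop)
    have hKΩ : K ⊆ S.Ω := by
      rintro _ ⟨⟨s, e⟩, ⟨hs, he⟩, rfl⟩
      refine (H s hs _ ?_).1
      simpa using he
    have := Reach.pstep (c := fun s => x + s • q) (q := fun _ => q) (p := p) hh (line_hasDeriv x q) hKc hKΩ hr hϖ
      (fun s hs z hz hzs A hA hAc => (H s hs z hzs).2 A hA (hAc ⟨(s, z - (x + s • q)), ⟨hs, by simpa using hzs⟩, by simp⟩))
      hℓ hm (half_pos hκ) hR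
    simp only [zero_smul, add_zero] at this
    have h2 := ih (κ := κ / 2) (by have := mul_nonneg hh.le hℓ; linarith) (half_pos hκ) this
    exact h2.mono (by linarith)

lemma Reach.exit {x0 : Eu n} (hx0 : x0 ∈ frontier S.Ω) {κ : ℝ} (hκ : 0 < κ) :
    ∃ s0 > (0:ℝ), ∀ s ∈ Ioc 0 s0, x0 + s • S.b x0 ∈ S.Ω ∧ Reach S α (x0 + s • S.b x0) κ := by
  obtain ⟨r, hr, c, hc, L, hL, H⟩ := S.cone hx0
  obtain ⟨B, hB, hbB⟩ := S.b_bdd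
  have hθ := S.θpos
  set ℓ := (2 * B) ^ 2 / (4 * S.θ₀) with hℓ
  have hℓ0 : 0 ≤ ℓ := by positivity
  set s0 := min (r / (2 * B)) (κ / (4 * (ℓ + 1))) with hs0
  refine ⟨s0, lt_min (by positivity) (by positivity), fun s hs => ?_⟩
  have hb0 := hbB x0 (S.front_sub hx0)
  have hsb : s * ‖S.b x0‖ < r := by
    have h1 : s * (2 * B) ≤ r := by rw [← le_div_iff₀ (by positivity)]; exact hs.2.trans (min_le_left _ _)
    have h2 : s * ‖S.b x0‖ ≤ s * B := mul_le_mul_of_nonneg_left hb0 hs.1.le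
    nlinarith [hs.1, norm_nonneg (S.b x0)]
  have hn : ‖s • S.b x0‖ < r := by rw [norm_smul, Real.norm_of_nonneg hs.1.le]; exact hsb
  have hm1 : x0 + s • S.b x0 ∈ ball x0 r := by rw [mem_ball, dist_eq_norm]; simpa using hn
  have hm2 : x0 - s • S.b x0 ∈ ball x0 r := by rw [mem_ball, dist_eq_norm]; simpa using hn
  have hm0 : x0 ∈ ball x0 r := mem_ball_self hr
  have hρ0 := S.ρ_front hx0
  have hcs : 0 < c * s := mul_pos hc hs.1
  have h1 : x0 + s • S.b x0 ∈ S.Ω := by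
    have := H x0 hm0 _ hm1 s hs.1.le
    simp only [add_sub_cancel_left, sub_self, norm_zero, mul_zero, add_zero] at this
    rw [S.mem_iff]; linarith
  have h2 : x0 - s • S.b x0 ∉ closure S.Ω := by
    intro hcon
    have := H _ hm2 _ hm0 s hs.1.le
    simp only [sub_sub_cancel, sub_self, norm_zero, mul_zero, add_zero] at this
    have := S.ρ_closure hcon
    linarith
  refine ⟨h1, ?_⟩
  have hR := Reach.out (α := α) h2
  have e1 : x0 - s • S.b x0 = x0 + s • S.b x0 + (2 * s) • (-S.b x0) := by
    rw [smul_neg, mul_smul, two_smul]; abel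
  rw [e1] at hR
  have := Reach.pstep (c := fun τ => x0 + s • S.b x0 + τ • (-S.b x0)) (q := fun _ => -S.b x0) (p := 0) (h := 2 * s)
    (ℓ := ℓ) (r := 1) (ϖ := 1) (K := ∅) (m := 0) (κ := κ / 2) (by linarith [hs.1]) (line_hasDeriv _ _) isCompact_empty (empty_subset _) one_pos one_pos
    (fun τ hτ z hz hzs A hA hAc => by
      rw [rate_zero, hℓ]
      have : ‖-S.b x0 - S.b z‖ ≤ 2 * B := by
        have a1 := norm_sub_le (-S.b x0) (S.b z)
        rw [norm_neg] at a1
        have := hbB z (subset_closure hz)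
        linarith
      gcongr) hℓ0 le_rfl (half_pos hκ) hR
  simp only [zero_smul, add_zero] at this
  refine this.mono ?_
  have : s * (4 * (ℓ + 1)) ≤ κ := by rw [← le_div_iff₀ (by positivity)]; exact hs.2.trans (min_le_right _ _)
  nlinarith [hs.1]

lemma Reach.flow {m : ℝ} (hm : 0 ≤ m) (hR : Reach S α 0 m) {κ : ℝ} (hκ : 0 < κ) {x : Eu n} (hx : x ∈ closure S.Ω) :
    Reach S α x (m + κ) := by
  obtain ⟨ρ, hρ, H⟩ := hR
  obtain ⟨T, hT, hTx⟩ := S.X_attract S.cpt (r := ρ / 2) (by linarith)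
  have h1 : Reach S α (S.X T x) m := by
    refine ⟨ρ / 2, by linarith, H.mono ?_ le_rfl⟩
    refine ball_subset_ball' ?_
    have := hTx T le_rfl x hx
    rw [dist_zero_right]; linarith
  have hθ := S.θpos
  have hK : (0:ℝ) ≤ S.K := S.K.2
  obtain ⟨r, hr, hrκ⟩ : ∃ r > 0, T * ((S.K * r) ^ 2 / (4 * S.θ₀)) < κ / 2 := by
    have hc : Continuous (fun r : ℝ => T * ((S.K * r) ^ 2 / (4 * S.θ₀))) := by fun_prop
    have h0 := hc.tendsto 0
    have h1 : ∀ᶠ r in 𝓝[>] (0:ℝ), T * ((S.K * r) ^ 2 / (4 * S.θ₀)) < κ / 2 := by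
      refine (h0.eventually (gt_mem_nhds ?_)).filter_mono nhdsWithin_le_nhds
      simpa using hκ
    obtain ⟨r, h2, h3⟩ := (h1.and self_mem_nhdsWithin).exists
    exact ⟨r, h3, h2⟩
  have := Reach.pstep (c := fun τ => S.X τ x) (q := fun τ => S.b (S.X τ x)) (p := 0) (h := T)
    (ℓ := (S.K * r) ^ 2 / (4 * S.θ₀)) (r := r) (ϖ := 1) (K := ∅) (m := m) (κ := κ / 2) hT (fun s => S.X_deriv x s) isCompact_empty (empty_subset _) hr one_pos
    (fun τ hτ z hz hzs A hA hAc => by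
      rw [rate_zero]
      have : ‖S.b (S.X τ x) - S.b z‖ ≤ S.K * r := by
        refine (S.b_bound _ _).trans ?_
        rw [norm_sub_rev]; gcongr
      gcongr) (by positivity) hm (half_pos hκ) h1
  simp only [S.X_zero] at this
  exact this.mono (by linarith)

theorem reach_all (hα : Coef S α) {V : Eu n → ℝ} (hVc : Continuous V) (hV0 : ∀ x ∈ closure S.Ω, 0 ≤ V x)
    (hVch : ∀ x ∈ S.Ω, ∀ κ > 0, ∃ c, Chain S α x c ∧ c < V x + κ) {x0 : Eu n} (hx0 : x0 ∈ frontier S.Ω) {κ : ℝ} (hκ : 0 < κ) :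
    RSet S α (closure S.Ω) (V x0 + κ) := by
  obtain ⟨s0, hs0, H⟩ := Reach.exit (α := α) hx0 (κ := κ / 8) (by linarith)
  have ht : Tendsto (fun s : ℝ => V (x0 + s • S.b x0)) (𝓝[>] 0) (𝓝 (V x0)) := by
    have : Continuous (fun s : ℝ => V (x0 + s • S.b x0)) := by fun_prop
    have := this.tendsto 0
    simp only [zero_smul, add_zero] at this
    exact this.mono_left nhdsWithin_le_nhds
  obtain ⟨s, hs1, hs2⟩ := ((ht.eventually (gt_mem_nhds (show V x0 < V x0 + κ / 8 by linarith))).and (Ioc_mem_nhdsGT hs0)).exists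
  obtain ⟨hΩ, hR⟩ := H s hs2
  obtain ⟨c, hc, hcV⟩ := hVch _ hΩ (κ / 8) (by linarith)
  have h1 := Reach.chain hα hc (κ := κ / 8) (by linarith) (by linarith) hR
  have hV1 := hV0 x0 (S.front_sub hx0)
  have h2 : Reach S α 0 (V x0 + κ / 2) := h1.mono (by linarith)
  have h3 : ∀ x ∈ closure S.Ω, Reach S α x (V x0 + κ) := fun x hx =>
    (h2.flow (by linarith) (κ := κ / 2) (by linarith) hx).mono (by linarith)
  refine S.cpt.induction_on (p := fun U => RSet S α U (V x0 + κ)) ?_ (fun s t hst h => h.mono hst le_rfl) (fun s t h h' => h.union h') ?_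
  · refine ⟨∅, isCompact_empty, empty_subset _, 1, one_pos, 1, one_pos, 1, one_pos, ?_⟩
    intro ε hε G γ t0 D0 A w hG hγ hD hw hA hb' hi y hy
    exact absurd hy.1 (by simp)
  · intro x hx
    obtain ⟨ρ, hρ, hU⟩ := h3 x hx
    exact ⟨ball x ρ, mem_nhdsWithin_of_mem_nhds (ball_mem_nhds x hρ), hU⟩
end

open Set Filter Metric Topology
open scoped ENNReal

noncomputable section
variable {n : ℕ} {S : SettingB n} {α : Eu n → Matrix (Fin n) (Fin n) ℝ}

set_option maxHeartbeats 1600000 in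
/-- transport of upper bounds along the flow. -/
theorem transport (S : SettingB n) {T r : ℝ} (hT : 0 < T) (hr : 0 < r) :
    ∃ κ > (0:ℝ), ∃ ε0 > (0:ℝ), ∀ ε ∈ Ioo 0 ε0, ∀ (G D C t1 : ℝ) (A : Eu n → ℝ → Matrix (Fin n) (Fin n) ℝ)
      (w : Eu n → ℝ → ℝ) (x0 : Eu n), 0 < C → 0 ≤ G → PSub S ε G A w t1 (t1 + T) → x0 ∈ closure S.Ω →
      (∀ x ∈ closure S.Ω, w x t1 ≤ D + C) →
      (∀ x ∈ closure S.Ω, ‖x - S.X T x0‖ < r → w x t1 ≤ D) →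
      (∀ x ∈ frontier S.Ω, ∀ t ∈ Icc t1 (t1 + T), w x t ≤ D + C) →
      (∀ x ∈ frontier S.Ω, ∀ t ∈ Icc t1 (t1 + T), ‖x - S.X (T - (t - t1)) x0‖ < r → w x t ≤ D) →
      w x0 (t1 + T) ≤ D + G * T + C * Real.exp (-κ / ε) := by
  have hθ := S.θpos
  have hθ1 := S.θ₀_mem.2
  set K : ℝ := (S.K : ℝ) with hKdef
  have hK0 : 0 ≤ K := S.K.2
  set lam : ℝ := 2 * K + 2 with hlam
  set q0 : ℝ := S.θ₀ * Real.exp (-(lam * T)) / 4 with hq0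
  have hq0p : 0 < q0 := by positivity
  set c' : ℝ := q0 * r ^ 2 / (2 * T) with hc'
  have hc'p : 0 < c' := by positivity
  have hc'T : c' * T = q0 * r ^ 2 / 2 := by rw [hc']; field_simp
  refine ⟨q0 * r ^ 2 / 2, by positivity, c' / (n * S.θ₀⁻¹ + 1), by positivity, ?_⟩
  intro ε hε G D C t1 A w x0 hC hG hw hx0 hi1 hi2 hb1 hb2
  have hεn : ε * (n * S.θ₀⁻¹) < c' := by
    have := hε.2
    rw [lt_div_iff₀ (by positivity)] at this
    nlinarith [hε.1]
  set Y : ℝ → Eu n := fun t => S.X (T - (t - t1)) x0 with hY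
  have hYd : ∀ t, HasDerivAt Y (-S.b (Y t)) t := by
    intro t
    have h1 := S.X_deriv x0 (T - (t - t1))
    have h2 : HasDerivAt (fun t : ℝ => T - (t - t1)) (-1) t := by
      refine (((hasDerivAt_id t).sub_const t1).const_sub T).congr_deriv rfl
    have := h1.scomp t h2
    refine this.congr_deriv (by simp [hY])
  have hYc : Continuous Y := continuous_iff_continuousAt.2 fun t => (hYd t).continuousAt
  set q : ℝ → ℝ := fun t => q0 * Real.exp (lam * (t - t1)) with hq
  have hqd : ∀ t, HasDerivAt q (lam * q t) t := by
    intro t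
    have h2 : HasDerivAt (fun t : ℝ => lam * (t - t1)) (lam * 1) t := ((hasDerivAt_id t).sub_const t1).const_mul lam
    refine ((h2.exp).const_mul q0).congr_deriv (by simp only [hq]; ring)
  have hqc : Continuous q := continuous_iff_continuousAt.2 fun t => (hqd t).continuousAt
  have hqge : ∀ t, t1 ≤ t → q0 ≤ q t := by
    intro t ht
    have : 1 ≤ Real.exp (lam * (t - t1)) := Real.one_le_exp (mul_nonneg (by linarith) (by linarith))
    simp only [hq]; nlinarith
  have hqle : ∀ t, t ≤ t1 + T → q t ≤ S.θ₀ / 4 := by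
    intro t ht
    have : Real.exp (lam * (t - t1)) ≤ Real.exp (lam * T) := Real.exp_le_exp.2 (mul_le_mul_of_nonneg_left (by linarith) (by linarith))
    have h2 : Real.exp (-(lam * T)) * Real.exp (lam * T) = 1 := by rw [← Real.exp_add]; simp
    calc q t ≤ q0 * Real.exp (lam * T) := mul_le_mul_of_nonneg_left this hq0p.le
      _ = S.θ₀ / 4 * (Real.exp (-(lam * T)) * Real.exp (lam * T)) := by rw [hq0]; ring
      _ = _ := by rw [h2, mul_one]
  set v : Eu n → ℝ → ℝ := fun x t => q t * ‖x - Y t‖ ^ 2 - q0 * r ^ 2 + c' * (t - t1) with hv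
  have hvbig : ∀ x t, t1 ≤ t → r ≤ ‖x - Y t‖ → 0 ≤ v x t := by
    intro x t ht hx
    have h1 := hqge t ht
    have h2 : r ^ 2 ≤ ‖x - Y t‖ ^ 2 := by gcongr
    have h3 : q0 * r ^ 2 ≤ q t * ‖x - Y t‖ ^ 2 := mul_le_mul h1 h2 (by positivity) (by linarith)
    have h4 : 0 ≤ c' * (t - t1) := mul_nonneg hc'p.le (by linarith)
    simp only [hv]; linarith
  have hexp1 : ∀ x t, t1 ≤ t → r ≤ ‖x - Y t‖ → D + C ≤ D + C * Real.exp (v x t / ε) := by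
    intro x t ht hx
    have : 1 ≤ Real.exp (v x t / ε) := Real.one_le_exp (div_nonneg (hvbig x t ht hx) hε.1.le)
    nlinarith
  have main := MP_exp hε.1 hw v D C ?_ ?_ ?_ ?_ x0 hx0 (t1 + T) ⟨by linarith, le_rfl⟩
  · have hYT : Y (t1 + T) = x0 := by simp [hY, S.X_zero]
    have hvT : v x0 (t1 + T) = - (q0 * r ^ 2 / 2) := by
      simp only [hv, hYT, sub_self, norm_zero]
      have : c' * (t1 + T - t1) = c' * T := by ring
      rw [this, hc'T]; ring
    rw [hvT] at main
    have e : t1 + T - t1 = T := by ring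
    rw [e] at main
    exact main
  · refine Continuous.continuousOn ?_
    have h1 : Continuous fun p : Eu n × ℝ => q p.2 := hqc.comp continuous_snd
    have h2 : Continuous fun p : Eu n × ℝ => Y p.2 := hYc.comp continuous_snd
    simp only [hv]
    fun_prop
  · intro x hx
    rcases lt_or_ge ‖x - Y t1‖ r with h | h
    · have h' : ‖x - S.X T x0‖ < r := by simpa [hY] using h
      have := hi2 x hx h'
      have : 0 < C * Real.exp (v x t1 / ε) := by positivity
      linarith
    · exact (hi1 x hx).trans (hexp1 x t1 le_rfl h)
  · intro x hx t ht
    have hGt : 0 ≤ G * (t - t1) := mul_nonneg hG (by linarith [ht.1])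
    rcases lt_or_ge ‖x - Y t‖ r with h | h
    · have := hb2 x hx t ht h
      have : 0 < C * Real.exp (v x t / ε) := by positivity
      linarith
    · have := (hb1 x hx t ht).trans (hexp1 x t ht.1 h)
      linarith
  · intro x hx t ht _
    have hA := hw.mem x hx t ht
    have hq1 := hqle t ht.2
    have hq2 := hqge t ht.1.le
    have hq3 : 0 < q t := by linarith
    refine ⟨lam * q t * ‖x - Y t‖ ^ 2 + q t * (2 * inner ℝ (x - Y t) (S.b (Y t))) + c', (2 * q t) • (x - Y t), 2 * q t, ?_, ?_, ?_⟩
    · have h1 : HasDerivAt (fun t => x - Y t) (S.b (Y t)) t := ((hYd t).const_sub x).congr_deriv (by simp)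
      have h2 := h1.norm_sq
      have h3 := ((((hqd t).mul h2).sub_const (q0 * r ^ 2))).add (((hasDerivAt_id t).sub_const t1).const_mul c')
      refine h3.congr_deriv (by simp)
    · intro ξ
      have k := ((((Der2.normsq_line (x - Y t) ξ).const_mul (q t)).add (Der2.const (- (q0 * r ^ 2) + c' * (t - t1)))))
      refine (k.congr (Eventually.of_forall fun τ => ?_)).congr_val ?_ ?_
      · simp only [hv]
        rw [show x + τ • ξ - Y t = x - Y t + τ • ξ by abel]; ring
      · rw [inner_smul_left]; simp; ring
      · ring
    · refine mul_pos hC ?_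
      have e1 : mquad (A x t) ((2 * q t) • (x - Y t)) ≤ q t * ‖x - Y t‖ ^ 2 := by
        have := (hA.2 ((2 * q t) • (x - Y t))).2
        rw [norm_smul, mul_pow, Real.norm_of_nonneg (by positivity)] at this
        refine this.trans ?_
        have : S.θ₀⁻¹ * ((2 * q t) ^ 2 * ‖x - Y t‖ ^ 2) = (4 * q t * S.θ₀⁻¹) * (q t * ‖x - Y t‖ ^ 2) := by ring
        rw [this]
        have h4 : 4 * q t * S.θ₀⁻¹ ≤ 1 := by
          rw [← div_eq_mul_inv, div_le_one hθ]; linarith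
        have : 0 ≤ q t * ‖x - Y t‖ ^ 2 := by positivity
        nlinarith
      have e2 : ε * (2 * q t) * ∑ i, A x t i i < c' := by
        have h1 := hA.diag_sum
        have h0 := hA.diag_nonneg hθ.le
        have : ε * (2 * q t) * ∑ i, A x t i i ≤ ε * 1 * (n * S.θ₀⁻¹) := by
          have : 2 * q t ≤ 1 := by linarith
          gcongr
          all_goals linarith [hε.1]
        linarith
      have e3 : inner ℝ (S.b x) ((2 * q t) • (x - Y t)) = 2 * q t * inner ℝ (x - Y t) (S.b x) := by
        rw [inner_smul_right, real_inner_comm]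
      have e4 : inner ℝ (x - Y t) (S.b x) - inner ℝ (x - Y t) (S.b (Y t)) ≤ K * ‖x - Y t‖ ^ 2 := by
        rw [← inner_sub_right]
        refine (real_inner_le_norm _ _).trans ?_
        have := S.b_bound x (Y t)
        nlinarith [norm_nonneg (x - Y t)]
      rw [e3]
      have e5 : 0 ≤ q t * ‖x - Y t‖ ^ 2 := by positivity
      have e6 := mul_le_mul_of_nonneg_left e4 hq3.le
      rw [hlam]
      nlinarith
end

open Set Filter Metric Topology
open scoped ENNReal

noncomputable section
variable {n : ℕ} {S : SettingB n} {α : Eu n → Matrix (Fin n) (Fin n) ℝ}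

open scoped Convolution in
lemma mollify {f : Eu n → ℝ} {L : NNReal} (hf : LipschitzWith L f) {e : ℝ} (he : 0 < e) :
    ∃ F : Eu n → ℝ, ContDiff ℝ 2 F ∧ (∀ x, |F x - f x| ≤ L * e) ∧
      (∀ x q : Eu n, ∀ ℓ : ℝ, (∃ h0 > (0:ℝ), ∀ y, ‖y - x‖ ≤ e → ∀ h ∈ Ioc 0 h0, f (y + h • q) - f y ≤ h * ℓ) →
        inner ℝ (gradient F x) q ≤ ℓ) := by
  let φ : ContDiffBump (0 : Eu n) := ⟨e / 2, e, by linarith, by linarith⟩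
  let μ : MeasureTheory.Measure (Eu n) := MeasureTheory.volume
  set F : Eu n → ℝ := MeasureTheory.convolution (φ.normed μ) f (ContinuousLinearMap.lsmul ℝ ℝ) μ with hF
  have hFx : ∀ x, F x = ∫ t, φ.normed μ t * f (x - t) ∂μ := fun x => rfl
  have hC2 : ContDiff ℝ 2 F :=
    φ.hasCompactSupport_normed.contDiff_convolution_left _ φ.contDiff_normed hf.continuous.locallyIntegrable
  have hint : ∀ x, MeasureTheory.Integrable (fun t => φ.normed μ t * f (x - t)) μ := fun x =>
    (φ.hasCompactSupport_normed.convolutionExists_left (ContinuousLinearMap.lsmul ℝ ℝ) φ.continuous_normed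
      hf.continuous.locallyIntegrable x)
  refine ⟨F, hC2, fun x => ?_, ?_⟩
  · have := φ.dist_normed_convolution_le (μ := μ) (x₀ := x) (g := f) (ε := L * e) hf.continuous.aestronglyMeasurable
      (fun y hy => (hf.dist_le_mul y x).trans (by gcongr; exact (mem_ball.1 hy).le))
    rwa [Real.dist_eq] at this
  · rintro x q ℓ ⟨h0, hh0, H⟩
    have hd := line_deriv ((hC2.differentiable (by norm_num)) x) q
    have key : ∀ h ∈ Ioc 0 h0, F (x + h • q) - F x ≤ h * ℓ := by
      intro h hh
      rw [hFx, hFx, ← MeasureTheory.integral_sub (hint _) (hint _)]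
      have : h * ℓ = ∫ t, φ.normed μ t * (h * ℓ) ∂μ := by
        rw [MeasureTheory.integral_mul_const, φ.integral_normed, one_mul]
      rw [this]
      refine MeasureTheory.integral_mono ((hint _).sub (hint _)) (φ.integrable_normed.mul_const _) fun t => ?_
      show φ.normed μ t * f (x + h • q - t) - φ.normed μ t * f (x - t) ≤ φ.normed μ t * (h * ℓ)
      by_cases ht : t ∈ ball (0 : Eu n) e
      · have h1 := H (x - t) (by simpa using (mem_ball_zero_iff.1 ht).le) h hh
        have h2 := φ.nonneg_normed (μ := μ) t
        rw [show x + h • q - t = x - t + h • q by abel, ← mul_sub]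
        exact mul_le_mul_of_nonneg_left h1 h2
      · have : φ.normed μ t = 0 := by
          have h3 := φ.support_normed_eq (μ := μ)
          by_contra hne
          exact ht (by rw [← show Function.support (φ.normed μ) = ball 0 e from h3]; exact hne)
        simp [this]
    have hslope := hd.tendsto_slope_zero_right
    simp only [zero_add, zero_smul, add_zero] at hslope
    refine le_of_tendsto hslope ?_
    filter_upwards [Ioc_mem_nhdsGT hh0] with h hh
    rw [smul_eq_mul, inv_mul_le_iff₀ hh.1]
    exact key h hh

lemma mollify_grad {f F : Eu n → ℝ} {L : NNReal} (hf : LipschitzWith L f) {e : ℝ}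
    (H : ∀ x q : Eu n, ∀ ℓ : ℝ, (∃ h0 > (0:ℝ), ∀ y, ‖y - x‖ ≤ e → ∀ h ∈ Ioc 0 h0, f (y + h • q) - f y ≤ h * ℓ) →
        inner ℝ (gradient F x) q ≤ ℓ) (x : Eu n) : ‖gradient F x‖ ≤ L := by
  have := H x (gradient F x) (L * ‖gradient F x‖) ⟨1, one_pos, fun y _ h hh => by
    have h1 := hf.dist_le_mul (y + h • gradient F x) y
    rw [Real.dist_eq, dist_eq_norm, add_sub_cancel_left, norm_smul, Real.norm_of_nonneg hh.1.le] at h1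
    have := le_abs_self (f (y + h • gradient F x) - f y)
    linarith⟩
  rw [real_inner_self_eq_norm_sq] at this
  rcases (norm_nonneg (gradient F x)).eq_or_lt with h | h
  · rw [← h]; exact L.2
  · nlinarith
end

open Set Filter Metric Topology
open scoped ENNReal

noncomputable section
variable {n : ℕ} {S : SettingB n} {α : Eu n → Matrix (Fin n) (Fin n) ℝ}

lemma memS.mv_le {θ : ℝ} (hθ : 0 < θ) {A : Matrix (Fin n) (Fin n) ℝ} (h : memS θ A) (p : Eu n) :
    ‖mv A p‖ ≤ θ⁻¹ * ‖p‖ := by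
  have h1 := mquad_add h.1 p ((-θ) • mv A p)
  have h2 := (h.2 (p + (-θ) • mv A p)).1
  have h3 := (h.2 (mv A p)).2
  have h4 := (h.2 p).2
  rw [mquad_smul, inner_smul_right, real_inner_self_eq_norm_sq] at h1
  have h5 : 0 ≤ θ * ‖p + (-θ) • mv A p‖ ^ 2 := by positivity
  have h6 : (-θ) ^ 2 * mquad A (mv A p) ≤ θ * ‖mv A p‖ ^ 2 := by
    calc (-θ) ^ 2 * mquad A (mv A p) ≤ (-θ) ^ 2 * (θ⁻¹ * ‖mv A p‖ ^ 2) := by gcongr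
      _ = θ * ‖mv A p‖ ^ 2 := by field_simp
  have h7 : θ * ‖mv A p‖ ^ 2 ≤ θ⁻¹ * ‖p‖ ^ 2 := by linarith
  have h8 : ‖mv A p‖ ^ 2 ≤ (θ⁻¹ * ‖p‖) ^ 2 := by
    have := mul_le_mul_of_nonneg_left h7 (inv_nonneg.2 hθ.le)
    rw [inv_mul_cancel_left₀ hθ.ne'] at this
    rw [mul_pow]; linarith
  exact (pow_le_pow_iff_left₀ (norm_nonneg _) (by positivity) two_ne_zero).1 h8

lemma SettingB.X_move (S : SettingB n) {t : ℝ} (ht : t ∈ Icc (0:ℝ) 1) (y : Eu n) :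
    ‖S.X t y - y‖ ≤ t * (S.K * Real.exp S.K * ‖y‖) := by
  have := S.X_disp ht.1 y 0
  rw [S.X_origin, sub_zero, sub_zero] at this
  refine this.trans ?_
  have h1 : Real.exp (S.K * t) ≤ Real.exp S.K := Real.exp_le_exp.2 (by nlinarith [ht.2, S.K.2])
  have hK : (0:ℝ) ≤ S.K := S.K.2
  have h2 : S.K * t * Real.exp (S.K * t) * ‖y‖ ≤ S.K * t * Real.exp S.K * ‖y‖ := by
    have := ht.1
    gcongr
  linarith

set_option maxHeartbeats 1600000 in
lemma approxV (hα : Coef S α) {V : Eu n → ℝ} {L : NNReal} (hV : LipschitzWith L V)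
    (hst : ∀ x q h ℓ, Step S α x q h ℓ → V (x + h • q) ≤ V x + h * ℓ) {σ e : ℝ} (hσ : 0 < σ) (he : 0 < e) :
    ∃ F : Eu n → ℝ, ContDiff ℝ 2 F ∧ (∀ x ∈ closure S.Ω, |F x - V x| ≤ e) ∧
      (∀ x, ‖gradient F x‖ ≤ L * Real.exp S.K) ∧
      ∀ x ∈ closure S.Ω, mquad (α x) (gradient F x) + inner ℝ (S.b x) (gradient F x) ≤ σ := by
  have hθ := S.θpos
  have hK : (0:ℝ) ≤ S.K := S.K.2
  have hL0 : (0:ℝ) ≤ L := L.2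
  set EK := Real.exp S.K with hEK
  have hEKp : 0 < EK := Real.exp_pos _
  let L1 : NNReal := L * ⟨EK, hEKp.le⟩
  have hL1 : (L1 : ℝ) = L * EK := rfl
  obtain ⟨d, hd, Hd⟩ := rate_near_unif hα (L1 : ℝ) (half_pos hσ)
  obtain ⟨B, hB, hbB⟩ := S.b_bdd
  obtain ⟨R, hR, hRb⟩ : ∃ R > 0, ∀ x ∈ closure S.Ω, ‖x‖ ≤ R := by
    obtain ⟨R, hR⟩ := S.cpt.isBounded.exists_norm_le
    exact ⟨max R 1, by positivity, fun x hx => (hR x hx).trans (le_max_left _ _)⟩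
  set Q := 2 * (S.θ₀⁻¹ * L1) + B with hQ
  have hQp : 0 < Q := by positivity
  -- choice of tau
  obtain ⟨τ, hτ0, hτ1, hτ2, hτ3, hτ4⟩ : ∃ τ > (0:ℝ), τ ≤ 1 ∧ τ * (S.K * EK * R) ≤ d / 2 ∧
      L * (S.K * τ * EK * Q) ≤ σ / 2 ∧ L * (τ * (S.K * EK * R)) ≤ e / 2 := by
    have hc : ∀ c : ℝ, Tendsto (fun τ : ℝ => τ * c) (𝓝[>] 0) (𝓝 0) := fun c => by
      have : Continuous (fun τ : ℝ => τ * c) := by fun_prop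
      have := this.tendsto 0
      rw [zero_mul] at this
      exact this.mono_left nhdsWithin_le_nhds
    have h1 := (hc (S.K * EK * R)).eventually (Iic_mem_nhds (half_pos hd))
    have h2 := (hc (L * (S.K * EK * Q))).eventually (Iic_mem_nhds (half_pos hσ))
    have h3 := (hc (L * (S.K * EK * R))).eventually (Iic_mem_nhds (half_pos he))
    obtain ⟨τ, ⟨⟨a1, a2⟩, a3⟩, a4⟩ := ((((h1.and h2).and h3).and (Ioc_mem_nhdsGT one_pos))).exists
    refine ⟨τ, a4.1, a4.2, a1, ?_, ?_⟩
    · have : L * (S.K * τ * EK * Q) = τ * (L * (S.K * EK * Q)) := by ring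
      rw [this]; exact a2
    · have : L * (τ * (S.K * EK * R)) = τ * (L * (S.K * EK * R)) := by ring
      rw [this]; exact a3
  have hexpτ : Real.exp (S.K * τ) ≤ EK := Real.exp_le_exp.2 (by nlinarith)
  have hXl : ∀ x y, ‖S.X τ x - S.X τ y‖ ≤ EK * ‖x - y‖ := fun x y =>
    (S.X_lip hτ0.le x y).trans (by gcongr)
  have hCc : IsCompact (S.X τ '' closure S.Ω) := S.cpt.image (S.X_contx hτ0.le)
  have hCΩ : S.X τ '' closure S.Ω ⊆ S.Ω := by rintro _ ⟨x, hx, rfl⟩; exact S.X_mem hx hτ0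
  obtain ⟨r', hr', Hr'⟩ := hCc.exists_cthickening_subset_open S.isOpen hCΩ
  have Hr : ∀ x ∈ closure S.Ω, ∀ z, ‖z - S.X τ x‖ ≤ r' → z ∈ S.Ω := fun x hx z hz =>
    Hr' (mem_cthickening_of_dist_le z _ _ _ (mem_image_of_mem _ hx) (by rwa [dist_eq_norm]))
  set ρ := min r' (d / 2) / 3 with hρ
  have hρp : 0 < ρ := by positivity
  have hρ1 : 3 * ρ ≤ r' := by have := min_le_left r' (d / 2); rw [hρ]; linarith
  have hρ2 : 3 * ρ ≤ d / 2 := by have := min_le_right r' (d / 2); rw [hρ]; linarith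
  set e' := min (ρ / EK) (e / (2 * (L1 + 1))) with he'
  have he'p : 0 < e' := by positivity
  have he'1 : EK * e' ≤ ρ := by
    have := min_le_left (ρ / EK) (e / (2 * (L1 + 1)))
    rw [← he', le_div_iff₀ hEKp] at this; linarith
  have he'2 : L1 * e' ≤ e / 2 := by
    have := min_le_right (ρ / EK) (e / (2 * (L1 + 1)))
    rw [← he', le_div_iff₀ (by positivity)] at this; nlinarith
  have hf : LipschitzWith L1 (fun x => V (S.X τ x)) := LipschitzWith.of_dist_le_mul fun x y => by
    refine (hV.dist_le_mul _ _).trans ?_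
    rw [hL1, mul_assoc, dist_eq_norm, dist_eq_norm]
    gcongr
    exact hXl x y
  obtain ⟨F, hF2, hFa, hFg⟩ := mollify hf he'p
  have hgrad := mollify_grad hf hFg
  refine ⟨F, hF2, fun x hx => ?_, hgrad, fun x hx => ?_⟩
  · have h1 := hFa x
    have h2 : |V (S.X τ x) - V x| ≤ e / 2 := by
      have := hV.dist_le_mul (S.X τ x) x
      rw [Real.dist_eq, dist_eq_norm] at this
      refine this.trans (le_trans ?_ hτ4)
      have := S.X_move ⟨hτ0.le, hτ1⟩ x
      gcongr
      refine this.trans ?_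
      have := hRb x hx
      gcongr
    have := abs_sub_le (F x) (V (S.X τ x)) (V x)
    linarith
  · set p := gradient F x with hp
    set q := (2:ℝ) • mv (α x) p + S.b x with hq
    have hαx := hα.mem x hx
    have hqQ : ‖q‖ ≤ Q := by
      refine (norm_add_le _ _).trans ?_
      rw [norm_smul, Real.norm_of_nonneg zero_le_two]
      have h1 := hαx.mv_le hθ p
      have h2 := hgrad x
      have h3 := hbB x hx
      have : S.θ₀⁻¹ * ‖p‖ ≤ S.θ₀⁻¹ * L1 := by gcongr
      rw [hQ]; linarith
    have hmain := hFg x q (mquad (α x) p + σ) ⟨ρ / (‖q‖ + 1), by positivity, fun y hy h hh => ?_⟩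
    · have e1 : inner ℝ p q = 2 * mquad (α x) p + inner ℝ (S.b x) p := by
        rw [hq, inner_add_right, inner_smul_right, mquad_eq, real_inner_comm p (mv _ _), real_inner_comm p (S.b x)]
      rw [e1] at hmain
      linarith
    · have hhq : h * ‖q‖ ≤ ρ := by
        have := hh.2
        rw [le_div_iff₀ (by positivity)] at this
        nlinarith [hh.1]
      set z := S.X τ y with hz
      have hzx : ‖z - S.X τ x‖ ≤ ρ := (hXl y x).trans ((mul_le_mul_of_nonneg_left hy hEKp.le).trans he'1)
      have hstep : Step S α z q h (mquad (α x) p + σ / 2) := by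
        refine ⟨hh.1, p, ρ, hρp, d, hd, fun s hs z' hz' => ?_⟩
        have hz'1 : ‖z' - S.X τ x‖ ≤ 3 * ρ := by
          have : z' - S.X τ x = (z' - (z + s • q)) + (z - S.X τ x) + s • q := by abel
          rw [this]
          refine (norm_add₃_le).trans ?_
          rw [norm_smul, Real.norm_of_nonneg hs.1]
          have : s * ‖q‖ ≤ h * ‖q‖ := mul_le_mul_of_nonneg_right hs.2 (norm_nonneg _)
          linarith
        have hzΩ := Hr x hx z' (hz'1.trans hρ1)
        refine ⟨hzΩ, fun A hA hAc => Hd x hx z' (subset_closure hzΩ) ?_ A hAc p (hgrad x) q (by simp [hq, hd.le])⟩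
        have h1 := S.X_move ⟨hτ0.le, hτ1⟩ x
        have h2 : τ * (S.K * EK * ‖x‖) ≤ τ * (S.K * EK * R) := by have := hRb x hx; gcongr
        have h3 : x - z' = -((z' - S.X τ x) + (S.X τ x - x)) := by abel
        rw [h3, norm_neg]
        refine (norm_add_le _ _).trans ?_
        linarith
      have h1 := hst _ _ _ _ hstep
      have h2 : ‖S.X τ (y + h • q) - (z + h • q)‖ ≤ h * (S.K * τ * EK * Q) := by
        have h3 := S.X_disp hτ0.le (y + h • q) y
        have h4 : S.X τ (y + h • q) - (z + h • q) = S.X τ (y + h • q) - S.X τ y - (y + h • q - y) := by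
          rw [hz]; abel
        rw [h4]
        refine h3.trans ?_
        rw [add_sub_cancel_left, norm_smul, Real.norm_of_nonneg hh.1.le]
        have hh0 := hh.1.le
        calc S.K * τ * Real.exp (S.K * τ) * (h * ‖q‖) ≤ S.K * τ * EK * (h * Q) := by gcongr
          _ = _ := by ring
      have h5 := hV.dist_le_mul (S.X τ (y + h • q)) (z + h • q)
      rw [Real.dist_eq, dist_eq_norm] at h5
      have h6 := le_abs_self (V (S.X τ (y + h • q)) - V (z + h • q))
      have h7 : L * ‖S.X τ (y + h • q) - (z + h • q)‖ ≤ h * (σ / 2) := by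
        calc L * ‖S.X τ (y + h • q) - (z + h • q)‖ ≤ L * (h * (S.K * τ * EK * Q)) := by gcongr
          _ = h * (L * (S.K * τ * EK * Q)) := by ring
          _ ≤ h * (σ / 2) := mul_le_mul_of_nonneg_left hτ3 hh.1.le
      have h8 : h * (mquad (α x) p + σ) = h * (mquad (α x) p + σ / 2) + h * (σ / 2) := by ring
      rw [h8]
      show V (S.X τ (y + h • q)) - V z ≤ _
      linarith
end

open Set Filter Metric Topology
open scoped ENNReal

noncomputable section
variable {n : ℕ} {S : SettingB n} {α : Eu n → Matrix (Fin n) (Fin n) ℝ}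

lemma SettingB.norm_bd (S : SettingB n) : ∃ R > (0:ℝ), ∀ x ∈ closure S.Ω, ‖x‖ ≤ R := by
  obtain ⟨R, hR⟩ := S.cpt.isBounded.exists_norm_le
  exact ⟨max R 1, by positivity, fun x hx => (hR x hx).trans (le_max_left _ _)⟩

set_option maxHeartbeats 1600000 in
lemma lyap (S : SettingB n) {r : ℝ} (hr : 0 < r) :
    ∃ F : Eu n → ℝ, ContDiff ℝ 2 F ∧ ∃ L > (0:ℝ), (∀ x, ‖gradient F x‖ ≤ L) ∧ ∃ σ > (0:ℝ),
      ∀ x ∈ closure S.Ω, r ≤ ‖x‖ → inner ℝ (S.b x) (gradient F x) ≤ -σ := by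
  have hK : (0:ℝ) ≤ S.K := S.K.2
  obtain ⟨R, hR, hRb⟩ := S.norm_bd
  obtain ⟨T, hT, HT⟩ := S.X_attract (isCompact_closedBall (0 : Eu n) (R + 1)) (r := r / 4) (by linarith)
  set EK := Real.exp S.K with hEK
  have hEKp : 0 < EK := Real.exp_pos _
  set ℓ : Eu n → ℝ := fun x => ∫ s in (0:ℝ)..T, ‖S.X s x‖ with hℓ
  have hcont : ∀ x, Continuous (fun s => ‖S.X s x‖) := fun x => (S.X_contt x).norm
  have hii : ∀ x a b, IntervalIntegrable (fun s => ‖S.X s x‖) MeasureTheory.volume a b := fun x a b =>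
    (hcont x).intervalIntegrable a b
  let L1 : NNReal := ⟨T * Real.exp (S.K * T) + 1, by positivity⟩
  have hL1 : (L1 : ℝ) = T * Real.exp (S.K * T) + 1 := rfl
  have hL1p : (0:ℝ) < L1 := by rw [hL1]; positivity
  have hlip : LipschitzWith L1 ℓ := by
    refine LipschitzWith.of_le_add_mul L1 fun x y => ?_
    have h1 : ∫ s in (0:ℝ)..T, ‖S.X s x‖ ≤ ∫ s in (0:ℝ)..T, (‖S.X s y‖ + Real.exp (S.K * T) * ‖x - y‖) := by
      refine intervalIntegral.integral_mono_on hT.le (hii x 0 T) ((hii y 0 T).add (by simp)) fun s hs => ?_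
      have h2 := S.X_lip hs.1 x y
      have h3 : Real.exp (S.K * s) ≤ Real.exp (S.K * T) := Real.exp_le_exp.2 (by gcongr; exact hs.2)
      have h4 : ‖S.X s x‖ ≤ ‖S.X s y‖ + ‖S.X s x - S.X s y‖ := norm_le_norm_add_norm_sub' _ _
      have h5 := mul_le_mul_of_nonneg_right h3 (norm_nonneg (x - y))
      linarith
    rw [intervalIntegral.integral_add (hii y 0 T) (by simp), intervalIntegral.integral_const] at h1
    simp only [sub_zero, smul_eq_mul] at h1
    rw [hL1, dist_eq_norm]
    have := norm_nonneg (x - y)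
    show ∫ s in (0:ℝ)..T, ‖S.X s x‖ ≤ (∫ s in (0:ℝ)..T, ‖S.X s y‖) + _
    nlinarith
  -- small constants
  set c1 := S.K * EK * (R + 1) with hc1
  have hc1p : 0 ≤ c1 := by positivity
  set e := min (1 / 2) (min (r / 8) (r / (16 * (L1 * S.K + 1)))) with he
  have hep : 0 < e := by positivity
  have he1 : e ≤ 1 / 2 := min_le_left _ _
  have he2 : e ≤ r / 8 := (min_le_right _ _).trans (min_le_left _ _)
  have he3 : L1 * S.K * (2 * e) ≤ r / 8 := by
    have : e ≤ r / (16 * (L1 * S.K + 1)) := (min_le_right _ _).trans (min_le_right _ _)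
    rw [le_div_iff₀ (by positivity)] at this
    nlinarith
  set h0 := min 1 (e / (c1 + 1)) with hh0
  have hh0p : 0 < h0 := by positivity
  have hh01 : h0 ≤ 1 := min_le_left _ _
  have hh02 : h0 * c1 ≤ e := by
    have : h0 ≤ e / (c1 + 1) := min_le_right _ _
    rw [le_div_iff₀ (by positivity)] at this
    nlinarith
  obtain ⟨F, hF2, hFa, hFg⟩ := mollify hlip hep
  refine ⟨F, hF2, L1, hL1p, mollify_grad hlip hFg, r / 8, by linarith, fun x hx hxr => ?_⟩
  rw [real_inner_comm]
  refine hFg x (S.b x) (-(r / 8)) ⟨h0, hh0p, fun y hy h hh => ?_⟩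
  have hyR : ‖y‖ ≤ R + 1 := by
    have := norm_le_norm_add_norm_sub' y x
    have := hRb x hx
    linarith
  have hyr : r - r / 8 ≤ ‖y‖ := by
    have := norm_le_norm_add_norm_sub' x y
    rw [norm_sub_rev] at this
    linarith
  have hmove : ∀ s ∈ Icc (0:ℝ) h, ‖S.X s y - y‖ ≤ e := by
    intro s hs
    have h1 := S.X_move ⟨hs.1, hs.2.trans (hh.2.trans hh01)⟩ y
    refine h1.trans (le_trans ?_ hh02)
    calc s * (S.K * Real.exp S.K * ‖y‖) ≤ h0 * (S.K * Real.exp S.K * (R + 1)) := by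
          have := hs.1; have := hs.2.trans hh.2; gcongr
      _ = _ := rfl
  -- flow versus straight line
  have hline : ‖S.X h y - (y + h • S.b x)‖ ≤ S.K * (2 * e) * h := by
    have := norm_image_sub_le_of_norm_deriv_le_segment' (a := 0) (b := h)
      (f := fun s => S.X s y - s • S.b x) (f' := fun s => S.b (S.X s y) - S.b x) (C := S.K * (2 * e))
      (fun s hs => (((S.X_deriv y s).sub ((hasDerivAt_id s).smul_const (S.b x))).congr_deriv (by simp)).hasDerivWithinAt)
      (fun s hs => by
        refine (S.b_bound _ _).trans ?_
        have h1 := hmove s ⟨hs.1, hs.2.le⟩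
        have h2 : S.X s y - x = (S.X s y - y) + (y - x) := by abel
        have h3 := norm_add_le (S.X s y - y) (y - x)
        rw [← h2] at h3
        gcongr
        linarith) h ⟨hh.1.le, le_rfl⟩
    simp only [S.X_zero, zero_smul, sub_zero] at this
    rwa [show S.X h y - h • S.b x - y = S.X h y - (y + h • S.b x) by abel] at this
  have h1 : ℓ (y + h • S.b x) ≤ ℓ (S.X h y) + h * (r / 8) := by
    have h2 := hlip.dist_le_mul (y + h • S.b x) (S.X h y)
    rw [Real.dist_eq, dist_eq_norm, norm_sub_rev] at h2
    have h3 := le_abs_self (ℓ (y + h • S.b x) - ℓ (S.X h y))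
    have h4 : L1 * ‖S.X h y - (y + h • S.b x)‖ ≤ h * (r / 8) := by
      calc L1 * ‖S.X h y - (y + h • S.b x)‖ ≤ L1 * (S.K * (2 * e) * h) := by gcongr
        _ = h * (L1 * S.K * (2 * e)) := by ring
        _ ≤ h * (r / 8) := mul_le_mul_of_nonneg_left he3 hh.1.le
    linarith
  have h2 : ℓ (S.X h y) = (∫ s in h..(T + h), ‖S.X s y‖) := by
    have := intervalIntegral.integral_comp_add_right (fun s => ‖S.X s y‖) h (a := 0) (b := T)
    rw [zero_add] at this
    rw [← this]
    show (∫ s in (0:ℝ)..T, ‖S.X s (S.X h y)‖) = _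
    simp only [S.X_add]
  have h3 : (∫ s in h..(T + h), ‖S.X s y‖) - (∫ s in (0:ℝ)..T, ‖S.X s y‖) =
      (∫ s in T..(T + h), ‖S.X s y‖) - ∫ s in (0:ℝ)..h, ‖S.X s y‖ := by
    have a1 := intervalIntegral.integral_add_adjacent_intervals (hii y 0 h) (hii y h (T + h))
    have a2 := intervalIntegral.integral_add_adjacent_intervals (hii y 0 T) (hii y T (T + h))
    linarith
  have h4 : (∫ s in T..(T + h), ‖S.X s y‖) ≤ h * (r / 4) := by
    have := intervalIntegral.integral_mono_on (a := T) (b := T + h) (by linarith [hh.1]) (hii y T (T + h)) (g := fun _ => r / 4)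
      (by simp) fun s hs => (HT s hs.1 y (by simpa using hyR)).le
    rw [intervalIntegral.integral_const] at this
    simpa using this
  have h5 : h * (r / 2) ≤ ∫ s in (0:ℝ)..h, ‖S.X s y‖ := by
    have := intervalIntegral.integral_mono_on (a := 0) (b := h) hh.1.le (f := fun _ => r / 2) (by simp) (hii y 0 h)
      fun s hs => by
        have b1 := hmove s hs
        have b2 := norm_le_norm_add_norm_sub' y (S.X s y)
        rw [norm_sub_rev] at b2
        linarith
    rw [intervalIntegral.integral_const] at this
    simpa using this
  have h6 : ℓ y = ∫ s in (0:ℝ)..T, ‖S.X s y‖ := rfl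
  nlinarith

lemma mquad_cvx {A : Matrix (Fin n) (Fin n) ℝ} {θ : ℝ} (hθ : 0 ≤ θ) (h : memS θ A) {κ : ℝ} (hκ : κ ∈ Icc (0:ℝ) 1) (p q : Eu n) :
    mquad A ((1 - κ) • p + κ • q) ≤ (1 - κ) * mquad A p + κ * mquad A q := by
  have h1 := mquad_add h.1 ((1 - κ) • p) (κ • q)
  have h2 := mquad_add h.1 p ((-1 : ℝ) • q)
  have h3 : 0 ≤ mquad A (p + (-1 : ℝ) • q) := le_trans (by positivity) (h.2 _).1
  rw [mquad_smul, mquad_smul, mv_smul, inner_smul_left, inner_smul_right] at h1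
  rw [mquad_smul, inner_smul_right] at h2
  simp at h1
  rw [h1]
  have h4 := mul_nonneg hκ.1 (sub_nonneg.2 hκ.2)
  nlinarith

set_option maxHeartbeats 1600000 in
theorem smoothV (hα : Coef S α) {V : Eu n → ℝ} {L : NNReal} (hV : LipschitzWith L V)
    (hst : ∀ x q h ℓ, Step S α x q h ℓ → V (x + h • q) ≤ V x + h * ℓ) {r e : ℝ} (hr : 0 < r) (he : 0 < e) :
    ∃ F : Eu n → ℝ, ContDiff ℝ 2 F ∧ (∀ x ∈ closure S.Ω, |F x - V x| ≤ e) ∧ ∃ σ > (0:ℝ),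
      ∀ x ∈ closure S.Ω, r ≤ ‖x‖ → mquad (α x) (gradient F x) + inner ℝ (S.b x) (gradient F x) ≤ -σ := by
  have hθ := S.θpos
  obtain ⟨F2, hF2, L2, hL2, hg2, σ2, hσ2, H2⟩ := lyap S hr
  obtain ⟨CV, hCV⟩ := S.cpt.exists_bound_of_continuousOn hV.continuous.continuousOn
  obtain ⟨C2, hC2⟩ := S.cpt.exists_bound_of_continuousOn hF2.continuous.continuousOn
  have hCV0 : 0 ≤ CV := (norm_nonneg _).trans (hCV 0 S.zero_cl)
  have hC20 : 0 ≤ C2 := (norm_nonneg _).trans (hC2 0 S.zero_cl)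
  -- multiplier
  set k := min 1 (σ2 * S.θ₀ / (2 * L2 ^ 2)) with hk
  have hkp : 0 < k := by positivity
  have hk1 : k ≤ 1 := min_le_left _ _
  have hk2 : k * (S.θ₀⁻¹ * L2 ^ 2) ≤ σ2 / 2 := by
    have : k ≤ σ2 * S.θ₀ / (2 * L2 ^ 2) := min_le_right _ _
    rw [le_div_iff₀ (by positivity)] at this
    have h2 : k * (S.θ₀⁻¹ * L2 ^ 2) = (k * (2 * L2 ^ 2)) * S.θ₀⁻¹ / 2 := by ring
    rw [h2]
    have h3 : (k * (2 * L2 ^ 2)) * S.θ₀⁻¹ ≤ σ2 * S.θ₀ * S.θ₀⁻¹ := by gcongr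
    rw [mul_assoc σ2, mul_inv_cancel₀ hθ.ne', mul_one] at h3
    linarith
  set κ := min 1 (e / (2 * (CV + 1 + C2))) with hκ
  have hκp : 0 < κ := by positivity
  have hκ1 : κ ≤ 1 := min_le_left _ _
  have hκ2 : κ * (CV + C2) ≤ e / 2 := by
    have : κ ≤ e / (2 * (CV + 1 + C2)) := min_le_right _ _
    rw [le_div_iff₀ (by positivity)] at this
    nlinarith
  obtain ⟨F1, hF1, hA1, hg1, H1⟩ := approxV hα hV hst (σ := κ * (k * σ2 / 4)) (e := e / 2) (by positivity) (by positivity)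
  refine ⟨fun x => (1 - κ) * F1 x + κ * (k * F2 x), ?_, ?_, κ * (k * σ2 / 4), by positivity, ?_⟩
  · exact (contDiff_const.mul hF1).add (contDiff_const.mul (contDiff_const.mul hF2))
  · intro x hx
    have h1 := hA1 x hx
    have h2 := hCV x hx
    have h3 := hC2 x hx
    rw [Real.norm_eq_abs] at h2 h3
    have h4 : (1 - κ) * F1 x + κ * (k * F2 x) - V x = (1 - κ) * (F1 x - V x) + κ * (k * F2 x - V x) := by ring
    rw [h4]
    have h5 : |k * F2 x - V x| ≤ CV + C2 := by
      refine (abs_sub _ _).trans ?_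
      rw [abs_mul, abs_of_pos hkp]
      nlinarith [abs_nonneg (F2 x)]
    refine (abs_add_le _ _).trans ?_
    rw [abs_mul, abs_mul, abs_of_pos hκp, abs_of_nonneg (sub_nonneg.2 hκ1)]
    have h6 : (1 - κ) * |F1 x - V x| ≤ |F1 x - V x| := by nlinarith [abs_nonneg (F1 x - V x)]
    have h7 := mul_le_mul_of_nonneg_left h5 hκp.le
    linarith
  · intro x hx hxr
    have hd1 := (hF1.differentiable (by norm_num)) x
    have hd2 := (hF2.differentiable (by norm_num)) x
    have hgr : gradient (fun x => (1 - κ) * F1 x + κ * (k * F2 x)) x = (1 - κ) • gradient F1 x + κ • (k • gradient F2 x) := by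
      refine HasGradientAt.gradient ?_
      have a1 := hd1.hasGradientAt.hasFDerivAt.const_mul (1 - κ)
      have a2 := (hd2.hasGradientAt.hasFDerivAt.const_mul k).const_mul κ
      rw [hasGradientAt_iff_hasFDerivAt]
      refine (a1.add a2).congr_fderiv ?_
      simp
    rw [hgr]
    have hαx := hα.mem x hx
    have h1 := mquad_cvx hθ.le hαx ⟨hκp.le, hκ1⟩ (gradient F1 x) (k • gradient F2 x)
    have h2 := H1 x hx
    have h3 := H2 x hx hxr
    have h4 : mquad (α x) (k • gradient F2 x) ≤ k * (σ2 / 2) := by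
      rw [mquad_smul]
      have h5 := (hαx.2 (gradient F2 x)).2
      have h6 := hg2 x
      calc k ^ 2 * mquad (α x) (gradient F2 x) ≤ k ^ 2 * (S.θ₀⁻¹ * L2 ^ 2) := by gcongr; exact h5.trans (by gcongr)
        _ = k * (k * (S.θ₀⁻¹ * L2 ^ 2)) := by ring
        _ ≤ _ := by gcongr
    rw [inner_add_right, inner_smul_right, inner_smul_right, inner_smul_right]
    have h7 := mul_le_mul_of_nonneg_left h4 hκp.le
    have h8 := mul_le_mul_of_nonneg_left h3 (mul_nonneg hκp.le hkp.le)
    have h9 := mul_le_mul_of_nonneg_left h2 (sub_nonneg.2 hκ1)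
    have h10 : (1 - κ) * (κ * (k * σ2 / 4)) ≤ κ * (k * σ2 / 4) := by
      have : 0 ≤ κ * (k * σ2 / 4) := by positivity
      nlinarith
    nlinarith
end

open Set Filter Metric Topology
open scoped ENNReal

noncomputable section
variable {n : ℕ} {S : SettingB n} {α : Eu n → Matrix (Fin n) (Fin n) ℝ}

/-- concave change of variables with slope going from one to `θ ^ 2`. -/
lemma slope_fun {θ : ℝ} (hθ : θ ∈ Ioc (0:ℝ) 1) (m0 : ℝ) {κ : ℝ} (hκ : 0 < κ) :
    ∃ h h1 h2 : ℝ → ℝ, (∀ s, HasDerivAt h (h1 s) s) ∧ (∀ s, HasDerivAt h1 (h2 s) s) ∧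
      (∀ s, θ ^ 2 ≤ h1 s ∧ h1 s ≤ 1) ∧ (∀ s, h2 s ≤ 0) ∧
      (∀ s, m0 ≤ s → h1 s = θ ^ 2 ∧ h s = m0 + θ ^ 2 * (s - m0)) ∧ ∀ s, h s ≤ s + κ := by
  have hθ2 : θ ^ 2 ≤ 1 := by nlinarith [hθ.1, hθ.2]
  set k : ℝ → ℝ := fun s => θ ^ 2 + (1 - θ ^ 2) * (1 - Real.smoothTransition ((s - (m0 - κ)) / κ)) with hk
  have hkd : Differentiable ℝ k := by
    have : Differentiable ℝ Real.smoothTransition := (Real.smoothTransition.contDiff (n := 1)).differentiable (by simp)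
    intro s
    have h1 : DifferentiableAt ℝ (fun s : ℝ => Real.smoothTransition ((s - (m0 - κ)) / κ)) s :=
      (this _).comp s (by fun_prop)
    exact ((h1.const_sub 1).const_mul _).const_add _
  have hkc : Continuous k := hkd.continuous
  have hkb : ∀ s, θ ^ 2 ≤ k s ∧ k s ≤ 1 := by
    intro s
    have a1 := Real.smoothTransition.nonneg ((s - (m0 - κ)) / κ)
    have a2 := Real.smoothTransition.le_one ((s - (m0 - κ)) / κ)
    constructor
    · simp only [hk]; nlinarith
    · simp only [hk]; nlinarith
  have hkhi : ∀ s, m0 ≤ s → k s = θ ^ 2 := by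
    intro s hs
    simp only [hk]
    rw [Real.smoothTransition.one_of_one_le]
    · ring
    · rw [le_div_iff₀ hκ]; linarith
  have hklo : ∀ s, s ≤ m0 - κ → k s = 1 := by
    intro s hs
    simp only [hk]
    rw [Real.smoothTransition.zero_of_nonpos]
    · ring
    · exact div_nonpos_of_nonpos_of_nonneg (by linarith) hκ.le
  have hanti : Antitone k := by
    intro s t hst
    have : Real.smoothTransition ((s - (m0 - κ)) / κ) ≤ Real.smoothTransition ((t - (m0 - κ)) / κ) :=
      Real.smoothTransition.monotone (by gcongr)
    simp only [hk]; nlinarith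
  have hii : ∀ a b, IntervalIntegrable k MeasureTheory.volume a b := fun a b => hkc.intervalIntegrable a b
  refine ⟨fun s => m0 + ∫ t in m0..s, k t, k, deriv k, fun s => ?_, fun s => (hkd s).hasDerivAt, hkb, fun s => ?_, fun s hs => ⟨hkhi s hs, ?_⟩, fun s => ?_⟩
  · exact (intervalIntegral.integral_hasDerivAt_right (hii _ _) (hkc.stronglyMeasurableAtFilter _ _) hkc.continuousAt).const_add m0
  · exact hanti.deriv_nonpos
  · have : ∫ t in m0..s, k t = ∫ t in m0..s, θ ^ 2 := intervalIntegral.integral_congr fun t ht => by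
      rw [uIcc_of_le hs] at ht; exact hkhi t ht.1
    show m0 + ∫ t in m0..s, k t = _
    rw [this, intervalIntegral.integral_const, smul_eq_mul]; ring
  · show m0 + ∫ t in m0..s, k t ≤ s + κ
    rcases le_total m0 s with h | h
    · have := intervalIntegral.integral_mono_on h (hii m0 s) (g := fun _ => 1) (by simp) fun t _ => (hkb t).2
      rw [intervalIntegral.integral_const, smul_eq_mul] at this
      linarith
    · rw [intervalIntegral.integral_symm]
      rcases le_total s (m0 - κ) with h' | h'
      · have a1 := intervalIntegral.integral_add_adjacent_intervals (hii s (m0 - κ)) (hii (m0 - κ) m0)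
        have a2 : 0 ≤ ∫ t in (m0 - κ)..m0, k t := intervalIntegral.integral_nonneg (by linarith) fun t _ =>
          (by positivity : (0:ℝ) ≤ θ ^ 2).trans (hkb t).1
        have a3 : ∫ t in s..(m0 - κ), k t = ∫ t in s..(m0 - κ), (1:ℝ) := intervalIntegral.integral_congr fun t ht => by
          rw [uIcc_of_le h'] at ht; exact hklo t ht.2
        rw [intervalIntegral.integral_const, smul_eq_mul] at a3
        linarith
      · have a2 : 0 ≤ ∫ t in s..m0, k t := intervalIntegral.integral_nonneg h fun t _ =>
          (by positivity : (0:ℝ) ≤ θ ^ 2).trans (hkb t).1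
        linarith

lemma hess_bdd (S : SettingB n) {F : Eu n → ℝ} (hF : ContDiff ℝ 2 F) :
    ∃ C > (0:ℝ), ∀ x ∈ closure S.Ω, ∀ ξ, mquad (hessS F x) ξ ≤ C * ‖ξ‖ ^ 2 := by
  have hg : ContDiff ℝ 1 (gradient F) := by
    have h1 : ContDiff ℝ 1 (fderiv ℝ F) := hF.fderiv_right (by norm_num)
    exact ((InnerProductSpace.toDual ℝ (Eu n)).symm.toContinuousLinearEquiv.contDiff).comp h1
  have hc : ∀ i j, Continuous (fun x => hessS F x i j) := by
    intro i j
    have h2 : ContDiff ℝ 1 (fun y => gradient F y i) :=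
      ((EuclideanSpace.proj (𝕜 := ℝ) i : Eu n →L[ℝ] ℝ).contDiff).comp hg
    exact (h2.continuous_fderiv (by norm_num)).clm_apply continuous_const
  have hC : Continuous (fun x => ∑ i, ∑ j, |hessS F x i j|) :=
    continuous_finsetSum _ fun i _ => continuous_finsetSum _ fun j _ => (hc i j).abs
  obtain ⟨C, hCb⟩ := S.cpt.exists_bound_of_continuousOn hC.continuousOn
  have hC0 : 0 ≤ C := (norm_nonneg _).trans (hCb 0 S.zero_cl)
  refine ⟨C * n + 1, by positivity, fun x hx ξ => ?_⟩
  have hm : MClose C (hessS F x) 0 := fun i j => by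
    have h1 := (le_abs_self _).trans (hCb x hx)
    have h2 : |hessS F x i j| ≤ ∑ j, |hessS F x i j| := Finset.single_le_sum (f := fun j => |hessS F x i j|) (fun _ _ => abs_nonneg _) (Finset.mem_univ j)
    have h3 : ∑ j, |hessS F x i j| ≤ ∑ i, ∑ j, |hessS F x i j| :=
      Finset.single_le_sum (f := fun i => ∑ j, |hessS F x i j|) (fun _ _ => Finset.sum_nonneg fun _ _ => abs_nonneg _) (Finset.mem_univ i)
    simp only [Matrix.zero_apply, sub_zero]
    linarith
  have := (le_abs_self _).trans (hm.quad hC0 ξ)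
  have h0 : mquad (0 : Matrix (Fin n) (Fin n) ℝ) ξ = 0 := by simp [mquad]
  rw [h0, sub_zero] at this
  nlinarith [sq_nonneg ‖ξ‖]

lemma mquad_rank1 (c1 c2 : ℝ) (p : Eu n) (H : Matrix (Fin n) (Fin n) ℝ) (ξ : Eu n) :
    mquad (fun i j => c1 * (p i * p j) + c2 * H i j) ξ = c1 * (inner ℝ p ξ) ^ 2 + c2 * mquad H ξ := by
  have e : (dotp p ξ) ^ 2 = ∑ i, ∑ j, (p i * ξ i) * (p j * ξ j) := by
    rw [sq]; simp only [dotp, Finset.sum_mul_sum]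
  rw [← dotp_eq, e]
  simp only [mquad, Finset.mul_sum, ← Finset.sum_add_distrib]
  exact Finset.sum_congr rfl fun i _ => Finset.sum_congr rfl fun j _ => by ring

lemma trMul_rank1 (A : Matrix (Fin n) (Fin n) ℝ) (c1 c2 : ℝ) (p : Eu n) (H : Matrix (Fin n) (Fin n) ℝ) :
    trMul A (fun i j => c1 * (p i * p j) + c2 * H i j) = c1 * mquad A p + c2 * trMul A H := by
  simp only [trMul, mquad, Finset.mul_sum, ← Finset.sum_add_distrib]
  exact Finset.sum_congr rfl fun i _ => Finset.sum_congr rfl fun j _ => by ring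

set_option maxHeartbeats 3200000 in
theorem psi_barrier (hα : Coef S α) {V : Eu n → ℝ} {L : NNReal} (hV : LipschitzWith L V) (hV0 : V 0 = 0)
    (hst : ∀ x q h ℓ, Step S α x q h ℓ → V (x + h • q) ≤ V x + h * ℓ) {M κ1 κ : ℝ}
    (hM : ∀ x ∈ frontier S.Ω, M ≤ V x) (hκ : 0 < κ) (hκ1 : 2 * κ ≤ S.θ₀ ^ 2 * κ1) :
    ∃ v1 : Eu n → ℝ, Continuous v1 ∧ v1 0 ≤ 4 * κ ∧
      (∀ x ∈ frontier S.Ω, M + 4 * κ1 ≤ V x → M + 2 * S.θ₀ ^ 2 * κ1 ≤ v1 x) ∧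
      ∃ K0 : Set (Eu n), IsCompact K0 ∧ K0 ⊆ S.Ω ∧ ∃ ϖ > (0:ℝ), ∃ ε0 > (0:ℝ), ∀ ε ∈ Ioo 0 ε0, ∀ m1 : ℝ,
        ∀ x ∈ S.Ω, ∀ A, memS S.θ₀ A → (x ∈ K0 → MClose ϖ A (α x)) → ∃ p H,
          (∀ ξ, Der2 (fun s => Real.exp ((v1 (x + s • ξ) - m1) / ε)) (inner ℝ p ξ) (mquad H ξ)) ∧
          ε * trMul A H + inner ℝ (S.b x) p ≤ Real.exp ((4 * κ - m1) / ε) := by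
  have hθ := S.θpos
  have hθ1 := S.θ₀_mem.2
  have hL0 : (0:ℝ) ≤ L := L.2
  set θ := S.θ₀ with hθdef
  have hθ2 : θ ^ 2 ≤ 1 := by nlinarith
  have hκ1p : κ ≤ κ1 := by
    by_contra hcon
    push Not at hcon
    rcases le_or_gt 0 κ1 with h | h
    · nlinarith
    · have : θ ^ 2 * κ1 ≤ 0 := mul_nonpos_of_nonneg_of_nonpos (by positivity) h.le
      linarith
  set r := κ / (L + 1) with hr
  have hrp : 0 < r := by positivity
  have hLr : L * r ≤ κ := by
    have : r * (L + 1) = κ := by rw [hr]; field_simp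
    nlinarith
  obtain ⟨F, hF2, hFV, σ, hσ, HF⟩ := smoothV hα hV hst hrp hκ
  obtain ⟨h, h1, h2, hd1, hd2, hb1, hb2, hhi, hle⟩ := slope_fun S.θ₀_mem (M - 2 * κ) hκ
  obtain ⟨CH, hCH, HCH⟩ := hess_bdd S hF2
  obtain ⟨B, hB, hbB⟩ := S.b_bdd
  obtain ⟨P, hP, hgP⟩ : ∃ P > (0:ℝ), ∀ x ∈ closure S.Ω, ‖gradient F x‖ ≤ P := by
    have hg : Continuous (gradient F) := by
      have h1 : Continuous (fderiv ℝ F) := hF2.continuous_fderiv (by norm_num)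
      exact ((InnerProductSpace.toDual ℝ (Eu n)).symm.toContinuousLinearEquiv.continuous).comp h1
    obtain ⟨P, hP⟩ := S.cpt.exists_bound_of_continuousOn hg.continuousOn
    exact ⟨max P 1, by positivity, fun x hx => (hP x hx).trans (le_max_left _ _)⟩
  have hhc : Continuous h := continuous_iff_continuousAt.2 fun s => (hd1 s).continuousAt
  refine ⟨fun x => h (F x), hhc.comp hF2.continuous, ?_, ?_, closure S.Ω ∩ {x | F x ≤ M - 2 * κ}, ?_, ?_, ?_⟩
  · have a1 := hFV 0 S.zero_cl
    rw [hV0, sub_zero] at a1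
    have := (le_abs_self _).trans a1
    have := hle (F 0)
    linarith
  · intro x hx hVx
    have a1 := (abs_le.1 (hFV x (S.front_sub hx))).1
    show _ ≤ h (F x)
    rw [(hhi (F x) (by linarith)).2]
    have : θ ^ 2 * (3 * κ1) ≤ θ ^ 2 * (F x - (M - 2 * κ)) := mul_le_mul_of_nonneg_left (by linarith) (by positivity)
    linarith
  · exact S.cpt.inter_right (isClosed_le hF2.continuous continuous_const)
  · rintro x ⟨hx, hxF⟩
    rcases S.mem_or hx with h' | h'
    · exact h'
    · have a1 := (abs_le.1 (hFV x hx)).1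
      have a2 := hM x h'
      have a3 : F x ≤ M - 2 * κ := hxF
      linarith
  -- constants
  set ϖ := σ / (2 * (n * P ^ 2 + 1)) with hϖ
  have hϖp : 0 < ϖ := by positivity
  set CT := CH * (n * θ⁻¹) with hCT
  have hCT0 : 0 ≤ CT := by positivity
  set CC := θ⁻¹ * P ^ 2 + B * P + CT + 1 with hCC
  have hCCp : 0 < CC := by positivity
  refine ⟨ϖ, hϖp, min 1 (min (θ ^ 2 * σ / (2 * (CT + 1))) (κ ^ 2 / (2 * CC))), by positivity, ?_⟩
  intro ε hε m1 x hx A hA hAc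
  have hε0 := hε.1
  have hε1 : ε ≤ 1 := (hε.2.trans_le (min_le_left _ _)).le
  have hε2 : ε * (CT + 1) ≤ θ ^ 2 * σ / 2 := by
    have : ε ≤ θ ^ 2 * σ / (2 * (CT + 1)) := (hε.2.trans_le ((min_le_right _ _).trans (min_le_left _ _))).le
    rw [le_div_iff₀ (by positivity)] at this; linarith
  have hε3 : ε * (2 * CC) ≤ κ ^ 2 := by
    have : ε ≤ κ ^ 2 / (2 * CC) := (hε.2.trans_le ((min_le_right _ _).trans (min_le_right _ _))).le
    rwa [le_div_iff₀ (by positivity)] at this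
  have hxc : x ∈ closure S.Ω := subset_closure hx
  set p := gradient F x with hp
  set s := h1 (F x) with hs
  set ψ := Real.exp ((h (F x) - m1) / ε) with hψ
  have hψp : 0 < ψ := Real.exp_pos _
  refine ⟨(ψ * s / ε) • p, fun i j => (ψ * (s ^ 2 / ε ^ 2 + h2 (F x) / ε)) * (p i * p j) + (ψ * s / ε) * hessS F x i j, ?_, ?_⟩
  · intro ξ
    have k0 := der2_line_of_contDiffAt (hF2.contDiffAt (x := x)) ξ
    have k1 := k0.comp (G := h) (G' := h1) (c2 := h2 (F (x + (0:ℝ) • ξ))) (Eventually.of_forall hd1) (hd2 _)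
    have k2 := ((k1.add (Der2.const (-m1))).const_mul ε⁻¹).exp
    refine (k2.congr (Eventually.of_forall fun τ => ?_)).congr_val ?_ ?_
    · simp only []
      congr 1
      rw [div_eq_inv_mul]; ring
    · rw [inner_smul_left]
      simp only [zero_smul, add_zero, conj_trivial]
      rw [← hs, ← hp, show ε⁻¹ * (h (F x) + -m1) = (h (F x) - m1) / ε by rw [div_eq_inv_mul]; ring, ← hψ]
      ring
    · rw [mquad_rank1]
      simp only [zero_smul, add_zero]
      rw [← hs, ← hp, show ε⁻¹ * (h (F x) + -m1) = (h (F x) - m1) / ε by rw [div_eq_inv_mul]; ring, ← hψ]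
      ring
  · rw [trMul_rank1, inner_smul_right]
    obtain ⟨BB, hBB⟩ := hA.exists_dec hθ.le
    have hTr : trMul A (hessS F x) ≤ CT := by
      rw [hBB.trMul_eq]
      calc ∑ k, mquad (hessS F x) (BB k) ≤ ∑ k, CH * ‖BB k‖ ^ 2 := Finset.sum_le_sum fun k _ => HCH x hxc _
        _ = CH * ∑ i, A i i := by rw [← Finset.mul_sum, hBB.norm]
        _ ≤ CT := by rw [hCT]; gcongr; exact hA.diag_sum
    obtain ⟨hs1, hs2⟩ := hb1 (F x)
    have hs0 : 0 < s := lt_of_lt_of_le (by positivity) hs1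
    have hApp : 0 ≤ mquad A p := le_trans (by positivity) (hA.2 p).1
    have hbr : ε * (ψ * (s ^ 2 / ε ^ 2 + h2 (F x) / ε) * mquad A p + ψ * s / ε * trMul A (hessS F x)) + ψ * s / ε * inner ℝ (S.b x) p
        = ψ / ε * (s * (s * mquad A p + inner ℝ (S.b x) p) + ε * (h2 (F x) * mquad A p) + ε * (s * trMul A (hessS F x))) := by
      field_simp
      ring
    rw [hbr]
    have hb2' : h2 (F x) * mquad A p ≤ 0 := mul_nonpos_of_nonpos_of_nonneg (hb2 _) hApp
    have hsT : s * trMul A (hessS F x) ≤ CT := by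
      rcases le_or_gt 0 (trMul A (hessS F x)) with h' | h'
      · exact (mul_le_of_le_one_left h' hs2).trans hTr
      · exact (mul_neg_of_pos_of_neg hs0 h').le.trans hCT0
    have hbd : s * (s * mquad A p + inner ℝ (S.b x) p) + ε * (h2 (F x) * mquad A p) + ε * (s * trMul A (hessS F x))
        ≤ s * (s * mquad A p + inner ℝ (S.b x) p) + ε * CT := by 
      linarith [mul_le_mul_of_nonneg_left hb2' hε0.le, mul_le_mul_of_nonneg_left hsT hε0.le]
    have hψε : 0 < ψ / ε := by positivity
    rcases le_or_gt r ‖x‖ with hxr | hxr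
    · have key : s * (s * mquad A p + inner ℝ (S.b x) p) ≤ - (θ ^ 2 * σ / 2) := by
        have hH := HF x hxc hxr
        have h3 : s * mquad A p + inner ℝ (S.b x) p ≤ - (σ / 2) := by
          rcases le_or_gt (F x) (M - 2 * κ) with hF | hF
          · have hc := hAc ⟨hxc, hF⟩
            have h4 := (le_abs_self _).trans (hc.quad hϖp.le p)
            have h5 : ϖ * (n * ‖p‖ ^ 2) ≤ σ / 2 := by
              have : n * ‖p‖ ^ 2 ≤ n * P ^ 2 + 1 := by
                have : (n:ℝ) * ‖p‖ ^ 2 ≤ n * P ^ 2 := by have := hgP x hxc; gcongr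
                linarith
              calc ϖ * (n * ‖p‖ ^ 2) ≤ ϖ * (n * P ^ 2 + 1) := by gcongr
                _ = σ / 2 := by rw [hϖ]; field_simp
            have h6 : s * mquad A p ≤ mquad A p := by exact mul_le_of_le_one_left hApp hs2
            linarith
          · have hs' : s = θ ^ 2 := (hhi (F x) hF.le).1
            have h4 : s * mquad A p ≤ mquad (α x) p := by
              have h5 := (hA.2 p).2
              have h6 := ((hα.mem x hxc).2 p).1
              rw [hs']
              calc θ ^ 2 * mquad A p ≤ θ ^ 2 * (θ⁻¹ * ‖p‖ ^ 2) := by gcongr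
                _ = θ * ‖p‖ ^ 2 := by field_simp
                _ ≤ _ := h6
            linarith
        linarith [mul_le_mul_of_nonneg_left h3 hs0.le, mul_le_mul_of_nonneg_right hs1 (half_pos hσ).le]
      have : s * (s * mquad A p + inner ℝ (S.b x) p) + ε * CT ≤ 0 := by linarith
      have h7 : ψ / ε * (s * (s * mquad A p + inner ℝ (S.b x) p) + ε * (h2 (F x) * mquad A p) + ε * (s * trMul A (hessS F x))) ≤ 0 :=
        mul_nonpos_of_nonneg_of_nonpos hψε.le (by linarith)
      exact h7.trans (Real.exp_pos _).le
    · have hFx : F x ≤ 2 * κ := by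
        have a1 := (le_abs_self _).trans (hFV x hxc)
        have a2 := hV.dist_le_mul x 0
        rw [Real.dist_eq, hV0, sub_zero, dist_zero_right] at a2
        have a3 := le_abs_self (V x)
        have a4 : L * ‖x‖ ≤ L * r := by gcongr
        linarith
      have hhF := hle (F x)
      have hψle : ψ ≤ Real.exp ((3 * κ - m1) / ε) := Real.exp_le_exp.2 (by gcongr; linarith)
      have hin : inner ℝ (S.b x) p ≤ B * P := (real_inner_le_norm _ _).trans (by
        have := hbB x hxc; have := hgP x hxc; gcongr)
      have hAP : mquad A p ≤ θ⁻¹ * P ^ 2 := (hA.2 p).2.trans (by have := hgP x hxc; gcongr)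
      have hX : s * (s * mquad A p + inner ℝ (S.b x) p) + ε * CT ≤ CC := by
        have h3 : s * mquad A p + inner ℝ (S.b x) p ≤ θ⁻¹ * P ^ 2 + B * P := by linarith [mul_le_of_le_one_left hApp hs2]
        have h4 : 0 ≤ θ⁻¹ * P ^ 2 + B * P := by positivity
        have h5 : s * (s * mquad A p + inner ℝ (S.b x) p) ≤ θ⁻¹ * P ^ 2 + B * P := by 
          exact (mul_le_mul_of_nonneg_left h3 hs0.le).trans (mul_le_of_le_one_left h4 hs2)
        have h6 : ε * CT ≤ CT := by exact mul_le_of_le_one_left hCT0 hε1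
        rw [hCC]; linarith
      have hq := Real.quadratic_le_exp_of_nonneg (x := κ / ε) (by positivity)
      have hCCε : CC / ε ≤ Real.exp (κ / ε) := by
        refine le_trans ?_ hq
        have h3 : CC / ε ≤ (κ / ε) ^ 2 / 2 := by
          rw [div_pow, div_div, div_le_div_iff₀ hε0 (by positivity)]
          linarith [mul_le_mul_of_nonneg_left hε3 hε0.le]
        have : 0 ≤ κ / ε := by positivity
        linarith
      calc _ ≤ ψ / ε * CC := mul_le_mul_of_nonneg_left (hbd.trans hX) hψε.le
        _ = ψ * (CC / ε) := by ring
        _ ≤ Real.exp ((3 * κ - m1) / ε) * Real.exp (κ / ε) := by gcongr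
        _ = _ := by rw [← Real.exp_add]; congr 1; ring
end

open Set Filter Metric Topology
open scoped ENNReal

noncomputable section
variable {n : ℕ} {S : SettingB n} {α : Eu n → Matrix (Fin n) (Fin n) ℝ}

lemma trMul_lin (A H : Matrix (Fin n) (Fin n) ℝ) (p : Eu n) (c1 c2 c3 : ℝ) :
    trMul (fun i j => c1 * (p i * p j) + c2 * (A i j) + c3 * (1 : Matrix (Fin n) (Fin n) ℝ) i j) H =
      c1 * mquad H p + c2 * trMul A H + c3 * ∑ i, H i i := by
  have e3 : ∑ i, H i i = ∑ i, ∑ j, (1 : Matrix (Fin n) (Fin n) ℝ) i j * H j i := by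
    refine Finset.sum_congr rfl fun i _ => ?_
    simp [Matrix.one_apply]
  have e1 : mquad H p = ∑ i, ∑ j, p i * p j * H j i := by
    rw [mquad, Finset.sum_comm]
    exact Finset.sum_congr rfl fun i _ => Finset.sum_congr rfl fun j _ => by ring
  rw [e3, e1]
  simp only [trMul, Finset.mul_sum, ← Finset.sum_add_distrib]
  exact Finset.sum_congr rfl fun i _ => Finset.sum_congr rfl fun j _ => by ring

lemma mquad_lin (A : Matrix (Fin n) (Fin n) ℝ) (p ξ : Eu n) (c1 c2 c3 : ℝ) :
    mquad (fun i j => c1 * (p i * p j) + c2 * (A i j) + c3 * (1 : Matrix (Fin n) (Fin n) ℝ) i j) ξ =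
      c1 * (inner ℝ p ξ) ^ 2 + c2 * mquad A ξ + c3 * ‖ξ‖ ^ 2 := by
  have e : (dotp p ξ) ^ 2 = ∑ i, ∑ j, (p i * ξ i) * (p j * ξ j) := by
    rw [sq]; simp only [dotp, Finset.sum_mul_sum]
  have e3 : ‖ξ‖ ^ 2 = ∑ i, ∑ j, (1 : Matrix (Fin n) (Fin n) ℝ) i j * ξ i * ξ j := by
    rw [EuclideanSpace.real_norm_sq_eq]
    refine Finset.sum_congr rfl fun i _ => ?_
    simp [Matrix.one_apply, sq]
  rw [← dotp_eq, e, e3]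
  simp only [mquad, Finset.mul_sum, ← Finset.sum_add_distrib]
  exact Finset.sum_congr rfl fun i _ => Finset.sum_congr rfl fun j _ => by ring

/-- reflection coupling inequality -/
lemma coupling {θ ϖ c1 c2 : ℝ} (hθ : 0 < θ) (hϖ : 0 ≤ ϖ) (hc1 : 0 ≤ c1) (hc2 : c2 ≤ 0)
    {A B P Q : Matrix (Fin n) (Fin n) ℝ} (hA : memS θ A) (hB : memS θ B) (hAB : MClose ϖ A B)
    (hsm : n * ϖ ≤ θ / 2) {z : Eu n} (hz : z ≠ 0)
    (h : ∀ ξ ζ : Eu n, mquad P ξ + mquad Q ζ ≤ c2 * (inner ℝ z (ξ - ζ)) ^ 2 + c1 * ‖ξ - ζ‖ ^ 2) :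
    trMul A P + trMul B Q ≤ 2 * θ * (c2 * ‖z‖ ^ 2 + c1) + (2 * n ^ 2 + n) * ϖ * c1 := by
  set ω := n * ϖ with hω
  have hn : (0:ℝ) ≤ n := Nat.cast_nonneg n
  have hω0 : 0 ≤ ω := by positivity
  have hz0 : 0 < ‖z‖ ^ 2 := by positivity
  set τ := θ / 2 / ‖z‖ ^ 2 with hτ
  have hτ0 : 0 ≤ τ := by positivity
  have hτz : τ * ‖z‖ ^ 2 = θ / 2 := by rw [hτ]; field_simp
  set A2 : Matrix (Fin n) (Fin n) ℝ := fun i j => (-τ) * (z i * z j) + 1 * (A i j) + (-ω) * (1 : Matrix (Fin n) (Fin n) ℝ) i j with hA2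
  set D : Matrix (Fin n) (Fin n) ℝ := fun i j => 0 * (z i * z j) + 1 * ((B - A) i j) + ω * (1 : Matrix (Fin n) (Fin n) ℝ) i j with hD
  have hsA : ∀ i j, A i j = A j i := fun i j => (hA.1.apply j i)
  have hsB : ∀ i j, B i j = B j i := fun i j => (hB.1.apply j i)
  have hs1 : ∀ i j, (1 : Matrix (Fin n) (Fin n) ℝ) i j = (1 : Matrix (Fin n) (Fin n) ℝ) j i := fun i j => by
    simp [Matrix.one_apply, eq_comm]
  obtain ⟨b2, hb2⟩ := exists_dec (A := A2) (Matrix.IsSymm.ext fun i j => by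
      simp only [hA2]; rw [hsA i j, hs1 i j]; ring) (fun p => by
      rw [hA2, mquad_lin]
      have h1 := (hA.2 p).1
      have h2 : (inner ℝ z p) ^ 2 ≤ ‖z‖ ^ 2 * ‖p‖ ^ 2 := by
        rw [← mul_pow, ← sq_abs]
        exact pow_le_pow_left₀ (abs_nonneg _) (abs_real_inner_le_norm z p) 2
      have h3 := mul_le_mul_of_nonneg_left h2 hτ0
      rw [← mul_assoc, hτz] at h3
      have h4 := mul_le_mul_of_nonneg_right hsm (sq_nonneg ‖p‖)
      nlinarith)
  obtain ⟨bD, hbD⟩ := exists_dec (A := D) (Matrix.IsSymm.ext fun i j => by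
      simp only [hD, Matrix.sub_apply]; rw [hsA i j, hsB i j, hs1 i j]; ring) (fun p => by
      rw [hD, mquad_lin]
      have h1 := (abs_le.1 (hAB.quad hϖ p)).2
      have h2 : mquad (B - A) p = mquad B p - mquad A p := by
        simp only [mquad, Matrix.sub_apply, sub_mul, Finset.sum_sub_distrib]
      rw [h2]
      have : ω * ‖p‖ ^ 2 = ϖ * (n * ‖p‖ ^ 2) := by rw [hω]; ring
      linarith)
  have eA : trMul A2 P = -τ * mquad P z + trMul A P - ω * ∑ i, P i i := by
    rw [hA2, trMul_lin]; ring
  have eA' : trMul A2 Q = -τ * mquad Q z + trMul A Q - ω * ∑ i, Q i i := by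
    rw [hA2, trMul_lin]; ring
  have eD : trMul D Q = (trMul B Q - trMul A Q) + ω * ∑ i, Q i i := by
    rw [hD, trMul_lin]
    have : trMul (B - A) Q = trMul B Q - trMul A Q := by
      simp only [trMul, Matrix.sub_apply, sub_mul, Finset.sum_sub_distrib]
    rw [this]; ring
  have f1 : trMul A2 P + trMul A2 Q ≤ 0 := by
    rw [hb2.trMul_eq, hb2.trMul_eq, ← Finset.sum_add_distrib]
    refine Finset.sum_nonpos fun k _ => ?_
    have := h (b2 k) (b2 k)
    simpa using this
  have f2 : mquad P z + mquad Q z ≤ 4 * ‖z‖ ^ 2 * (c2 * ‖z‖ ^ 2 + c1) := by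
    have := h z (-z)
    have e1 : mquad Q (-z) = mquad Q z := by
      have := mquad_smul Q (-1) z
      simpa using this
    have e2 : z - -z = (2:ℝ) • z := by rw [two_smul]; abel
    rw [e1, e2, inner_smul_right, norm_smul, real_inner_self_eq_norm_sq] at this
    simp only [Real.norm_ofNat] at this
    nlinarith
  have f3 : ∑ i, P i i ≤ n * c1 := by
    have : ∀ i ∈ Finset.univ, P i i ≤ c1 := fun i _ => by
      have := h (EuclideanSpace.single i 1) 0
      rw [mquad_single] at this
      have e0 : mquad Q 0 = 0 := by simp [mquad]
      rw [e0] at this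
      simp only [sub_zero, EuclideanSpace.norm_single, norm_one, one_pow, mul_one, add_zero] at this
      nlinarith [sq_nonneg (inner ℝ z (EuclideanSpace.single i (1:ℝ)))]
    have := Finset.sum_le_sum this
    simpa using this
  have f4 : trMul D Q ≤ c1 * (n * ϖ + n * ω) := by
    rw [hbD.trMul_eq]
    have g1 : ∑ k, mquad Q (bD k) ≤ ∑ k, c1 * ‖bD k‖ ^ 2 := Finset.sum_le_sum fun k _ => by
      have := h 0 (bD k)
      have e0 : mquad P 0 = 0 := by simp [mquad]
      rw [e0] at this
      simp only [zero_sub, norm_neg, zero_add] at this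
      nlinarith [sq_nonneg (inner ℝ z (-(bD k)))]
    rw [← Finset.mul_sum, hbD.norm] at g1
    refine g1.trans (mul_le_mul_of_nonneg_left ?_ hc1)
    have : ∀ i ∈ Finset.univ, D i i ≤ ϖ + ω := fun i _ => by
      have := (abs_le.1 (hAB i i)).1
      simp only [hD, Matrix.sub_apply, Matrix.one_apply_eq]; linarith
    have := Finset.sum_le_sum this
    simp at this; linarith
  have f5 := mul_le_mul_of_nonneg_left f2 hτ0
  have f6 := mul_le_mul_of_nonneg_left f3 hω0
  have e5 : τ * (4 * ‖z‖ ^ 2 * (c2 * ‖z‖ ^ 2 + c1)) = 2 * θ * (c2 * ‖z‖ ^ 2 + c1) := by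
    linear_combination 4 * (c2 * ‖z‖ ^ 2 + c1) * hτz
  rw [e5] at f5
  have e6 : (2 * n ^ 2 + n) * ϖ * c1 = ω * (n * c1) + c1 * (n * ϖ + n * ω) := by rw [hω]; ring
  linarith
end

open Set Filter Metric Topology
open scoped ENNReal

noncomputable section
variable {n : ℕ} {S : SettingB n} {α : Eu n → Matrix (Fin n) (Fin n) ℝ}

/-- the coupling profile -/
def prof (Λ y : ℝ) : ℝ := Real.exp (-Λ * y ^ (1/4 : ℝ))

lemma prof_cont (Λ : ℝ) : Continuous (prof Λ) := by
  unfold prof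
  exact Real.continuous_exp.comp (continuous_const.mul (Real.continuous_rpow_const (by norm_num)))

lemma rpow_quarter {ρ : ℝ} (hρ : 0 < ρ) : (ρ ^ 4) ^ (1/4 : ℝ) = ρ := by
  rw [← Real.rpow_natCast ρ 4, ← Real.rpow_mul hρ.le]; norm_num

lemma prof_deriv (Λ : ℝ) {y : ℝ} (hy : 0 < y) :
    HasDerivAt (prof Λ) (prof Λ y * (-Λ * (1/4 * y ^ (-3/4 : ℝ)))) y := by
  have h1 : HasDerivAt (fun y : ℝ => y ^ (1/4 : ℝ)) (1/4 * y ^ (1/4 - 1 : ℝ)) y :=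
    Real.hasDerivAt_rpow_const (Or.inl hy.ne')
  have h2 := (h1.const_mul (-Λ)).exp
  refine h2.congr_deriv ?_
  unfold prof; norm_num

lemma prof_deriv2 (Λ : ℝ) {ρ : ℝ} (hρ : 0 < ρ) :
    HasDerivAt (fun y => prof Λ y * (-Λ * (1/4 * y ^ (-3/4 : ℝ))))
      (Real.exp (-Λ * ρ) * (Λ ^ 2 / (16 * ρ ^ 6) + 3 * Λ / (16 * ρ ^ 7))) (ρ ^ 4) := by
  have hy : (0:ℝ) < ρ ^ 4 := by positivity
  have h1 : HasDerivAt (fun y : ℝ => y ^ (-3/4 : ℝ)) (-3/4 * (ρ ^ 4) ^ (-3/4 - 1 : ℝ)) (ρ ^ 4) :=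
    Real.hasDerivAt_rpow_const (Or.inl hy.ne')
  have h2 := (prof_deriv Λ hy).mul ((h1.const_mul (1/4)).const_mul (-Λ))
  refine h2.congr_deriv ?_
  have e1 : (ρ ^ 4) ^ (-3/4 : ℝ) = (ρ ^ 3)⁻¹ := by
    rw [← Real.rpow_natCast ρ 4, ← Real.rpow_mul hρ.le, ← Real.rpow_natCast ρ 3, ← Real.rpow_neg hρ.le]; norm_num
  have e2 : (ρ ^ 4) ^ (-3/4 - 1 : ℝ) = (ρ ^ 7)⁻¹ := by
    rw [← Real.rpow_natCast ρ 4, ← Real.rpow_mul hρ.le, ← Real.rpow_natCast ρ 7, ← Real.rpow_neg hρ.le]; norm_num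
  have e3 : prof Λ (ρ ^ 4) = Real.exp (-Λ * ρ) := by unfold prof; rw [rpow_quarter hρ]
  rw [e1, e2, e3]
  field_simp
  ring

lemma prof_line (Λ : ℝ) {ρ : ℝ} (hρ : 0 < ρ) {z : Eu n} (hz : ‖z‖ ^ 2 = ρ ^ 4) (v : Eu n) :
    Der2 (fun s => prof Λ (‖z + s • v‖ ^ 2)) (Real.exp (-Λ * ρ) * (-Λ / (2 * ρ ^ 3)) * inner ℝ z v)
      (Real.exp (-Λ * ρ) * ((Λ ^ 2 / (4 * ρ ^ 6) + 3 * Λ / (4 * ρ ^ 7)) * (inner ℝ z v) ^ 2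
        - Λ / (2 * ρ ^ 3) * ‖v‖ ^ 2)) := by
  have e0 : ‖z + (0:ℝ) • v‖ ^ 2 = ρ ^ 4 := by simpa using hz
  have hy : (0:ℝ) < ρ ^ 4 := by positivity
  have h := (Der2.normsq_line z v).comp (G := prof Λ) (G' := fun y => prof Λ y * (-Λ * (1/4 * y ^ (-3/4 : ℝ))))
    (c2 := Real.exp (-Λ * ρ) * (Λ ^ 2 / (16 * ρ ^ 6) + 3 * Λ / (16 * ρ ^ 7)))
    (by rw [e0]; filter_upwards [lt_mem_nhds hy] with y hy using prof_deriv Λ hy)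
    (by rw [e0]; exact prof_deriv2 Λ hρ)
  have e1 : (ρ ^ 4) ^ (-3/4 : ℝ) = (ρ ^ 3)⁻¹ := by
    rw [← Real.rpow_natCast ρ 4, ← Real.rpow_mul hρ.le, ← Real.rpow_natCast ρ 3, ← Real.rpow_neg hρ.le]; norm_num
  have e3 : prof Λ (ρ ^ 4) = Real.exp (-Λ * ρ) := by unfold prof; rw [rpow_quarter hρ]
  refine h.congr_val ?_ ?_
  · rw [e0, e1, e3]; field_simp; ring
  · rw [e0, e1, e3]; field_simp; ring

lemma time_max {f : ℝ → ℝ} {d t t0 : ℝ} (hd : HasDerivAt f d t) (ht : t0 < t)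
    (hmax : ∀ s ∈ Icc t0 t, f s ≤ f t) : 0 ≤ d := by
  by_contra hneg
  push Not at hneg
  have h1 := hd.tendsto_slope
  have h2 : ∀ᶠ s in 𝓝[<] t, slope f t s < 0 :=
    (h1.eventually (gt_mem_nhds hneg)).filter_mono (nhdsWithin_mono _ fun s hs => ne_of_lt hs)
  have h3 : ∀ᶠ s in 𝓝[<] t, s ∈ Ioo t0 t := Ioo_mem_nhdsLT ht
  obtain ⟨s, hs, hs'⟩ := (h2.and h3).exists
  rw [slope_def_field] at hs
  have h4 := hmax s ⟨hs'.1.le, hs'.2.le⟩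
  have h6 : 0 ≤ (f s - f t) / (s - t) :=
    div_nonneg_of_nonpos (by linarith) (by linarith [hs'.2])
  linarith

set_option maxHeartbeats 1600000 in
theorem doubling {ε ϖ R t0 t1 m l a Λ : ℝ} (hε : 0 < ε) (hϖ : 0 ≤ ϖ) (hsm : (2 * n ^ 2 + n) * ϖ ≤ S.θ₀)
    (hm : 0 < m) (hΛ : 0 < Λ) (ha : 0 < a) (hl : l * (t1 - t0) ≤ 1) (hl0 : 0 ≤ l)
    {w1 w2 : Eu n → ℝ → ℝ} {A : Eu n → ℝ → Matrix (Fin n) (Fin n) ℝ} {G : Eu n → ℝ}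
    (hc1 : ContinuousOn (fun q : Eu n × ℝ => w1 q.1 q.2) (closedBall 0 R ×ˢ Icc t0 t1))
    (hc2 : ContinuousOn (fun q : Eu n × ℝ => w2 q.1 q.2) (closedBall 0 R ×ˢ Icc t0 t1))
    (hA : ∀ x ∈ ball (0 : Eu n) R, ∀ t ∈ Ioc t0 t1, memS S.θ₀ (A x t))
    (hs1 : ∀ x ∈ ball (0 : Eu n) R, ∀ t ∈ Ioc t0 t1, SubAt ε (G x) (A x t) (S.b x) w1 x t)
    (hs2 : ∀ x ∈ ball (0 : Eu n) R, ∀ t ∈ Ioc t0 t1, SubAt ε (G x) (A x t) (S.b x) w2 x t)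
    (hcl : ∀ x ∈ ball (0 : Eu n) R, ∀ y ∈ ball (0 : Eu n) R, ∀ t ∈ Ioc t0 t1, MClose ϖ (A x t) (A y t))
    (hin : ∀ x ∈ closedBall (0 : Eu n) R, ∀ y ∈ closedBall (0 : Eu n) R, w1 x t0 + w2 y t0 ≤ m)
    (hbd : ∀ x ∈ closedBall (0 : Eu n) R, ∀ y ∈ closedBall (0 : Eu n) R, ∀ t ∈ Icc t0 t1,
      (‖x‖ = R ∨ ‖y‖ = R) → w1 x t + w2 y t ≤ 0)
    (hdi : ∀ x ∈ closedBall (0 : Eu n) R, ∀ t ∈ Icc t0 t1, w1 x t + w2 x t ≤ 0)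
    (hkey : ∀ x ∈ ball (0 : Eu n) R, ∀ y ∈ ball (0 : Eu n) R, ∀ ρ : ℝ, 0 < ρ → ‖x - y‖ = ρ ^ 2 →
      a * Real.exp (-Λ * ρ) * (- (ε * S.θ₀ * Λ ^ 2 / (2 * ρ ^ 2)) + S.K * Λ * ρ / 2) + G x + G y < - (m * l)) :
    ∀ x ∈ closedBall (0 : Eu n) R, ∀ y ∈ closedBall (0 : Eu n) R, ∀ t ∈ Icc t0 t1,
      w1 x t + w2 y t ≤ m * (1 - l * (t - t0)) + a := by
  have hθ := S.θpos
  set Φ : Eu n → Eu n → ℝ → ℝ := fun x y t => m * (1 - l * (t - t0)) + a * (1 - prof Λ (‖x - y‖ ^ 2)) with hΦ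
  have hprof : ∀ y, 0 ≤ y → prof Λ y ≤ 1 := fun y hy => by
    unfold prof; rw [Real.exp_le_one_iff]
    have : 0 ≤ y ^ (1/4 : ℝ) := Real.rpow_nonneg hy _
    nlinarith
  have hΦ1 : ∀ x y t, Φ x y t ≤ m * (1 - l * (t - t0)) + a := fun x y t => by
    have : 0 < prof Λ (‖x - y‖ ^ 2) := Real.exp_pos _
    simp only [hΦ]; nlinarith
  have hΦ0 : ∀ x y, ∀ t ∈ Icc t0 t1, 0 ≤ Φ x y t := fun x y t ht => by
    have h1 := hprof (‖x - y‖ ^ 2) (by positivity)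
    have h2 : l * (t - t0) ≤ 1 := (mul_le_mul_of_nonneg_left (by linarith [ht.2]) hl0).trans hl
    have h3 : 0 ≤ a * (1 - prof Λ (‖x - y‖ ^ 2)) := mul_nonneg ha.le (by linarith)
    have h4 : 0 ≤ m * (1 - l * (t - t0)) := mul_nonneg hm.le (by linarith)
    simp only [hΦ]; linarith
  suffices H : ∀ x ∈ closedBall (0 : Eu n) R, ∀ y ∈ closedBall (0 : Eu n) R, ∀ t ∈ Icc t0 t1,
      w1 x t + w2 y t ≤ Φ x y t from fun x hx y hy t ht => (H x hx y hy t ht).trans (hΦ1 x y t)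
  intro x' hx' y' hy' t' ht'
  by_contra hcon
  push Not at hcon
  have hK : IsCompact (closedBall (0 : Eu n) R ×ˢ closedBall (0 : Eu n) R ×ˢ Icc t0 t1) :=
    (isCompact_closedBall _ _).prod ((isCompact_closedBall _ _).prod isCompact_Icc)
  have hcont : ContinuousOn (fun q : Eu n × Eu n × ℝ => w1 q.1 q.2.2 + w2 q.2.1 q.2.2 - Φ q.1 q.2.1 q.2.2)
      (closedBall (0 : Eu n) R ×ˢ closedBall (0 : Eu n) R ×ˢ Icc t0 t1) := by
    refine (ContinuousOn.add ?_ ?_).sub ?_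
    · exact hc1.comp (f := fun q : Eu n × Eu n × ℝ => (q.1, q.2.2)) (by fun_prop) fun q hq => ⟨hq.1, hq.2.2⟩
    · exact hc2.comp (f := fun q : Eu n × Eu n × ℝ => (q.2.1, q.2.2)) (by fun_prop) fun q hq => ⟨hq.2.1, hq.2.2⟩
    · apply Continuous.continuousOn
      have := (prof_cont Λ).comp (show Continuous fun q : Eu n × Eu n × ℝ => ‖q.1 - q.2.1‖ ^ 2 by fun_prop)
      simp only [hΦ]
      exact (by fun_prop : Continuous fun q : Eu n × Eu n × ℝ => m * (1 - l * (q.2.2 - t0))).add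
        (continuous_const.mul (continuous_const.sub this))
  obtain ⟨⟨x, y, t⟩, hxyt, hmax⟩ := hK.exists_isMaxOn ⟨(x', y', t'), hx', hy', ht'⟩ hcont
  have hmax' : ∀ x2 ∈ closedBall (0 : Eu n) R, ∀ y2 ∈ closedBall (0 : Eu n) R, ∀ s ∈ Icc t0 t1,
      w1 x2 s + w2 y2 s - Φ x2 y2 s ≤ w1 x t + w2 y t - Φ x y t :=
    fun x2 hx2 y2 hy2 s hs => hmax (show (x2, y2, s) ∈ closedBall (0 : Eu n) R ×ˢ closedBall (0 : Eu n) R ×ˢ Icc t0 t1 from ⟨hx2, hy2, hs⟩)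
  have hpos : Φ x y t < w1 x t + w2 y t := by have := hmax' x' hx' y' hy' t' ht'; linarith
  obtain ⟨hx1, hy1, ht1⟩ := hxyt
  simp only at hx1 hy1 ht1
  have hp0 : 0 < w1 x t + w2 y t := (hΦ0 x y t ht1).trans_lt hpos
  have hxR : ‖x‖ ≠ R := fun hh => by have := hbd x hx1 y hy1 t ht1 (Or.inl hh); linarith
  have hyR : ‖y‖ ≠ R := fun hh => by have := hbd x hx1 y hy1 t ht1 (Or.inr hh); linarith
  have hx : x ∈ ball (0 : Eu n) R := by
    rw [mem_ball_zero_iff]; exact lt_of_le_of_ne (mem_closedBall_zero_iff.1 hx1) hxR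
  have hy : y ∈ ball (0 : Eu n) R := by
    rw [mem_ball_zero_iff]; exact lt_of_le_of_ne (mem_closedBall_zero_iff.1 hy1) hyR
  have hxy : x ≠ y := by
    rintro rfl; have := hdi x hx1 t ht1; linarith
  have ht : t ∈ Ioc t0 t1 := by
    refine ⟨lt_of_le_of_ne ht1.1 ?_, ht1.2⟩
    intro hh
    have h1 := hin x hx1 y hy1
    have h2 := hprof (‖x - y‖ ^ 2) (by positivity)
    have h3 : 0 ≤ a * (1 - prof Λ (‖x - y‖ ^ 2)) := mul_nonneg ha.le (by linarith)
    rw [← hh] at hpos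
    simp only [hΦ, sub_self, mul_zero, sub_zero, mul_one] at hpos
    linarith
  set z := x - y with hz
  have hz0 : z ≠ 0 := sub_ne_zero.2 hxy
  have hzn : 0 < ‖z‖ := norm_pos_iff.2 hz0
  set ρ := Real.sqrt ‖z‖ with hρdef
  have hρ : 0 < ρ := Real.sqrt_pos.2 hzn
  have hρ2 : ‖z‖ = ρ ^ 2 := (Real.sq_sqrt hzn.le).symm
  have hρ4 : ‖z‖ ^ 2 = ρ ^ 4 := by rw [hρ2]; ring
  set E := Real.exp (-Λ * ρ) with hE
  have hEp : 0 < E := Real.exp_pos _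
  obtain ⟨wt, p, P, hwt, hw2, hwin⟩ := hs1 x hx t ht
  obtain ⟨vt, q, Q, hvt, hv2, hvin⟩ := hs2 y hy t ht
  -- space
  have hsp : ∀ ξ ζ : Eu n, inner ℝ p ξ + inner ℝ q ζ = a * (E * (Λ / (2 * ρ ^ 3)) * inner ℝ z (ξ - ζ)) ∧
      mquad P ξ + mquad Q ζ ≤ (- (a * E * (Λ ^ 2 / (4 * ρ ^ 6) + 3 * Λ / (4 * ρ ^ 7)))) * (inner ℝ z (ξ - ζ)) ^ 2
        + a * E * (Λ / (2 * ρ ^ 3)) * ‖ξ - ζ‖ ^ 2 := by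
    intro ξ ζ
    have hD := ((hw2 ξ).add (hv2 ζ)).add ((prof_line Λ hρ hρ4 (ξ - ζ)).const_mul a)
    have hlm : IsLocalMax (fun s : ℝ => w1 (x + s • ξ) t + w2 (y + s • ζ) t + a * prof Λ (‖z + s • (ξ - ζ)‖ ^ 2)) 0 := by
      have hcx : ∀ x ξ : Eu n, Tendsto (fun s : ℝ => x + s • ξ) (𝓝 0) (𝓝 x) := fun x ξ => by
        have : Continuous (fun s : ℝ => x + s • ξ) := by fun_prop
        simpa using this.tendsto 0
      filter_upwards [hcx x ξ (isOpen_ball.mem_nhds hx), hcx y ζ (isOpen_ball.mem_nhds hy)] with s hsx hsy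
      have := hmax' _ (ball_subset_closedBall hsx) _ (ball_subset_closedBall hsy) t ht1
      have e : x + s • ξ - (y + s • ζ) = z + s • (ξ - ζ) := by rw [hz, smul_sub]; abel
      simp only [hΦ, e] at this
      simp only [zero_smul, add_zero]
      linarith
    have := hD.locMax hlm
    constructor
    · have h1 := this.1
      have e : (-Λ / (2 * ρ ^ 3)) = -(Λ / (2 * ρ ^ 3)) := by ring
      rw [e] at h1; linarith
    · have h2 := this.2; linarith
  have htime : 0 ≤ wt + vt + m * l := by
    have e1 := (((hasDerivAt_id t).sub_const t0).const_mul l).const_sub 1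
    have hd := (hwt.add hvt).sub (e1.const_mul m)
    refine (time_max hd ht.1 fun s hs => ?_).trans_eq (by ring)
    have := hmax' x hx1 y hy1 s ⟨hs.1, hs.2.trans ht.2⟩
    simp only [hΦ] at this
    simp only [Pi.add_apply, Pi.sub_apply, id]
    linarith
  have hn0 : (0:ℝ) ≤ n := Nat.cast_nonneg n
  have hcoup := coupling hθ hϖ (c1 := a * E * (Λ / (2 * ρ ^ 3)))
    (c2 := - (a * E * (Λ ^ 2 / (4 * ρ ^ 6) + 3 * Λ / (4 * ρ ^ 7)))) (by positivity)
    (by rw [neg_nonpos]; positivity) (hA x hx t ht) (hA y hy t ht) (hcl x hx y hy t ht)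
    (by nlinarith [mul_nonneg (sq_nonneg (n:ℝ)) hϖ, mul_nonneg hn0 hϖ, (show (n:ℝ) ≤ n ^ 2 by exact_mod_cast Nat.le_self_pow two_ne_zero n)]) hz0 (fun ξ ζ => (hsp ξ ζ).2)
  have hc' : trMul (A x t) P + trMul (A y t) Q ≤ - (a * E * S.θ₀ * Λ ^ 2 / (2 * ρ ^ 2)) := by
    refine hcoup.trans ?_
    have h1 := mul_le_mul_of_nonneg_right hsm (show 0 ≤ a * E * (Λ / (2 * ρ ^ 3)) by positivity)
    refine (add_le_add_right h1 _).trans (le_of_eq ?_)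
    rw [hρ4]; field_simp; ring
  have hfirst := (hsp (S.b x) (S.b y)).1
  have hbK : inner ℝ z (S.b x - S.b y) ≤ S.K * ρ ^ 4 := by
    have h1 := real_inner_le_norm z (S.b x - S.b y)
    have h2 := S.b_bound x y
    rw [← hz] at h2
    have h3 := mul_le_mul_of_nonneg_left h2 hzn.le
    rw [← hρ4]; nlinarith
  have hfirst' : inner ℝ p (S.b x) + inner ℝ q (S.b y) ≤ a * E * (S.K * Λ * ρ / 2) := by
    rw [hfirst]
    have := mul_le_mul_of_nonneg_left hbK (show 0 ≤ a * E * (Λ / (2 * ρ ^ 3)) by positivity)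
    calc _ = a * E * (Λ / (2 * ρ ^ 3)) * inner ℝ z (S.b x - S.b y) := by ring
      _ ≤ _ := this
      _ = _ := by field_simp
  have hk := hkey x hx y hy ρ hρ hρ2
  rw [← hE] at hk
  have hc'' := mul_le_mul_of_nonneg_left hc' hε.le
  rw [real_inner_comm] at hwin hvin
  have e : a * E * (-(ε * S.θ₀ * Λ ^ 2 / (2 * ρ ^ 2)) + S.K * Λ * ρ / 2) =
    ε * -(a * E * S.θ₀ * Λ ^ 2 / (2 * ρ ^ 2)) + a * E * (S.K * Λ * ρ / 2) := by ring
  rw [e] at hk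
  rw [mul_add] at hc''
  linarith
end

open Set Filter Metric Topology
open scoped ENNReal

noncomputable section
variable {n : ℕ} {S : SettingB n} {α : Eu n → Matrix (Fin n) (Fin n) ℝ}

lemma ev_small {P : ℝ → Prop} (h : ∀ᶠ ε in 𝓝[>] (0:ℝ), P ε) : ∃ ε0 > (0:ℝ), ∀ ε ∈ Ioo 0 ε0, P ε := by
  obtain ⟨e, he, hs⟩ := mem_nhdsGT_iff_exists_Ioo_subset.1 h
  exact ⟨e, he, fun ε hε => hs hε⟩

lemma ev_of {P : ℝ → Prop} {ε0 : ℝ} (h0 : 0 < ε0) (h : ∀ ε ∈ Ioo 0 ε0, P ε) : ∀ᶠ ε in 𝓝[>] (0:ℝ), P ε :=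
  mem_nhdsGT_iff_exists_Ioo_subset.2 ⟨ε0, h0, h⟩

lemma ev_lt {c : ℝ} (hc : 0 < c) : ∀ᶠ ε in 𝓝[>] (0:ℝ), ε < c :=
  ev_of hc fun _ h => h.2

lemma ev_pos : ∀ᶠ ε in 𝓝[>] (0:ℝ), 0 < ε := ev_of one_pos fun _ h => h.1

lemma ev_div {c : ℝ} (hc : 0 < c) (D : ℝ) : ∀ᶠ ε in 𝓝[>] (0:ℝ), D < c / ε := by
  have : Tendsto (fun ε : ℝ => c * ε⁻¹) (𝓝[>] 0) atTop := tendsto_inv_nhdsGT_zero.const_mul_atTop hc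
  simpa [div_eq_mul_inv] using this.eventually_gt_atTop D

lemma ev_exp {c : ℝ} (hc : 0 < c) (D : ℝ) : ∀ᶠ ε in 𝓝[>] (0:ℝ), D < Real.exp (c / ε) := by
  filter_upwards [ev_div hc D] with ε h
  linarith [Real.add_one_le_exp (c / ε)]

lemma ev_expn {c η : ℝ} (hc : 0 < c) (hη : 0 < η) (D : ℝ) : ∀ᶠ ε in 𝓝[>] (0:ℝ), D * Real.exp (-c / ε) < η := by
  filter_upwards [ev_exp hc (D / η)] with ε h
  rw [neg_div, Real.exp_neg, ← div_eq_mul_inv, div_lt_iff₀ (Real.exp_pos _)]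
  rw [div_lt_iff₀ hη] at h; linarith

lemma trMul_comm' (A H : Matrix (Fin n) (Fin n) ℝ) : trMul A H = trMul H A := by
  rw [trMul, Finset.sum_comm]
  exact Finset.sum_congr rfl fun i _ => Finset.sum_congr rfl fun j _ => by ring

lemma trMul_lin' (A H : Matrix (Fin n) (Fin n) ℝ) (p : Eu n) (c1 c2 c3 : ℝ) :
    trMul A (fun i j => c1 * (p i * p j) + c2 * (H i j) + c3 * (1 : Matrix (Fin n) (Fin n) ℝ) i j) =
      c1 * mquad A p + c2 * trMul A H + c3 * ∑ i, A i i := by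
  have h := trMul_lin H A p c1 c2 c3
  rw [trMul_comm' H A] at h
  exact (trMul_comm' _ _).trans h

/-- the exponent constant -/
def SettingB.kk (S : SettingB n) : ℝ := S.b₀ * S.θ₀ / 4

lemma SettingB.kk_pos (S : SettingB n) : 0 < S.kk := by
  have := S.b₀_pos; have := S.θpos; unfold SettingB.kk; positivity

def SettingB.chi (S : SettingB n) (ε : ℝ) (x : Eu n) : ℝ := Real.exp (S.kk / ε * ‖x‖ ^ 2)

/-- the generator of chi, upper bound, as function of squared norm. -/
def SettingB.XX (S : SettingB n) (ε s : ℝ) : ℝ := S.kk / ε * Real.exp (S.kk / ε * s) * (2 * ε * n / S.θ₀ - S.b₀ * s)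

lemma chi_sub {ε c t : ℝ} (hε : 0 < ε) (hc : 0 ≤ c) {A : Matrix (Fin n) (Fin n) ℝ} (hA : memS S.θ₀ A)
    {w : Eu n → ℝ → ℝ} {x : Eu n} (hx : x ∈ ball (0 : Eu n) S.r₀) (h : SubAt ε 0 A (S.b x) w x t) :
    SubAt ε (c * S.XX ε (‖x‖ ^ 2)) A (S.b x) (fun x t => w x t - c * S.chi ε x) x t := by
  obtain ⟨wt, p, H, h1, h2, h3⟩ := h
  have hθ := S.θpos
  have hk := S.kk_pos
  set χ := S.chi ε x with hχ
  have hχp : 0 < χ := Real.exp_pos _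
  set k := S.kk with hkd
  refine ⟨wt, p + (-(c * χ * (2 * k / ε))) • x, fun i j => (-(c * χ * (2 * k / ε) ^ 2)) * (x i * x j) + 1 * (H i j)
    + (-(c * χ * (2 * k / ε))) * (1 : Matrix (Fin n) (Fin n) ℝ) i j, ?_, fun ξ => ?_, ?_⟩
  · exact h1.sub_const _
  · have hd := (h2 ξ).sub ((((Der2.normsq_line x ξ).const_mul (k / ε)).exp).const_mul c)
    refine (hd.congr (Eventually.of_forall fun s => ?_)).congr_val ?_ ?_
    · simp only [SettingB.chi]; rfl
    · simp only [zero_smul, add_zero, inner_add_left, inner_smul_left, hχ, SettingB.chi, ← hkd]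
      simp; ring
    · rw [mquad_lin]
      simp only [zero_smul, add_zero, hχ, SettingB.chi, ← hkd]
      ring
  · rw [trMul_lin', inner_add_right, inner_smul_right]
    have hb := S.b_coerc x hx
    rw [dotp_eq] at hb
    have hq := (hA.2 x).2
    have htr := hA.diag_sum
    have key : χ * (k / ε) * (4 * k * mquad A x + 2 * ε * (∑ i, A i i) + 2 * inner ℝ (S.b x) x) ≤
        S.XX ε (‖x‖ ^ 2) := by
      unfold SettingB.XX
      rw [show Real.exp (S.kk / ε * ‖x‖ ^ 2) = χ from rfl, ← hkd, mul_comm (k / ε) χ]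
      refine mul_le_mul_of_nonneg_left ?_ (by positivity)
      have e1 : 4 * k * mquad A x ≤ S.b₀ * ‖x‖ ^ 2 := by
        have := mul_le_mul_of_nonneg_left hq (show 0 ≤ 4 * k by positivity)
        refine this.trans (le_of_eq ?_)
        rw [hkd, SettingB.kk]; field_simp
      have e2 : 2 * ε * (∑ i, A i i) ≤ 2 * ε * n / S.θ₀ := by
        have := mul_le_mul_of_nonneg_left htr (show 0 ≤ 2 * ε by positivity)
        refine this.trans (le_of_eq ?_)
        field_simp
      nlinarith
    have := mul_le_mul_of_nonneg_left key hc
    have e : c * (χ * (k / ε) * (4 * k * mquad A x + 2 * ε * (∑ i, A i i) + 2 * inner ℝ (S.b x) x)) =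
      ε * (c * χ * (2 * k / ε) ^ 2 * mquad A x + c * χ * (2 * k / ε) * ∑ i, A i i) +
        c * χ * (2 * k / ε) * inner ℝ (S.b x) x := by
      field_simp
      ring
    rw [e] at this
    linarith

def SettingB.CX (S : SettingB n) : ℝ := S.kk * (2 * n / S.θ₀) * Real.exp (S.kk * (2 * n / S.θ₀) / S.b₀)

lemma SettingB.CX_nonneg (S : SettingB n) : 0 ≤ S.CX := by
  have := S.kk_pos; have := S.θpos; unfold SettingB.CX; positivity

lemma XX_le {ε s : ℝ} (hε : 0 < ε) (hs : 0 ≤ s) : S.XX ε s ≤ S.CX := by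
  have hk := S.kk_pos
  have hθ := S.θpos
  have hb := S.b₀_pos
  by_cases h : S.b₀ * s ≤ 2 * ε * n / S.θ₀
  · have h1 : S.kk / ε * s ≤ S.kk * (2 * n / S.θ₀) / S.b₀ := by
      rw [le_div_iff₀ hb]
      calc S.kk / ε * s * S.b₀ = S.kk / ε * (S.b₀ * s) := by ring
        _ ≤ S.kk / ε * (2 * ε * n / S.θ₀) := mul_le_mul_of_nonneg_left h (by positivity)
        _ = _ := by field_simp
    have h2 := Real.exp_le_exp.2 h1
    unfold SettingB.XX SettingB.CX
    calc S.kk / ε * Real.exp (S.kk / ε * s) * (2 * ε * n / S.θ₀ - S.b₀ * s) ≤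
        S.kk / ε * Real.exp (S.kk * (2 * n / S.θ₀) / S.b₀) * (2 * ε * n / S.θ₀) := by
          refine mul_le_mul (mul_le_mul_of_nonneg_left h2 (by positivity)) (by nlinarith) (by linarith) (by positivity)
      _ = _ := by field_simp
  · push Not at h
    refine le_trans ?_ S.CX_nonneg
    unfold SettingB.XX
    exact mul_nonpos_of_nonneg_of_nonpos (by positivity) (by linarith)

lemma XX_neg {ε s Q : ℝ} (hε : 0 < ε) (hQ : 0 < Q) (hs : Q / 4 ≤ s) (h : 2 * ε * n / S.θ₀ ≤ S.b₀ * Q / 8) :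
    S.XX ε s ≤ - (S.kk * S.b₀ * Q / 8 / ε * Real.exp (S.kk * Q / 8 / ε) ^ 2) := by
  have hk := S.kk_pos
  have hθ := S.θpos
  have hb := S.b₀_pos
  have h1 : Real.exp (S.kk * Q / 8 / ε) ^ 2 ≤ Real.exp (S.kk / ε * s) := by
    rw [← Real.exp_nat_mul]
    refine Real.exp_le_exp.2 ?_
    calc ((2:ℕ):ℝ) * (S.kk * Q / 8 / ε) = S.kk / ε * (Q / 4) := by push_cast; ring
      _ ≤ _ := mul_le_mul_of_nonneg_left hs (by positivity)
  have h2 : S.b₀ * Q / 8 ≤ S.b₀ * s - 2 * ε * n / S.θ₀ := by nlinarith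
  have h3 : Real.exp (S.kk * Q / 8 / ε) ^ 2 * (S.b₀ * Q / 8) ≤ Real.exp (S.kk / ε * s) * (S.b₀ * s - 2 * ε * n / S.θ₀) :=
    mul_le_mul h1 h2 (by positivity) (by positivity)
  have h4 := mul_le_mul_of_nonneg_left h3 (show 0 ≤ S.kk / ε by positivity)
  unfold SettingB.XX
  have e : S.kk * S.b₀ * Q / 8 / ε * Real.exp (S.kk * Q / 8 / ε) ^ 2 = S.kk / ε * (Real.exp (S.kk * Q / 8 / ε) ^ 2 * (S.b₀ * Q / 8)) := by ring
  rw [e]; linarith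
end

open Set Filter Metric Topology
open scoped ENNReal

noncomputable section
variable {n : ℕ} {S : SettingB n} {α : Eu n → Matrix (Fin n) (Fin n) ℝ}

set_option maxHeartbeats 1600000 in
lemma contraction_key (S : SettingB n) {R : ℝ} (hR : 0 < R) : ∃ c' > (0:ℝ), c' < S.kk * R ^ 2 ∧
    ∀ᶠ ε in 𝓝[>] (0:ℝ), ∃ Λ > (0:ℝ), ∀ x ∈ ball (0 : Eu n) R, ∀ y ∈ ball (0 : Eu n) R, ∀ ρ : ℝ, 0 < ρ →
      ‖x - y‖ = ρ ^ 2 →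
      (1/4) * Real.exp (-Λ * ρ) * (- (ε * S.θ₀ * Λ ^ 2 / (2 * ρ ^ 2)) + S.K * Λ * ρ / 2) +
        Real.exp (-(S.kk * R ^ 2) / ε) * (S.XX ε (‖x‖ ^ 2) + S.XX ε (‖y‖ ^ 2)) < - (Real.exp (-c' / ε) / 4) := by
  have hk := S.kk_pos
  have hθ := S.θpos
  have hb := S.b₀_pos
  have hK : (0:ℝ) ≤ S.K := S.K.2
  have hC := S.CX_nonneg
  set k := S.kk with hkd
  set θ := S.θ₀ with hθd
  set Q := min (R ^ 2) (θ * k * R ^ 2 / (4 * (S.K + 1))) with hQd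
  have hQ : 0 < Q := lt_min (by positivity) (by positivity)
  have hQ1 : Q ≤ R ^ 2 := min_le_left _ _
  have hQ2 : Q * (4 * (S.K + 1)) ≤ θ * k * R ^ 2 := by
    rw [← le_div_iff₀ (by positivity)]; exact min_le_right _ _
  set ρs := Real.sqrt (Real.sqrt Q) with hρs
  have hρ0 : 0 < ρs := Real.sqrt_pos.2 (Real.sqrt_pos.2 hQ)
  have hρ4 : ρs ^ 4 = Q := by
    have h1 : ρs ^ 2 = Real.sqrt Q := Real.sq_sqrt (Real.sqrt_nonneg Q)
    calc ρs ^ 4 = (ρs ^ 2) ^ 2 := by ring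
      _ = Q := by rw [h1]; exact Real.sq_sqrt hQ.le
  set c' := k * (R ^ 2 - Q / 8) with hc'
  have hc1 : k * R ^ 2 / 2 ≤ c' := by rw [hc']; nlinarith
  have hc0 : 0 < c' := lt_of_lt_of_le (by positivity) hc1
  have hc2 : 2 * S.K * Q ≤ θ * c' := by
    have := mul_le_mul_of_nonneg_left hc1 hθ.le
    linarith
  refine ⟨c', hc0, by rw [hc']; nlinarith [mul_pos hk hQ], ?_⟩
  set c4 := S.K * c' * (2 * R + 1) / (8 * ρs) with hc4
  have hc40 : 0 ≤ c4 := by positivity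
  set c5 := k * S.b₀ * Q / 8 with hc5
  have hc50 : 0 < c5 := by positivity
  have hYp : 0 < k * Q / 8 := by positivity
  filter_upwards [ev_pos, ev_lt one_pos, ev_div (show 0 < θ * c' ^ 2 / (4 * Q) by positivity) 3,
    ev_exp hYp (4 * S.CX), ev_exp hYp ((c4 + S.CX + 1) / c5),
    ev_lt (show 0 < S.b₀ * Q / 8 * θ / (2 * (n + 1)) by positivity)] with ε hε hε1 hA1 hA2 hA3 hA4
  have hA4' : 2 * ε * n / S.θ₀ ≤ S.b₀ * Q / 8 := by
    rw [lt_div_iff₀ (by positivity)] at hA4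
    rw [← hθd, div_le_iff₀ hθ]
    linarith
  set Y := Real.exp (k * Q / 8 / ε) with hY
  have hY1 : 1 ≤ Y := Real.one_le_exp (by positivity)
  set σ := Real.exp (-(k * R ^ 2) / ε) with hσ
  have hσ0 : 0 < σ := Real.exp_pos _
  have he' : Real.exp (-c' / ε) = σ * Y := by
    rw [hσ, hY, ← Real.exp_add]; congr 1; rw [hc']; field_simp; ring
  set Λ := c' / (ε * ρs) with hΛd
  have hΛ : 0 < Λ := by positivity
  have hΛρ : Λ * ρs = c' / ε := by rw [hΛd]; field_simp
  refine ⟨Λ, hΛ, fun x hx y hy ρ hρ hxy => ?_⟩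
  have hX1 := XX_le (S := S) hε (sq_nonneg ‖x‖)
  have hX2 := XX_le (S := S) hε (sq_nonneg ‖y‖)
  rw [he']
  rcases le_total ρ ρs with hle | hle
  · have hE : σ * Y ≤ Real.exp (-Λ * ρ) := by
      rw [← he']
      refine Real.exp_le_exp.2 ?_
      have := mul_le_mul_of_nonneg_left hle hΛ.le
      rw [neg_div, ← hΛρ]; linarith
    have hbr : -(ε * θ * Λ ^ 2 / (2 * ρ ^ 2)) + S.K * Λ * ρ / 2 ≤ -3 := by
      have hρ2 : ρ ^ 2 ≤ ρs ^ 2 := pow_le_pow_left₀ hρ.le hle 2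
      have g1 : ε * θ * Λ ^ 2 / (4 * ρs ^ 2) = θ * c' ^ 2 / (4 * Q) / ε := by
        rw [hΛd, ← hρ4]; field_simp
      have g2 : ε * θ * Λ ^ 2 / (4 * ρs ^ 2) ≤ ε * θ * Λ ^ 2 / (4 * ρ ^ 2) := by gcongr
      have g3 : S.K * Λ * ρ / 2 ≤ ε * θ * Λ ^ 2 / (4 * ρ ^ 2) := by
        rw [le_div_iff₀ (by positivity)]
        have g4 : 2 * S.K * ρ ^ 3 ≤ ε * θ * Λ := by
          have g5 : ε * θ * Λ = θ * c' / ρs := by rw [hΛd]; field_simp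
          rw [g5, le_div_iff₀ hρ0]
          have g6 : ρ ^ 3 * ρs ≤ Q := by
            rw [← hρ4]
            have := pow_le_pow_left₀ hρ.le hle 3
            linarith [mul_le_mul_of_nonneg_right this hρ0.le]
          have := mul_le_mul_of_nonneg_left g6 (show 0 ≤ 2 * (S.K:ℝ) by positivity)
          linarith
        have := mul_le_mul_of_nonneg_right g4 hΛ.le
        linarith
      have g7 : ε * θ * Λ ^ 2 / (2 * ρ ^ 2) = 2 * (ε * θ * Λ ^ 2 / (4 * ρ ^ 2)) := by field_simp; ring
      rw [g7]; linarith
    have h1 : (1/4) * Real.exp (-Λ * ρ) * (-(ε * θ * Λ ^ 2 / (2 * ρ ^ 2)) + S.K * Λ * ρ / 2) ≤ (1/4) * (σ * Y) * (-3) := by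
      have hp := Real.exp_pos (-Λ * ρ)
      linarith [mul_le_mul_of_nonneg_left hbr (show 0 ≤ (1/4) * Real.exp (-Λ * ρ) by positivity)]
    have h2 : σ * (S.XX ε (‖x‖ ^ 2) + S.XX ε (‖y‖ ^ 2)) ≤ σ * (2 * S.CX) := mul_le_mul_of_nonneg_left (by linarith) hσ0.le
    have h3 : σ * (4 * S.CX) < σ * Y := mul_lt_mul_of_pos_left hA2 hσ0
    linarith
  · have hE : Real.exp (-Λ * ρ) ≤ σ * Y := by
      rw [← he']
      refine Real.exp_le_exp.2 ?_
      have := mul_le_mul_of_nonneg_left hle hΛ.le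
      rw [neg_div, ← hΛρ]; linarith
    rw [mem_ball_zero_iff] at hx hy
    have hρR : ρ ≤ 2 * R + 1 := by
      have := norm_sub_le x y
      linarith [sq_nonneg (ρ - 1), sq_nonneg ρ]
    have hbr : -(ε * θ * Λ ^ 2 / (2 * ρ ^ 2)) + S.K * Λ * ρ / 2 ≤ 4 * (c4 / ε) := by
      have g1 : 0 ≤ ε * θ * Λ ^ 2 / (2 * ρ ^ 2) := by positivity
      have g2 : S.K * Λ * ρ / 2 ≤ S.K * Λ * (2 * R + 1) / 2 := by gcongr
      have g3 : S.K * Λ * (2 * R + 1) / 2 = 4 * (c4 / ε) := by rw [hc4, hΛd]; field_simp; ring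
      linarith
    have h1 : (1/4) * Real.exp (-Λ * ρ) * (-(ε * θ * Λ ^ 2 / (2 * ρ ^ 2)) + S.K * Λ * ρ / 2) ≤ σ * Y * (c4 / ε) := by
      have hp := Real.exp_pos (-Λ * ρ)
      have g1 := mul_le_mul_of_nonneg_left hbr (show 0 ≤ (1/4) * Real.exp (-Λ * ρ) by positivity)
      have g2 := mul_le_mul_of_nonneg_right hE (show 0 ≤ c4 / ε by positivity)
      linarith
    have h2 : S.XX ε (‖x‖ ^ 2) + S.XX ε (‖y‖ ^ 2) ≤ S.CX - c5 / ε * Y ^ 2 := by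
      have hor : Q / 4 ≤ ‖x‖ ^ 2 ∨ Q / 4 ≤ ‖y‖ ^ 2 := by
        by_contra hcon
        push Not at hcon
        have g1 := norm_sub_le x y
        have g2 : ρs ^ 2 ≤ ρ ^ 2 := pow_le_pow_left₀ hρ0.le hle 2
        have g3 : ρs ^ 2 ≤ ‖x‖ + ‖y‖ := by linarith
        have g4 : Q ≤ (‖x‖ + ‖y‖) ^ 2 := by
          rw [← hρ4]
          have := pow_le_pow_left₀ (by positivity) g3 2
          linarith
        linarith [sq_nonneg (‖x‖ - ‖y‖)]
      rcases hor with h | h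
      · have := XX_neg (S := S) hε hQ h hA4'
        rw [← hkd, ← hY, ← hc5] at this
        linarith
      · have := XX_neg (S := S) hε hQ h hA4'
        rw [← hkd, ← hY, ← hc5] at this
        linarith
    have h3 := mul_le_mul_of_nonneg_left h2 hσ0.le
    rw [div_lt_iff₀ hc50] at hA3
    have hYp : 0 < Y := by linarith
    have hm := mul_lt_mul_of_pos_right hA3 hYp
    have hCY : S.CX ≤ S.CX * Y := le_mul_of_one_le_right S.CX_nonneg hY1
    have h4 : Y * c4 + S.CX + Y / 4 < c5 * Y ^ 2 := by
      have e1 : Y * c5 * Y = c5 * Y ^ 2 := by ring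
      have e2 : (c4 + S.CX + 1) * Y = Y * c4 + S.CX * Y + Y := by ring
      rw [e1, e2] at hm
      linarith
    have h5 : Y * c4 + ε * S.CX + ε * (Y / 4) < c5 * Y ^ 2 := by
      have : ε * S.CX ≤ S.CX := mul_le_of_le_one_left S.CX_nonneg hε1.le
      have : ε * (Y / 4) ≤ Y / 4 := mul_le_of_le_one_left (by linarith) hε1.le
      linarith
    have h6 : Y * (c4 / ε) + S.CX + Y / 4 < c5 / ε * Y ^ 2 := by
      have e1 : Y * (c4 / ε) + S.CX + Y / 4 = (Y * c4 + ε * S.CX + ε * (Y / 4)) / ε := by field_simp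
      have e2 : c5 / ε * Y ^ 2 = c5 * Y ^ 2 / ε := by ring
      rw [e1, e2]
      exact (div_lt_div_iff_of_pos_right hε).2 h5
    have h7 := mul_lt_mul_of_pos_left h6 hσ0
    have e1 : σ * (Y * (c4 / ε) + S.CX + Y / 4) = σ * Y * (c4 / ε) + σ * S.CX + σ * Y / 4 := by ring
    have e2 : σ * (S.CX - c5 / ε * Y ^ 2) = σ * S.CX - σ * (c5 / ε * Y ^ 2) := by ring
    rw [e1] at h7
    rw [e2] at h3
    linarith

set_option maxHeartbeats 1600000 in
theorem contraction (S : SettingB n) {R ϖ : ℝ} (hR : 0 < R) (hRr : R ≤ S.r₀) (hϖ : 0 ≤ ϖ)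
    (hsm : (2 * n ^ 2 + n) * ϖ ≤ S.θ₀) : ∃ c' > (0:ℝ), c' < S.kk * R ^ 2 ∧
    ∀ᶠ ε in 𝓝[>] (0:ℝ), ∀ (u : Eu n → ℝ → ℝ) (m t0 t1 : ℝ), S.SolvesQL ε u → 0 ≤ t0 → 0 < m →
      t1 = t0 + 2 * Real.exp (c' / ε) →
      (∀ x ∈ closedBall (0 : Eu n) R, ∀ y ∈ closedBall (0 : Eu n) R, ∀ t ∈ Icc t0 t1, u x t - u y t ≤ m) →
      (∀ x ∈ ball (0 : Eu n) R, ∀ y ∈ ball (0 : Eu n) R, ∀ t ∈ Ioc t0 t1, MClose ϖ (S.a x (u x t)) (S.a y (u y t))) →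
      ∀ x ∈ closedBall (0 : Eu n) (R / 2), ∀ y ∈ closedBall (0 : Eu n) (R / 2), u x t1 - u y t1 ≤ 7 / 8 * m := by
  have hk := S.kk_pos
  obtain ⟨c', hc0, hc1, hev⟩ := contraction_key S hR
  refine ⟨c', hc0, hc1, ?_⟩
  filter_upwards [ev_pos, hev, ev_expn (show 0 < S.kk * R ^ 2 * (3/4) by positivity) (show (0:ℝ) < 1/8 by norm_num) 2]
    with ε hε hkey hfin u m t0 t1 hu ht0 hm ht1 hosc hcl x hx y hy
  obtain ⟨Λ, hΛ, hkey⟩ := hkey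
  set σ := Real.exp (-(S.kk * R ^ 2) / ε) with hσ
  have hσ0 : 0 < σ := Real.exp_pos _
  have hE0 : 0 < Real.exp (c' / ε) := Real.exp_pos _
  have ht01 : t0 ≤ t1 := by rw [ht1]; linarith
  have hmσ : 0 ≤ m * σ := by positivity
  have hsub : closedBall (0 : Eu n) R ⊆ S.Ω := (closedBall_subset_closedBall hRr).trans S.ball_sub
  have hbsub : ball (0 : Eu n) R ⊆ ball (0 : Eu n) S.r₀ := ball_subset_ball hRr
  have hu1 := hu.toSub (t1 := t0) (t2 := t1) ht0
  have hu2 := hu.toSub_neg (t1 := t0) (t2 := t1) ht0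
  have hcx : Continuous (S.chi ε) := by unfold SettingB.chi; fun_prop
  have hcc : ContinuousOn (fun q : Eu n × ℝ => m * σ * S.chi ε q.1) (closedBall 0 R ×ˢ Icc t0 t1) :=
    (continuous_const.mul (hcx.comp continuous_fst)).continuousOn
  have hmono : closedBall (0 : Eu n) R ×ˢ Icc t0 t1 ⊆ closure S.Ω ×ˢ Icc t0 t1 :=
    prod_mono (hsub.trans subset_closure) le_rfl
  have hchi0 : ∀ x, 0 < S.chi ε x := fun x => Real.exp_pos _
  have hchiR : ∀ x : Eu n, ‖x‖ = R → σ * S.chi ε x = 1 := fun x hx => by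
    rw [SettingB.chi, hx, hσ, ← Real.exp_add, Real.exp_eq_one_iff]; ring
  have hl : Real.exp (-c' / ε) * Real.exp (c' / ε) = 1 := by
    rw [← Real.exp_add, Real.exp_eq_one_iff]; ring
  have D := doubling (S := S) (R := R) (t0 := t0) (t1 := t1) (m := m) (l := Real.exp (-c' / ε) / 4) (a := m / 4)
    (Λ := Λ) hε hϖ hsm hm hΛ (by positivity) (by rw [ht1]; nlinarith) (by positivity)
    (w1 := fun x t => u x t - m * σ * S.chi ε x) (w2 := fun x t => - u x t - m * σ * S.chi ε x)
    (A := fun x t => S.a x (u x t)) (G := fun x => m * σ * S.XX ε (‖x‖ ^ 2))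
    ((hu1.cont.mono hmono).sub hcc) ((hu2.cont.mono hmono).sub hcc)
    (fun x hx t ht => hu1.mem x (hsub (ball_subset_closedBall hx)) t ht)
    (fun x hx t ht => chi_sub hε hmσ (hu1.mem x (hsub (ball_subset_closedBall hx)) t ht) (hbsub hx)
      (hu1.sub x (hsub (ball_subset_closedBall hx)) t ht))
    (fun x hx t ht => chi_sub hε hmσ (hu1.mem x (hsub (ball_subset_closedBall hx)) t ht) (hbsub hx)
      (hu2.sub x (hsub (ball_subset_closedBall hx)) t ht))
    hcl
    (fun x hx y hy => by
      have h1 := hosc x hx y hy t0 ⟨le_rfl, ht01⟩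
      have h2 := mul_nonneg hmσ (hchi0 x).le
      have h3 := mul_nonneg hmσ (hchi0 y).le
      show u x t0 - m * σ * S.chi ε x + (- u y t0 - m * σ * S.chi ε y) ≤ m
      linarith)
    (fun x hx y hy t ht hor => by
      have h1 := hosc x hx y hy t ht
      have h2 := mul_nonneg hmσ (hchi0 x).le
      have h3 := mul_nonneg hmσ (hchi0 y).le
      show u x t - m * σ * S.chi ε x + (- u y t - m * σ * S.chi ε y) ≤ 0
      rcases hor with h | h
      · have := hchiR x h
        rw [mul_assoc m σ (S.chi ε x), this]; linarith
      · have := hchiR y h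
        rw [mul_assoc m σ (S.chi ε y), this]; linarith)
    (fun x hx t ht => by
      have h2 := mul_nonneg hmσ (hchi0 x).le
      show u x t - m * σ * S.chi ε x + (- u x t - m * σ * S.chi ε x) ≤ 0
      linarith)
    (fun x hx y hy ρ hρ hxy => by
      have := mul_lt_mul_of_pos_left (hkey x hx y hy ρ hρ hxy) hm
      show m / 4 * Real.exp (-Λ * ρ) * (- (ε * S.θ₀ * Λ ^ 2 / (2 * ρ ^ 2)) + S.K * Λ * ρ / 2) +
        m * σ * S.XX ε (‖x‖ ^ 2) + m * σ * S.XX ε (‖y‖ ^ 2) < - (m * (Real.exp (-c' / ε) / 4))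
      linarith)
    x ((closedBall_subset_closedBall (by linarith)) hx) y ((closedBall_subset_closedBall (by linarith)) hy) t1 ⟨ht01, le_rfl⟩
  have hchf : ∀ x ∈ closedBall (0 : Eu n) (R / 2), 2 * (σ * S.chi ε x) ≤ 1/8 := fun x hx => by
    refine le_trans ?_ hfin.le
    rw [SettingB.chi, hσ, ← Real.exp_add]
    have : ‖x‖ ^ 2 ≤ (R / 2) ^ 2 := pow_le_pow_left₀ (norm_nonneg _) (mem_closedBall_zero_iff.1 hx) 2
    have h2 := mul_le_mul_of_nonneg_left this (show 0 ≤ S.kk / ε by positivity)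
    have : -(S.kk * R ^ 2) / ε + S.kk / ε * ‖x‖ ^ 2 ≤ -(S.kk * R ^ 2 * (3 / 4)) / ε := by
      have e : -(S.kk * R ^ 2 * (3 / 4)) / ε = -(S.kk * R ^ 2) / ε + S.kk / ε * (R / 2) ^ 2 := by field_simp; ring
      rw [e]; linarith
    have := Real.exp_le_exp.2 this
    linarith
  have h1 := mul_le_mul_of_nonneg_left (hchf x hx) hm.le
  have h2 := mul_le_mul_of_nonneg_left (hchf y hy) hm.le
  have e3 : Real.exp (-c' / ε) / 4 * (t1 - t0) = 1 / 2 := by rw [ht1]; linarith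
  rw [e3] at D
  linarith
end

open Set Filter Metric Topology
open scoped ENNReal

noncomputable section
variable {n : ℕ} {S : SettingB n} {α : Eu n → Matrix (Fin n) (Fin n) ℝ}

/-- local upper barrier near the origin. -/
lemma init_ball {ε R D E C t1 t2 : ℝ} (hε : 0 < ε) (hRr : R ≤ S.r₀)
    {A : Eu n → ℝ → Matrix (Fin n) (Fin n) ℝ} {w : Eu n → ℝ → ℝ} (h : PSub S ε 0 A w t1 t2)
    (hE : 0 < E) (hCD : C ≤ D + E) (hC : ∀ x ∈ closure S.Ω, ∀ t ∈ Icc t1 t2, w x t ≤ C)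
    (hi : ∀ x ∈ closedBall (0 : Eu n) R, w x t1 ≤ D) (hR : 0 < R) (h12 : t1 ≤ t2) :
    ∀ x ∈ closure S.Ω, ∀ t ∈ Icc t1 t2,
      w x t ≤ D + E * Real.exp (-(S.kk * R ^ 2) / ε) * (S.chi ε x + (S.CX + 1) * (t - t1)) := by
  have hk := S.kk_pos
  have hCX := S.CX_nonneg
  set c := E * Real.exp (-(S.kk * R ^ 2) / ε) with hc
  have hc0 : 0 < c := mul_pos hE (Real.exp_pos _)
  have hcx : Continuous (S.chi ε) := by unfold SettingB.chi; fun_prop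
  have hchi0 : ∀ x, 0 < S.chi ε x := fun x => Real.exp_pos _
  have hout : ∀ x : Eu n, R ≤ ‖x‖ → ∀ t, t1 ≤ t → C ≤ D + c * (S.chi ε x + (S.CX + 1) * (t - t1)) := by
    intro x hx t ht
    have h1 : E ≤ c * S.chi ε x := by
      rw [hc, mul_assoc, SettingB.chi, ← Real.exp_add]
      refine le_mul_of_one_le_right hE.le (Real.one_le_exp ?_)
      have h2 : R ^ 2 ≤ ‖x‖ ^ 2 := pow_le_pow_left₀ hR.le hx 2
      have h3 := mul_le_mul_of_nonneg_left h2 (show 0 ≤ S.kk / ε by positivity)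
      have e : -(S.kk * R ^ 2) / ε = - (S.kk / ε * R ^ 2) := by ring
      rw [e]; linarith
    have h4 : 0 ≤ c * ((S.CX + 1) * (t - t1)) := mul_nonneg hc0.le (mul_nonneg (by linarith) (by linarith))
    rw [mul_add]; linarith
  refine MP hε.le h (fun x t => D + c * (S.chi ε x + (S.CX + 1) * (t - t1))) ?_ ?_ ?_ ?_
  · exact (continuous_const.add (continuous_const.mul ((hcx.comp continuous_fst).add (by fun_prop)))).continuousOn
  · intro x hx
    by_cases hxR : ‖x‖ ≤ R
    · have := hi x (mem_closedBall_zero_iff.2 hxR)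
      have := mul_pos hc0 (hchi0 x)
      show w x t1 ≤ D + c * (S.chi ε x + (S.CX + 1) * (t1 - t1))
      rw [sub_self, mul_zero, add_zero]; linarith
    · exact (hC x hx t1 ⟨le_rfl, h12⟩).trans (hout x (by linarith) t1 le_rfl)
  · intro x hx t ht
    have hxR : R ≤ ‖x‖ := by
      by_contra hcon
      have : x ∈ S.Ω := S.ball_sub (mem_closedBall_zero_iff.2 (by linarith))
      have h2 := hx.2
      rw [S.isOpen.interior_eq] at h2
      exact h2 this
    exact (hC x (S.front_sub hx) t ht).trans (hout x hxR t ht.1)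
  · intro x hx t ht hlt
    have hxR : ‖x‖ < R := by
      by_contra hcon
      push Not at hcon
      have := (hC x (subset_closure hx) t ⟨ht.1.le, ht.2⟩).trans (hout x hcon t ht.1.le)
      linarith
    have h0 : SubAt ε 0 (A x t) (S.b x) (fun (_ : Eu n) (_ : ℝ) => (0:ℝ)) x t :=
      ⟨0, 0, 0, hasDerivAt_const _ _, fun ξ => (Der2.const _).congr_val (by simp) (by simp [mquad]), by simp [trMul]⟩
    obtain ⟨wt, p, H, h1, h2, h3⟩ := chi_sub hε hc0.le (h.mem x hx t ht)
      (mem_ball_zero_iff.2 (hxR.trans_le hRr)) h0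
    have hw : wt = 0 := h1.unique (hasDerivAt_const _ _)
    refine ⟨c * (S.CX + 1), fun ξ => - inner ℝ p ξ, fun ξ => - mquad H ξ, ?_, fun ξ => ?_, fun B hB => ?_⟩
    · exact (((((hasDerivAt_id t).sub_const t1).const_mul (S.CX + 1)).const_add (S.chi ε x)).const_mul c |>.const_add D).congr_deriv (by ring)
    · refine (((h2 ξ).neg.add (Der2.const (D + c * ((S.CX + 1) * (t - t1))))).congr
        (Eventually.of_forall fun τ => ?_)).congr_val (by ring) (by ring)
      ring
    · have e1 := hB.trMul_eq H
      have e2 := mul_le_mul_of_nonneg_left (XX_le (S := S) hε (sq_nonneg ‖x‖)) hc0.le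
      rw [Finset.sum_neg_distrib, ← e1]
      show ε * -trMul (A x t) H + - inner ℝ p (S.b x) + 0 < c * (S.CX + 1)
      rw [hw] at h3
      have e3 := real_inner_comm p (S.b x)
      have e4 : ε * -trMul (A x t) H = -(ε * trMul (A x t) H) := by ring
      have e5 : c * (S.CX + 1) = c * S.CX + c := by ring
      rw [e4, e5]
      linarith

lemma tube (S : SettingB n) {K : Set (Eu n)} (hK : IsCompact K) (hKΩ : K ⊆ S.Ω) (T : ℝ) :
    ∃ r > (0:ℝ), ∀ x0 ∈ K, ∀ s ∈ Icc 0 T, ∀ x ∈ frontier S.Ω, r ≤ ‖x - S.X s x0‖ := by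
  have hc : IsCompact ((fun q : ℝ × Eu n => S.X q.1 q.2) '' (Icc 0 T ×ˢ K)) :=
    (isCompact_Icc.prod hK).image_of_continuousOn
      (S.X_contOn.mono (prod_mono (fun t ht => ht.1) (subset_univ _)))
  have hsub : (fun q : ℝ × Eu n => S.X q.1 q.2) '' (Icc 0 T ×ˢ K) ⊆ S.Ω := by
    rintro _ ⟨⟨s, x⟩, ⟨hs, hx⟩, rfl⟩
    exact S.X_mem' (hKΩ hx) hs.1
  obtain ⟨r, hr, hrs⟩ := hc.exists_thickening_subset_open S.isOpen hsub
  refine ⟨r, hr, fun x0 hx0 s hs x hx => ?_⟩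
  by_contra hcon
  push Not at hcon
  have h2 := hx.2
  rw [S.isOpen.interior_eq] at h2
  refine h2 (hrs ?_)
  rw [mem_thickening_iff]
  exact ⟨_, ⟨(s, x0), ⟨hs, hx0⟩, rfl⟩, by rw [dist_eq_norm]; exact hcon⟩

lemma transp_osc (S : SettingB n) {K : Set (Eu n)} (hK : IsCompact K) (hKΩ : K ⊆ S.Ω) {T ρ ζ : ℝ} (hT : 0 < T)
    (hρ : 0 < ρ) (hX : ∀ x ∈ K, ‖S.X T x‖ < ρ / 2) (hB : closedBall (0 : Eu n) ρ ⊆ S.Ω) (hζ : 0 < ζ) :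
    ∀ᶠ ε in 𝓝[>] (0:ℝ), ∀ u : Eu n → ℝ → ℝ, S.SolvesQL ε u → S.BC u → ∀ s m : ℝ, 0 ≤ s →
      (∀ x ∈ closedBall (0 : Eu n) ρ, ∀ y ∈ closedBall (0 : Eu n) ρ, u x s - u y s ≤ m) →
      ∀ x ∈ K, ∀ y ∈ K, u x (s + T) - u y (s + T) ≤ m + ζ := by
  obtain ⟨r0, hr0, htube⟩ := tube S hK hKΩ T
  obtain ⟨C, hC, hgC⟩ := S.g_bdd
  set r := min r0 (ρ / 2) with hr
  have hrp : 0 < r := lt_min hr0 (by linarith)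
  obtain ⟨κ, hκ, ε0, hε0, htr⟩ := transport S hT hrp
  filter_upwards [ev_of hε0 htr, ev_pos, ev_expn hκ hζ (4 * C)] with ε htr hε hsm u hu hbc s m hs hosc x hx y hy
  have hab := fun (x : Eu n) (hx : x ∈ closure S.Ω) (t : ℝ) (ht : 0 ≤ t) =>
    _root_.abs_le.1 (hu.abs_bd hε.le hbc hgC hx ht)
  have hBc : closedBall (0 : Eu n) ρ ⊆ closure S.Ω := hB.trans subset_closure
  have hcont : ContinuousOn (fun x => u x s) (closedBall (0 : Eu n) ρ) :=
    hu.cont.comp (f := fun x => (x, s)) (by fun_prop) fun x hx => ⟨hBc hx, hs⟩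
  have hne : (closedBall (0 : Eu n) ρ).Nonempty := ⟨0, by simp [hρ.le]⟩
  obtain ⟨z1, hz1, hmax⟩ := (isCompact_closedBall (0 : Eu n) ρ).exists_isMaxOn hne hcont
  obtain ⟨z2, hz2, hmin⟩ := (isCompact_closedBall (0 : Eu n) ρ).exists_isMinOn hne hcont
  have hball : ∀ x0 ∈ K, ∀ x : Eu n, ‖x - S.X T x0‖ < r → x ∈ closedBall (0 : Eu n) ρ := by
    intro x0 hx0 x hx
    have h1 := hX x0 hx0
    have h2 : r ≤ ρ / 2 := min_le_right _ _
    have h3 := norm_add_le (x - S.X T x0) (S.X T x0)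
    rw [sub_add_cancel] at h3
    rw [mem_closedBall_zero_iff]; linarith
  have hvac : ∀ x0 ∈ K, ∀ x ∈ frontier S.Ω, ∀ t ∈ Icc s (s + T), ¬ ‖x - S.X (T - (t - s)) x0‖ < r := by
    intro x0 hx0 x hx t ht
    have := htube x0 hx0 (T - (t - s)) ⟨by linarith [ht.2], by linarith [ht.1]⟩ x hx
    have h2 : r ≤ r0 := min_le_left _ _
    linarith
  have a1 := hab z1 (hBc hz1) s hs
  have a2 := hab z2 (hBc hz2) s hs
  have h1 := htr 0 (u z1 s) (2 * C) s _ _ x (by linarith) le_rfl (hu.toSub hs) (subset_closure (hKΩ hx))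
    (fun y hy => by linarith [(hab y hy s hs).2])
    (fun y _ hyr => hmax (hball x hx y hyr))
    (fun y hy t ht => by linarith [(hab y (S.front_sub hy) t (hs.trans ht.1)).2])
    (fun y hy t ht hyr => absurd hyr (hvac x hx y hy t ht))
  have h2 := htr 0 (- u z2 s) (2 * C) s _ _ y (by linarith) le_rfl (hu.toSub_neg hs) (subset_closure (hKΩ hy))
    (fun y hy => by linarith [(hab y hy s hs).1])
    (fun z _ hzr => neg_le_neg (hmin (hball y hy z hzr)))
    (fun y hy t ht => by linarith [(hab y (S.front_sub hy) t (hs.trans ht.1)).1])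
    (fun z hz t ht hzr => absurd hzr (hvac y hy z hz t ht))
  have h3 := hosc z1 hz1 z2 hz2
  linarith

set_option maxHeartbeats 1600000 in
theorem const_ball (S : SettingB n) {η : ℝ} (hη : 0 < η) : ∃ R > (0:ℝ), R ≤ S.r₀ ∧ ∀ᶠ ε in 𝓝[>] (0:ℝ),
    ∀ u : Eu n → ℝ → ℝ, S.SolvesQL ε u → S.BC u → ∀ t : ℝ, 0 ≤ t →
      ∀ x ∈ closedBall (0 : Eu n) R, ∀ y ∈ closedBall (0 : Eu n) R, u x t - u y t ≤ η := by
  obtain ⟨C, hC, hgC⟩ := S.g_bdd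
  have hθ := S.θpos
  have hk := S.kk_pos
  have hCX := S.CX_nonneg
  set ϖ := S.θ₀ / (2 * n ^ 2 + n + 1) with hϖ
  have hden : (0:ℝ) < 2 * n ^ 2 + n + 1 := by positivity
  have hϖ0 : 0 < ϖ := by positivity
  have hsm : (2 * n ^ 2 + n) * ϖ ≤ S.θ₀ := by
    rw [hϖ, mul_div_assoc', div_le_iff₀ hden]; nlinarith
  obtain ⟨d, hd, hdm⟩ := mat_unif (f := fun p : Eu n × ℝ => S.a p.1 p.2) (S.cpt.prod (isCompact_Icc (a := -C) (b := C)))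
    (S.a_cont.mono (prod_mono le_rfl (subset_univ _))) hϖ0
  set η' := min η d with hη'
  have hη'0 : 0 < η' := lt_min hη hd
  have hη'1 : η' ≤ η := min_le_left _ _
  have hη'2 : η' ≤ d := min_le_right _ _
  have hg0 : ContinuousAt S.g 0 := S.g_cont.continuousAt (mem_of_superset (S.isOpen.mem_nhds S.zero_mem) subset_closure)
  obtain ⟨e, he, hge⟩ := Metric.continuousAt_iff.1 hg0 (η' / 4) (by linarith)
  set R0 := min (min (e / 2) d) S.r₀ with hR0
  have hR0p : 0 < R0 := lt_min (lt_min (by linarith) hd) S.r₀_pos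
  have hR0e : R0 ≤ e / 2 := (min_le_left _ _).trans (min_le_left _ _)
  have hR0d : R0 ≤ d := (min_le_left _ _).trans (min_le_right _ _)
  have hR0r : R0 ≤ S.r₀ := min_le_right _ _
  have hgR : ∀ x ∈ closedBall (0 : Eu n) R0, |S.g x - S.g 0| ≤ η' / 4 := fun x hx =>
    (hge (lt_of_le_of_lt (mem_closedBall.1 hx) (by linarith))).le
  set R := R0 / 2 with hR
  have hRp : 0 < R := by linarith
  have hRr : R ≤ S.r₀ := by linarith
  have hBR : ∀ {ρ : ℝ}, ρ ≤ S.r₀ → closedBall (0 : Eu n) ρ ⊆ S.Ω := fun h => (closedBall_subset_closedBall h).trans S.ball_sub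
  obtain ⟨c', hc'0, hc'1, hctr⟩ := contraction S hRp hRr hϖ0.le hsm
  obtain ⟨T1, hT1, hatt⟩ := S.X_attract (isCompact_closedBall (0 : Eu n) R) (r := R / 2 / 2) (by linarith)
  refine ⟨R, hRp, hRr, ?_⟩
  filter_upwards [ev_pos, hctr, transp_osc S (isCompact_closedBall (0 : Eu n) R) (hBR hRr) hT1 (ρ := R / 2) (ζ := η' / 8)
    (by linarith) (hatt T1 le_rfl) (hBR (by linarith)) (by linarith),
    ev_expn (show 0 < 3 / 4 * (S.kk * R0 ^ 2) by positivity) (show 0 < η' / 4 by linarith)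
      (2 * C + 2 * C * (S.CX + 1) * (2 + T1))] with ε hε hctr htr hsmall u hu hbc
  have hab := fun (x : Eu n) (hx : x ∈ closure S.Ω) (t : ℝ) (ht : 0 ≤ t) =>
    _root_.abs_le.1 (hu.abs_bd hε.le hbc hgC hx ht)
  set T := 2 * Real.exp (c' / ε) with hT
  have hT0 : 0 < T := by positivity
  -- initial layer
  have herr : ∀ x ∈ closedBall (0 : Eu n) R, ∀ t ∈ Icc 0 (T + T1),
      2 * C * Real.exp (-(S.kk * R0 ^ 2) / ε) * (S.chi ε x + (S.CX + 1) * (t - 0)) ≤ η' / 4 := by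
    intro x hx t ht
    set Z := Real.exp (S.kk * R0 ^ 2 / 4 / ε) with hZ
    have hZ1 : 1 ≤ Z := Real.one_le_exp (by positivity)
    have h1 : S.chi ε x ≤ Z := by
      refine Real.exp_le_exp.2 ?_
      have h2 : ‖x‖ ^ 2 ≤ R ^ 2 := pow_le_pow_left₀ (norm_nonneg _) (mem_closedBall_zero_iff.1 hx) 2
      have h3 := mul_le_mul_of_nonneg_left h2 (show 0 ≤ S.kk / ε by positivity)
      have e : S.kk * R0 ^ 2 / 4 / ε = S.kk / ε * R ^ 2 := by rw [hR]; ring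
      rw [e]; exact h3
    have h2 : Real.exp (c' / ε) ≤ Z := by
      refine Real.exp_le_exp.2 ((div_le_div_iff_of_pos_right hε).2 ?_)
      have e : S.kk * R0 ^ 2 / 4 = S.kk * R ^ 2 := by rw [hR]; ring
      rw [e]; exact hc'1.le
    have h3 : t ≤ (2 + T1) * Z := by
      have := mul_le_mul_of_nonneg_left hZ1 hT1.le
      have := ht.2
      rw [add_mul]; linarith
    have h4 : S.chi ε x + (S.CX + 1) * (t - 0) ≤ (1 + (S.CX + 1) * (2 + T1)) * Z := by
      have := mul_le_mul_of_nonneg_left h3 (show 0 ≤ S.CX + 1 by linarith)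
      have e : (1 + (S.CX + 1) * (2 + T1)) * Z = Z + (S.CX + 1) * ((2 + T1) * Z) := by ring
      rw [sub_zero, e]; linarith
    have h5 := mul_le_mul_of_nonneg_left h4 (show 0 ≤ 2 * C * Real.exp (-(S.kk * R0 ^ 2) / ε) by positivity)
    refine h5.trans (le_of_eq_of_le ?_ hsmall.le)
    have e : Real.exp (-(3 / 4 * (S.kk * R0 ^ 2)) / ε) = Real.exp (-(S.kk * R0 ^ 2) / ε) * Z := by
      rw [hZ, ← Real.exp_add]; congr 1; ring
    rw [e]; ring
  have hg0C := _root_.abs_le.1 (hgC 0 S.zero_cl)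
  have hinit : ∀ t ∈ Icc 0 (T + T1), ∀ x ∈ closedBall (0 : Eu n) R, ∀ y ∈ closedBall (0 : Eu n) R, u x t - u y t ≤ η' := by
    intro t ht x hx y hy
    have h1 := init_ball hε hR0r (hu.toSub (t1 := 0) (t2 := T + T1) le_rfl) (E := 2 * C) (D := S.g 0 + η' / 4) (C := C)
      (by linarith) (by linarith) (fun x hx t ht => (hab x hx t ht.1).2)
      (fun x hx => by
        rw [hbc.1 x (subset_closure (hBR hR0r hx))]
        have := (_root_.abs_le.1 (hgR x hx)).2
        linarith) hR0p (by linarith) x (subset_closure (hBR hRr hx)) t ht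
    have h2 := init_ball hε hR0r (hu.toSub_neg (t1 := 0) (t2 := T + T1) le_rfl) (E := 2 * C) (D := - S.g 0 + η' / 4) (C := C)
      (by linarith) (by linarith) (fun x hx t ht => by have := (hab x hx t ht.1).1; linarith)
      (fun x hx => by
        rw [hbc.1 x (subset_closure (hBR hR0r hx))]
        have := (_root_.abs_le.1 (hgR x hx)).1
        linarith) hR0p (by linarith) y (subset_closure (hBR hRr hy)) t ht
    have h3 := herr x hx t ht
    have h4 := herr y hy t ht
    linarith
  have hind : ∀ j : ℕ, ∀ t ∈ Icc 0 (T + T1 + j * T1), ∀ x ∈ closedBall (0 : Eu n) R, ∀ y ∈ closedBall (0 : Eu n) R,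
      u x t - u y t ≤ η' := by
    intro j
    induction j with
    | zero => simpa using hinit
    | succ j ih =>
      intro t ht x hx y hy
      by_cases htl : t ≤ T + T1 + j * T1
      · exact ih t ⟨ht.1, htl⟩ x hx y hy
      push Not at htl
      have ht2 := ht.2
      push_cast at ht2
      have hjT : 0 ≤ (j:ℝ) * T1 := by positivity
      have hc := hctr u η' (t - T1 - T) (t - T1) hu (by linarith) hη'0 (by rw [hT]; ring)
        (fun x hx y hy s hs => ih s ⟨by linarith [hs.1], by linarith [hs.2]⟩ x hx y hy)
        (fun x hx y hy s hs => by
          have hs0 : 0 ≤ s := by linarith [hs.1]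
          have hxc := subset_closure (hBR hRr (ball_subset_closedBall hx))
          have hyc := subset_closure (hBR hRr (ball_subset_closedBall hy))
          have o1 := ih s ⟨hs0, by linarith [hs.2]⟩ x (ball_subset_closedBall hx) y (ball_subset_closedBall hy)
          have o2 := ih s ⟨hs0, by linarith [hs.2]⟩ y (ball_subset_closedBall hy) x (ball_subset_closedBall hx)
          refine hdm (x, u x s) ⟨hxc, hab x hxc s hs0⟩ (y, u y s) ⟨hyc, hab y hyc s hs0⟩ ?_
          rw [Prod.dist_eq]
          refine max_le ?_ ?_
          · have h1 := dist_triangle_right x y 0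
            have h2 := mem_ball.1 hx
            have h3 := mem_ball.1 hy
            show dist x y ≤ d
            linarith
          · show dist (u x s) (u y s) ≤ d
            rw [Real.dist_eq]
            exact _root_.abs_le.2 ⟨by linarith, by linarith⟩)
      have h8 := htr u hu hbc (t - T1) (7 / 8 * η') (by linarith) hc x hx y hy
      rw [sub_add_cancel] at h8
      linarith
  intro t ht x hx y hy
  obtain ⟨j, hj⟩ := exists_nat_ge (t / T1)
  rw [div_le_iff₀ hT1] at hj
  exact (hind j t ⟨ht, by linarith⟩ x hx y hy).trans hη'1

/-- spatial constancy on compact sets. -/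
theorem constancy (S : SettingB n) {η : ℝ} (hη : 0 < η) {K : Set (Eu n)} (hK : IsCompact K) (hKΩ : K ⊆ S.Ω) :
    ∃ T > (0:ℝ), ∀ᶠ ε in 𝓝[>] (0:ℝ),
    ∀ u : Eu n → ℝ → ℝ, S.SolvesQL ε u → S.BC u → ∀ t : ℝ, T ≤ t → ∀ x ∈ K, ∀ y ∈ K, |u x t - u y t| ≤ η := by
  obtain ⟨R, hR, hRr, hev⟩ := const_ball S (half_pos hη)
  obtain ⟨T, hT, hatt⟩ := S.X_attract hK (r := R / 2) (by linarith)
  refine ⟨T, hT, ?_⟩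
  filter_upwards [hev, transp_osc S hK hKΩ hT hR (hatt T le_rfl) ((closedBall_subset_closedBall hRr).trans S.ball_sub)
    (half_pos hη)] with ε h1 h2 u hu hbc t ht x hx y hy
  have h3 := h2 u hu hbc (t - T) (η / 2) (by linarith) (h1 u hu hbc (t - T) (by linarith))
  rw [sub_add_cancel] at h3
  have h4 := h3 x hx y hy
  have h5 := h3 y hy x hx
  exact _root_.abs_le.2 ⟨by linarith, by linarith⟩

end

open Set Filter Metric Topology
open scoped ENNReal

noncomputable section
variable {n : ℕ} {S : SettingB n} {α : Eu n → Matrix (Fin n) (Fin n) ℝ}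

lemma mquad_subm (A B : Matrix (Fin n) (Fin n) ℝ) (c : ℝ) (ξ : Eu n) :
    mquad (fun i j => A i j - c * B i j) ξ = mquad A ξ - c * mquad B ξ := by
  simp only [mquad, Finset.mul_sum, ← Finset.sum_sub_distrib]
  refine Finset.sum_congr rfl fun i _ => Finset.sum_congr rfl fun j _ => ?_
  ring

lemma trMul_subm (M A B : Matrix (Fin n) (Fin n) ℝ) (c : ℝ) :
    trMul M (fun i j => A i j - c * B i j) = trMul M A - c * trMul M B := by
  simp only [trMul, Finset.mul_sum, ← Finset.sum_sub_distrib]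
  refine Finset.sum_congr rfl fun i _ => Finset.sum_congr rfl fun j _ => ?_
  ring

lemma PSub.sub_barrier {ε c e β t1 t2 : ℝ} {A : Eu n → ℝ → Matrix (Fin n) (Fin n) ℝ} {w : Eu n → ℝ → ℝ} {ψ : Eu n → ℝ}
    (h : PSub S ε 0 A w t1 t2) (hc : 0 ≤ c) (hψ : Continuous ψ)
    (hb : ∀ x ∈ S.Ω, ∀ t ∈ Ioc t1 t2, ∃ p H, (∀ ξ, Der2 (fun s => ψ (x + s • ξ)) (inner ℝ p ξ) (mquad H ξ)) ∧
      ε * trMul (A x t) H + inner ℝ (S.b x) p ≤ e) :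
    PSub S ε (c * e) A (fun x t => w x t - β - c * ψ x) t1 t2 := by
  refine ⟨(h.cont.sub continuousOn_const).sub (continuous_const.mul (hψ.comp continuous_fst)).continuousOn, h.mem, ?_⟩
  intro x hx t ht
  obtain ⟨wt, p, H, h1, h2, h3⟩ := h.sub x hx t ht
  obtain ⟨q, J, k1, k2⟩ := hb x hx t ht
  refine ⟨wt, p - c • q, fun i j => H i j - c * J i j, ?_, fun ξ => ?_, ?_⟩
  · exact (h1.sub_const β).sub_const _
  · rw [mquad_subm, inner_sub_left, real_inner_smul_left]
    refine (((h2 ξ).sub ((k1 ξ).const_mul c)).add (Der2.const (-β))).congr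
      (Eventually.of_forall fun τ => ?_) |>.congr_val (by ring) (by ring)
    ring
  · rw [trMul_subm, inner_sub_right, real_inner_smul_right]
    have := mul_le_mul_of_nonneg_left k2 hc
    rw [mul_add] at this
    have e1 : ε * (trMul (A x t) H - c * trMul (A x t) J) = ε * trMul (A x t) H - c * (ε * trMul (A x t) J) := by ring
    rw [e1]
    linarith

lemma crossing {h : ℝ → ℝ} {τ1 τ2 b1 b2 b : ℝ} (h12 : τ1 ≤ τ2) (hc : ContinuousOn h (Icc τ1 τ2)) (h1 : h τ1 = b1) (h2 : h τ2 = b2)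
    (hb1 : b1 < b) (hb2 : b < b2) :
    ∃ s t, τ1 ≤ s ∧ s ≤ t ∧ h s = b ∧ h t = b2 ∧ ∀ r ∈ Icc s t, b ≤ h r ∧ h r ≤ b2 := by
  have cA : IsCompact (Icc τ1 τ2 ∩ h ⁻¹' Ici b2) := by
    exact isCompact_Icc.of_isClosed_subset (hc.preimage_isClosed_of_isClosed isClosed_Icc isClosed_Ici) inter_subset_left
  obtain ⟨t, ht, htl⟩ := cA.exists_isLeast ⟨τ2, ⟨h12, le_rfl⟩, h2.ge⟩
  have hτt : τ1 ≤ t := ht.1.1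
  have hc2 : ContinuousOn h (Icc τ1 t) := hc.mono (Icc_subset_Icc le_rfl ht.1.2)
  have hlt : ∀ r ∈ Icc τ1 t, r < t → h r < b2 := by
    intro r hr hrt
    by_contra hcon
    push Not at hcon
    have := htl ⟨⟨hr.1, hr.2.trans ht.1.2⟩, hcon⟩
    linarith
  have htb : h t = b2 := by
    refine le_antisymm ?_ ht.2
    by_contra hcon
    push Not at hcon
    obtain ⟨r, hr, hrb⟩ := intermediate_value_Icc hτt hc2 (show b2 ∈ Icc (h τ1) (h t) from ⟨by linarith, hcon.le⟩)
    have hne : r < t := lt_of_le_of_ne hr.2 (fun e => by rw [e] at hrb; linarith)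
    have := hlt r hr hne
    linarith
  have cB : IsCompact (Icc τ1 t ∩ h ⁻¹' Iic b) :=
    isCompact_Icc.of_isClosed_subset (hc2.preimage_isClosed_of_isClosed isClosed_Icc isClosed_Iic) inter_subset_left
  obtain ⟨s, hs, hsl⟩ := cB.exists_isGreatest ⟨τ1, ⟨le_rfl, hτt⟩, by show h τ1 ≤ b; linarith⟩
  have hgt : ∀ r ∈ Icc s t, s < r → b < h r := by
    intro r hr hsr
    by_contra hcon
    push Not at hcon
    have := hsl ⟨⟨hs.1.1.trans hr.1, hr.2⟩, hcon⟩
    linarith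
  have hsb : h s = b := by
    refine le_antisymm hs.2 ?_
    by_contra hcon
    push Not at hcon
    obtain ⟨r, hr, hrb⟩ := intermediate_value_Icc hs.1.2 (hc2.mono (Icc_subset_Icc hs.1.1 le_rfl))
      (show b ∈ Icc (h s) (h t) from ⟨hcon.le, by linarith⟩)
    have hne : s < r := lt_of_le_of_ne hr.1 (fun e => by rw [← e] at hrb; linarith)
    have := hgt r hr hne
    linarith
  refine ⟨s, t, hs.1.1, hs.1.2, hsb, htb, fun r hr => ⟨?_, ?_⟩⟩
  · rcases hr.1.eq_or_lt with e | e
    · rw [← e, hsb]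
    · exact (hgt r hr e).le
  · rcases hr.2.eq_or_lt with e | e
    · rw [e, htb]
    · exact (hlt r ⟨hs.1.1.trans hr.1, hr.2⟩ e).le

lemma bdry_gap (S : SettingB n) (hne : (frontier S.Ω).Nonempty) {c : ℝ} (hG : S.Gp c < c) {V : Eu n → ℝ} (hVc : Continuous V)
    (hVq : ∀ x ∈ closure S.Ω, Vq (fun x => S.a x c) S.b S.Ω x = V x) :
    ∃ x0 ∈ frontier S.Ω, (∀ x ∈ frontier S.Ω, V x0 ≤ V x) ∧ ∃ γ > (0:ℝ), ∃ κ1 > (0:ℝ),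
      ∀ x ∈ frontier S.Ω, c - γ ≤ S.g x → V x0 + 4 * κ1 ≤ V x := by
  have hcF : IsCompact (frontier S.Ω) := S.cpt.of_isClosed_subset isClosed_frontier fun x hx => S.front_sub hx
  obtain ⟨x0, hx0, hmin⟩ := hcF.exists_isMinOn hne hVc.continuousOn
  refine ⟨x0, hx0, fun x hx => hmin hx, (c - S.Gp c) / 2, by linarith, ?_⟩
  set γ := (c - S.Gp c) / 2 with hγ
  obtain ⟨C, hC, hgC⟩ := S.g_bdd
  have hbdd : BddAbove (S.Gset c) := ⟨C, by
    rintro _ ⟨x, hx, rfl⟩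
    exact (_root_.abs_le.1 (hgC x (S.front_sub hx.1))).2⟩
  have hgc : ContinuousOn S.g (frontier S.Ω) := S.g_cont.mono fun x hx => S.front_sub hx
  have cB : IsCompact (frontier S.Ω ∩ S.g ⁻¹' Ici (c - γ)) :=
    hcF.of_isClosed_subset (hgc.preimage_isClosed_of_isClosed isClosed_frontier isClosed_Ici) inter_subset_left
  by_cases hB : (frontier S.Ω ∩ S.g ⁻¹' Ici (c - γ)).Nonempty
  · obtain ⟨z, hz, hzmin⟩ := cB.exists_isMinOn hB hVc.continuousOn
    have hlt : V x0 < V z := by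
      refine lt_of_le_of_ne (hmin hz.1) fun e => ?_
      have hz2 : z ∈ argminV (fun x => S.a x c) S.b S.Ω := by
        refine ⟨hz.1, fun y hy => ?_⟩
        rw [hVq z (S.front_sub hz.1), hVq y (S.front_sub hy), ← e]
        exact hmin hy
      have h3 : S.g z ≤ S.Gp c := le_csSup hbdd ⟨z, hz2, rfl⟩
      have h4 : c - γ ≤ S.g z := hz.2
      linarith
    refine ⟨(V z - V x0) / 4, by linarith, fun x hx hgx => ?_⟩
    have : V z ≤ V x := hzmin ⟨hx, hgx⟩
    linarith
  · refine ⟨1, one_pos, fun x hx hgx => absurd ⟨x, hx, hgx⟩ hB⟩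

end

open Set Filter Metric Topology
open scoped ENNReal

noncomputable section
variable {n : ℕ} {S : SettingB n} {α : Eu n → Matrix (Fin n) (Fin n) ℝ}

/-- iteration of the one-block decay estimate. -/
lemma block_iter {ε G T m γ D t0 t1 ϖ ε0 : ℝ} {K : Set (Eu n)} {A : Eu n → ℝ → Matrix (Fin n) (Fin n) ℝ} {w : Eu n → ℝ → ℝ}
    (hε : ε ∈ Ioo 0 ε0) (hT : 0 < T) (hG : 0 ≤ G) (hγ : 0 < γ) (hD : 0 ≤ D) (h01 : t0 ≤ t1)
    (hR : RBase S α (closure S.Ω) m K ϖ T ε0) (hw : PSub S ε G A w t0 t1)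
    (hA : ∀ x ∈ K, ∀ t ∈ Icc t0 t1, MClose ϖ (A x t) (α x))
    (hb : ∀ x ∈ frontier S.Ω, ∀ t ∈ Icc t0 t1, w x t ≤ -γ)
    (hi : ∀ x ∈ closure S.Ω, w x t0 ≤ D) (hGT : G * T ≤ γ * Real.exp (-m / ε)) :
    ∀ x ∈ closure S.Ω, w x t1 ≤ D + G * T := by
  have hind : ∀ j : ℕ, t0 + j * T ≤ t1 → ∀ x ∈ closure S.Ω, w x (t0 + j * T) ≤ D := by
    intro j
    induction j with
    | zero => intro _; simpa using hi
    | succ j ih =>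
      intro hj x hx
      push_cast at hj ⊢
      have e : t0 + ((j:ℝ) + 1) * T = t0 + j * T + T := by ring
      rw [e] at hj ⊢
      have hj0 : 0 ≤ (j:ℝ) * T := by positivity
      have := hR ε hε G γ (t0 + j * T) D A w hG hγ hD (hw.mono (by linarith) hj)
        (fun x hx t ht => hA x hx t ⟨by linarith [ht.1], ht.2.trans hj⟩)
        (fun x hx t ht => hb x hx t ⟨by linarith [ht.1], ht.2.trans hj⟩)
        (ih (by linarith)) x ⟨hx, hx⟩
      linarith
  intro x hx
  set j := ⌊(t1 - t0) / T⌋₊ with hj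
  have h1 : (j:ℝ) * T ≤ t1 - t0 := by
    rw [← le_div_iff₀ hT]; exact Nat.floor_le (div_nonneg (by linarith) hT.le)
  have h2 : t1 - t0 < ((j:ℝ) + 1) * T := by
    rw [← div_lt_iff₀ hT]; exact Nat.lt_floor_add_one _
  have hj0 : 0 ≤ (j:ℝ) * T := by positivity
  have h3 := MP_const hε.1.le hG (hw.mono (s1 := t0 + j * T) (by linarith) le_rfl) (hind j (by linarith))
    (fun x hx t ht => (hb x hx t ⟨by linarith [ht.1], ht.2⟩).trans (by linarith)) x hx t1 ⟨by linarith, le_rfl⟩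
  have h4 : G * (t1 - (t0 + j * T)) ≤ G * T := mul_le_mul_of_nonneg_left (by linarith) hG
  linarith

set_option maxHeartbeats 1600000 in
theorem upper_half (S : SettingB n) {β₁ β₂ a₁ : ℝ} (ha₁ : 0 < a₁) (hβ : β₁ < β₂) (hG : S.Gp β₂ < β₂)
    (hne : (frontier S.Ω).Nonempty) : ∀ᶠ ε in 𝓝[>] (0:ℝ), ∀ u : Eu n → ℝ → ℝ, S.SolvesQL ε u → S.BC u →
      ∀ τ1 τ2 : ℝ, Real.exp (a₁ / ε) ≤ τ1 → τ1 ≤ τ2 → u 0 τ1 = β₁ → u 0 τ2 = β₂ → False := by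
  have hα := S.coef β₂
  obtain ⟨V, ⟨L, hVL⟩, hV0, hVn, hVq, hVch, hVst⟩ := Vq_props hα
  obtain ⟨x0, hx0, hM, γ, hγ, κ1, hκ1, hgap⟩ := bdry_gap S hne hG hVL.continuous hVq
  have hθ := S.θpos
  have hCX := S.CX_nonneg
  set M := V x0 with hMd
  have hM0 : 0 ≤ M := hVn x0 (S.front_sub hx0)
  set κ := S.θ₀ ^ 2 * κ1 / 4 with hκd
  have hκ : 0 < κ := by positivity
  have hκe : S.θ₀ ^ 2 * κ1 = 4 * κ := by rw [hκd]; ring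
  obtain ⟨v1, hv1c, hv10, hv1b, K0, hK0, hK0Ω, ϖ0, hϖ0, e0, he0, hψ⟩ :=
    psi_barrier hα hVL hV0 hVst hM hκ (κ1 := κ1) (by linarith)
  obtain ⟨K1, hK1, hK1Ω, ϖ1, hϖ1, T, hT, e1, he1, hRB⟩ := reach_all hα hVL.continuous hVn hVch hx0 hκ
  obtain ⟨C0, hC0, hgC0⟩ := S.g_bdd
  set C := C0 + |β₂| with hCd
  have hC : 0 < C := by positivity
  have hβC := _root_.abs_le.1 (show |β₂| ≤ C by linarith)
  have hgC : ∀ x ∈ closure S.Ω, |S.g x| ≤ C := fun x hx => (hgC0 x hx).trans (by linarith [abs_nonneg β₂])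
  set ϖ := min ϖ0 ϖ1 with hϖd
  obtain ⟨d, hd, hdm⟩ := mat_unif (f := fun p : Eu n × ℝ => S.a p.1 p.2) (S.cpt.prod (isCompact_Icc (a := -C) (b := C)))
    (S.a_cont.mono (prod_mono le_rfl (subset_univ _))) (lt_min hϖ0 hϖ1)
  set δ := min (min (d / 2) (γ / 4)) ((β₂ - β₁) / 2) with hδd
  have hδ : 0 < δ := lt_min (lt_min (by linarith) (by linarith)) (by linarith)
  have hδ1 : δ ≤ d / 2 := (min_le_left _ _).trans (min_le_left _ _)
  have hδ2 : δ ≤ γ / 4 := (min_le_left _ _).trans (min_le_right _ _)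
  have hδ3 : δ ≤ (β₂ - β₁) / 2 := min_le_right _ _
  set βh := β₂ - δ + δ / 4 with hβh
  set C2 := 2 * C + γ with hC2
  have hC2p : 0 < C2 := by positivity
  obtain ⟨T1, hT1, hatt⟩ := S.X_attract S.cpt (r := S.r₀ / 2) (by linarith [S.r₀_pos])
  obtain ⟨κt, hκt, e2, he2, htr⟩ := transport S hT1 (show 0 < S.r₀ / 2 by linarith [S.r₀_pos])
  set K := K0 ∪ K1 ∪ closedBall (0 : Eu n) S.r₀ with hKd
  have hKc : IsCompact K := (hK0.union hK1).union (isCompact_closedBall _ _)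
  have hKΩ : K ⊆ S.Ω := union_subset (union_subset hK0Ω hK1Ω) S.ball_sub
  obtain ⟨T2, hT2, hconst⟩ := constancy S (show 0 < δ / 4 by linarith) hKc hKΩ
  have hkr : 0 < S.kk * S.r₀ ^ 2 := mul_pos S.kk_pos (pow_pos S.r₀_pos 2)
  filter_upwards [ev_pos, ev_of he0 hψ, ev_lt he1, ev_of he2 htr, hconst, ev_exp ha₁ T2,
    ev_expn hkr hδ (2 * (C2 * (1 + (S.CX + 1) * T1))),
    ev_expn (show 0 < 3 * κ by linarith) (show 0 < γ / 2 by linarith) (C2 * T),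
    ev_expn (show 0 < 4 * κ by linarith) (show 0 < δ / 4 by linarith) (C2 * (1 + T1 + T)),
    ev_expn hκt (show 0 < δ / 4 by linarith) C2]
    with ε hε hψ hε1 htr hconst ha hs1 hs2 hs3 hs4 u hu hbc τ1 τ2 hτ1 hτ12 hu1 hu2
  have hτ0 : 0 ≤ τ1 := (Real.exp_pos _).le.trans hτ1
  have hab := fun (x : Eu n) (hx : x ∈ closure S.Ω) (t : ℝ) (ht : 0 ≤ t) =>
    _root_.abs_le.1 (hu.abs_bd hε.le hbc hgC hx ht)
  have hc0 : ContinuousOn (fun t => u 0 t) (Icc τ1 τ2) :=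
    hu.cont.comp (f := fun t => ((0 : Eu n), t)) (by fun_prop) fun t ht => ⟨S.zero_cl, hτ0.trans ht.1⟩
  obtain ⟨s, t, hτs, hst, hus, hut, hbet⟩ := crossing (b := β₂ - δ) hτ12 hc0 hu1 hu2 (by linarith) (by linarith)
  have hs0 : 0 ≤ s := hτ0.trans hτs
  have h0K : (0 : Eu n) ∈ K := Or.inr (by simp [S.r₀_pos.le])
  have hosc : ∀ r ∈ Icc s t, ∀ x ∈ K, |u x r - u 0 r| ≤ δ / 4 := fun r hr x hx =>
    hconst u hu hbc r (by linarith [hr.1]) x hx 0 h0K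
  have hKcl : ∀ x ∈ K, ∀ r ∈ Icc s t, MClose ϖ (S.a x (u x r)) (S.a x β₂) := by
    intro x hx r hr
    have hxc := subset_closure (hKΩ hx)
    refine hdm (x, u x r) ⟨hxc, hab x hxc r (hs0.trans hr.1)⟩ (x, β₂) ⟨hxc, hβC⟩ ?_
    rw [Prod.dist_eq]
    refine max_le (by rw [dist_self]; exact hd.le) ?_
    show dist (u x r) β₂ ≤ d
    have h1 := _root_.abs_le.1 (hosc r hr x hx)
    have h2 := hbet r hr
    rw [Real.dist_eq]
    exact _root_.abs_le.2 ⟨by linarith [h1.1], by linarith [h1.2]⟩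
  have hstart : ∀ x ∈ closedBall (0 : Eu n) S.r₀, u x s ≤ βh := by
    intro x hx
    have h1 := _root_.abs_le.1 (hosc s ⟨le_rfl, hst⟩ x (Or.inr hx))
    rw [hβh, ← hus]; linarith [h1.2]
  rcases lt_or_ge t (s + T1) with hshort | hlong
  · have h1 := init_ball hε le_rfl (hu.toSub (t1 := s) (t2 := t) hs0) (E := C2) (D := βh) (C := C) hC2p (by linarith)
      (fun x hx r hr => (hab x hx r (hs0.trans hr.1)).2) hstart S.r₀_pos hst 0 S.zero_cl t ⟨hst, le_rfl⟩
    have e1 : S.chi ε 0 = 1 := by simp [SettingB.chi]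
    rw [e1, hut] at h1
    have h2 : 1 + (S.CX + 1) * (t - s) ≤ 1 + (S.CX + 1) * T1 := by
      have := mul_le_mul_of_nonneg_left (show t - s ≤ T1 by linarith) (show 0 ≤ S.CX + 1 by linarith)
      linarith
    have h3 := mul_le_mul_of_nonneg_left h2 (show 0 ≤ C2 * Real.exp (-(S.kk * S.r₀ ^ 2) / ε) by positivity)
    have e2 : 2 * (C2 * (1 + (S.CX + 1) * T1)) * Real.exp (-(S.kk * S.r₀ ^ 2) / ε) =
      2 * (C2 * Real.exp (-(S.kk * S.r₀ ^ 2) / ε) * (1 + (S.CX + 1) * T1)) := by ring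
    rw [e2] at hs1
    linarith
  set m1 := M + 8 * κ with hm1
  set ψ : Eu n → ℝ := fun x => Real.exp ((v1 x - m1) / ε) with hψd
  set w : Eu n → ℝ → ℝ := fun x t => u x t - βh - C2 * ψ x with hw
  set ee := Real.exp ((4 * κ - m1) / ε) with hee
  have hψp : ∀ x, 0 < ψ x := fun x => Real.exp_pos _
  have heep : 0 < ee := Real.exp_pos _
  have hψc : Continuous ψ := Real.continuous_exp.comp ((hv1c.sub continuous_const).div_const _)
  have hPS : PSub S ε (C2 * ee) (fun x t => S.a x (u x t)) w s t := by
    refine (hu.toSub (t1 := s) (t2 := t) hs0).sub_barrier hC2p.le hψc fun x hx r hr => ?_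
    exact hψ m1 x hx _ (S.a_mem x (subset_closure hx) _) fun hxK =>
      (hKcl x (Or.inl (Or.inl hxK)) r ⟨hr.1.le, hr.2⟩).mono (min_le_left _ _)
  have hbd : ∀ x ∈ frontier S.Ω, ∀ r ∈ Icc s t, w x r ≤ -(γ / 2) := by
    intro x hx r hr
    have e := hbc.front hx (hs0.trans hr.1)
    show u x r - βh - C2 * ψ x ≤ -(γ / 2)
    rw [e]
    by_cases hgx : β₂ - γ ≤ S.g x
    · have h1 := hv1b x hx (hgap x hx hgx)
      have h2 : 1 ≤ ψ x := Real.one_le_exp (div_nonneg (by linarith) hε.le)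
      have h3 := mul_le_mul_of_nonneg_left h2 hC2p.le
      have h4 := (_root_.abs_le.1 (hgC x (S.front_sub hx))).2
      linarith
    · have h3 := mul_pos hC2p (hψp x)
      linarith
  have hwC : ∀ x ∈ closure S.Ω, ∀ r ∈ Icc s t, w x r ≤ C2 := by
    intro x hx r hr
    have h1 := (hab x hx r (hs0.trans hr.1)).2
    have h3 := mul_pos hC2p (hψp x)
    show u x r - βh - C2 * ψ x ≤ C2
    linarith
  have hsT : s + T1 ∈ Icc s t := ⟨by linarith, hlong⟩
  have hGp : 0 ≤ C2 * ee := by positivity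
  have hD : ∀ x ∈ closure S.Ω, w x (s + T1) ≤ C2 * ee * T1 + C2 * Real.exp (-κt / ε) := by
    intro y hy
    have := htr (C2 * ee) 0 C2 s _ w y hC2p hGp (hPS.mono le_rfl hlong) hy
      (fun x hx => by linarith [hwC x hx s ⟨le_rfl, hst⟩])
      (fun x hx hxr => by
        have h1 := hatt T1 le_rfl y hy
        have h2 := norm_add_le (x - S.X T1 y) (S.X T1 y)
        rw [sub_add_cancel] at h2
        have h3 := hstart x (mem_closedBall_zero_iff.2 (by linarith))
        have h4 := mul_pos hC2p (hψp x)
        show u x s - βh - C2 * ψ x ≤ 0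
        linarith)
      (fun x hx r hr => by linarith [hbd x hx r ⟨hr.1, hr.2.trans hlong⟩])
      (fun x hx r hr _ => by linarith [hbd x hx r ⟨hr.1, hr.2.trans hlong⟩])
    linarith
  have heeb : ee ≤ Real.exp (-(4 * κ) / ε) :=
    Real.exp_le_exp.2 ((div_le_div_iff_of_pos_right hε).2 (by linarith))
  have hGT : C2 * ee * T ≤ γ / 2 * Real.exp (-(M + κ) / ε) := by
    have e : ee = Real.exp (-(3 * κ) / ε) * Real.exp (-(M + κ) / ε) := by
      rw [hee, ← Real.exp_add]; congr 1; rw [hm1]; ring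
    have h1 := mul_le_mul_of_nonneg_right hs2.le (Real.exp_pos (-(M + κ) / ε)).le
    rw [e]
    linarith
  have hfin := block_iter (α := fun x => S.a x β₂) ⟨hε, hε1⟩ hT hGp (show 0 < γ / 2 by linarith) (by positivity) hlong hRB
    (hPS.mono hsT.1 le_rfl)
    (fun x hx r hr => (hKcl x (Or.inl (Or.inr hx)) r ⟨by linarith [hr.1], hr.2⟩).mono (min_le_right _ _))
    (fun x hx r hr => hbd x hx r ⟨by linarith [hr.1], hr.2⟩) hD hGT 0 S.zero_cl
  have hψ0 : ψ 0 ≤ ee := Real.exp_le_exp.2 ((div_le_div_iff_of_pos_right hε).2 (by linarith))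
  have h1 : C2 * ψ 0 ≤ C2 * ee := mul_le_mul_of_nonneg_left hψ0 hC2p.le
  have h2 : u 0 t - βh - C2 * ψ 0 ≤ C2 * ee * T1 + C2 * Real.exp (-κt / ε) + C2 * ee * T := hfin
  have h3 := mul_le_mul_of_nonneg_left heeb (show 0 ≤ C2 * (1 + T1 + T) by positivity)
  have e4 : C2 * (1 + T1 + T) * ee = C2 * ee + C2 * ee * T1 + C2 * ee * T := by ring
  rw [e4] at h3
  rw [hut] at h2
  linarith

end

open Set Filter Metric Topology
open scoped ENNReal

noncomputable section
variable {n : ℕ} {S : SettingB n} {α : Eu n → Matrix (Fin n) (Fin n) ℝ}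

lemma nofront_dim (S : SettingB n) (h : ¬ (frontier S.Ω).Nonempty) : n = 0 := by
  rw [not_nonempty_iff_eq_empty, frontier_eq_empty_iff] at h
  rcases h with h | h
  · exact absurd S.zero_mem (by rw [h]; exact notMem_empty _)
  · rcases n with _ | k
    · rfl
    · have := S.bdd
      rw [h] at this
      exact absurd this (NormedSpace.unbounded_univ ℝ (Eu (k + 1)))

lemma dim_zero_const (S : SettingB 0) {ε : ℝ} {u : Eu 0 → ℝ → ℝ} (hu : S.SolvesQL ε u) {τ1 τ2 : ℝ} (h1 : 0 < τ1) (h12 : τ1 ≤ τ2) :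
    u 0 τ2 = u 0 τ1 := by
  have hd : ∀ t, 0 < t → HasDerivAt (u 0) 0 t := by
    intro t ht
    have h2 := (hu.1.2.1 0 S.zero_mem t ht ENNReal.ofReal_lt_top).2.hasDerivAt
    have h3 := hu.2 0 S.zero_mem t ht ENNReal.ofReal_lt_top
    simp only [tD, trMul, dotp, Finset.univ_eq_empty, Finset.sum_empty, mul_zero, add_zero] at h3
    rwa [h3] at h2
  exact constant_of_has_deriv_right_zero
    (fun t ht => (hd t (h1.trans_le ht.1)).continuousAt.continuousWithinAt)
    (fun t ht => (hd t (h1.trans_le ht.1)).hasDerivWithinAt) τ2 ⟨h12, le_rfl⟩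

theorem main_up (S : SettingB n) (u : ℝ → Eu n → ℝ → ℝ)
    (hu : ∀ ε ∈ Set.Ioo (0:ℝ) 1, S.SolvesQL ε (u ε) ∧ S.BC (u ε))
    (μ lam εk : ℕ → ℝ) (a₁ β₁ β₂ : ℝ) (ha₁ : 0 < a₁)
    (hεk : ∀ k, εk k ∈ Set.Ioo (0:ℝ) 1)
    (hεk0 : Filter.Tendsto εk Filter.atTop (nhds 0))
    (hk : ∀ k, a₁ ≤ μ k ∧ μ k < lam k)
    (hβ₁ : ∀ k, u (εk k) 0 (Real.exp (μ k / εk k)) = β₁)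
    (hβ₂ : ∀ k, u (εk k) 0 (Real.exp (lam k / εk k)) = β₂) (hβ : β₁ < β₂) : β₂ ≤ S.Gp β₂ := by
  by_contra hcon
  push Not at hcon
  have hexp : ∀ k, Real.exp (μ k / εk k) ≤ Real.exp (lam k / εk k) := fun k =>
    Real.exp_le_exp.2 ((div_le_div_iff_of_pos_right (hεk k).1).2 (hk k).2.le)
  by_cases hne : (frontier S.Ω).Nonempty
  · have hev := upper_half S ha₁ hβ hcon hne
    have ht : Tendsto εk atTop (𝓝[>] 0) :=
      tendsto_nhdsWithin_iff.2 ⟨hεk0, Eventually.of_forall fun k => (hεk k).1⟩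
    obtain ⟨k, hk'⟩ := (ht.eventually hev).exists
    exact hk' (u (εk k)) (hu _ (hεk k)).1 (hu _ (hεk k)).2 _ _
      (Real.exp_le_exp.2 ((div_le_div_iff_of_pos_right (hεk k).1).2 (hk k).1)) (hexp k) (hβ₁ k) (hβ₂ k)
  · have hn := nofront_dim S hne
    subst hn
    have := dim_zero_const S (hu _ (hεk 0)).1 (Real.exp_pos _) (hexp 0)
    rw [hβ₁, hβ₂] at this
    linarith

/-- the reflected data. -/
def SettingB.flip (S : SettingB n) : SettingB n where
  Ω := S.Ω
  ν := S.ν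
  g := fun x => - S.g x
  θ₀ := S.θ₀
  a := fun x c => S.a x (-c)
  b := S.b
  b₀ := S.b₀
  r₀ := S.r₀
  θ₀_mem := S.θ₀_mem
  domain := S.domain
  zero_mem := S.zero_mem
  g_cont := S.g_cont.neg
  a_cont := S.a_cont.comp (f := fun p : Eu n × ℝ => (p.1, -p.2)) (by fun_prop) fun p hp => ⟨hp.1, mem_univ _⟩
  a_mem := fun x hx c => S.a_mem x hx (-c)
  b_lip := S.b_lip
  b_zero := S.b_zero
  b_gas := S.b_gas
  b_inward := S.b_inward
  b₀_pos := S.b₀_pos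
  r₀_pos := S.r₀_pos
  ball_sub := S.ball_sub
  b_coerc := S.b_coerc

lemma tD_neg' (u : Eu n → ℝ → ℝ) (x : Eu n) (t : ℝ) : tD (fun x t => - u x t) x t = - tD u x t := by
  simp only [tD]
  exact deriv.fun_neg

lemma sG_neg' (u : Eu n → ℝ → ℝ) (x : Eu n) (t : ℝ) : sG (fun x t => - u x t) x t = - sG u x t := by
  simp only [sG, gradient]
  rw [fderiv_fun_neg, map_neg]

lemma sH_neg' (u : Eu n → ℝ → ℝ) (x : Eu n) (t : ℝ) : sH (fun x t => - u x t) x t = - sH u x t := by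
  ext i j
  simp only [sH, sG_neg', Matrix.neg_apply, PiLp.neg_apply]
  rw [fderiv_fun_neg]
  rfl

lemma SettingB.SolvesQL.flip {ε : ℝ} {u : Eu n → ℝ → ℝ} (h : S.SolvesQL ε u) :
    S.flip.SolvesQL ε (fun x t => - u x t) := by
  obtain ⟨⟨h1, h2, h3, h4⟩, h5⟩ := h
  refine ⟨⟨h1.neg, fun x hx t ht ht' => ⟨(h2 x hx t ht ht').1.neg, (h2 x hx t ht ht').2.neg⟩, ?_, ?_⟩, ?_⟩
  · simp only [tD_neg']
    exact h3.neg
  · simp only [sH_neg']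
    exact h4.neg
  · intro x hx t ht ht'
    have := h5 x hx t ht ht'
    rw [tD_neg', sG_neg', sH_neg', this]
    simp only [SettingB.flip, neg_neg, SettingB.trMul_neg]
    have e : dotp (S.b x) (-sG u x t) = - dotp (S.b x) (sG u x t) := by
      rw [dotp_eq, dotp_eq, inner_neg_right]
    rw [e]; ring

lemma SettingB.BC.flip {u : Eu n → ℝ → ℝ} (h : S.BC u) : S.flip.BC (fun x t => - u x t) :=
  ⟨fun x hx => congrArg Neg.neg (h.1 x hx), fun x hx t ht => congrArg Neg.neg (h.2 x hx t ht)⟩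

lemma SettingB.Gp_flip (S : SettingB n) (c : ℝ) : S.flip.Gp (-c) = - S.Gm c := by
  have e : S.flip.Gset (-c) = - S.Gset c := by
    simp only [SettingB.Gset, SettingB.flip, neg_neg]
    ext y
    constructor
    · rintro ⟨x, hx, rfl⟩
      exact ⟨x, hx, (neg_neg _).symm⟩
    · rintro ⟨x, hx, hy⟩
      exact ⟨x, hx, by show - S.g x = y; rw [hy, neg_neg]⟩
  rw [SettingB.Gp, SettingB.Gm, e, Real.sInf_def, neg_neg]

end

/-- Proposition 1.3. -/
theorem stmt2 {n : ℕ} (S : SettingB n) (u : ℝ → Eu n → ℝ → ℝ)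
    (hu : ∀ ε ∈ Set.Ioo (0:ℝ) 1, S.SolvesQL ε (u ε) ∧ S.BC (u ε))
    (μ lam εk : ℕ → ℝ) (a₁ a₂ β₁ β₂ : ℝ)
    (ha₁ : 0 < a₁) (ha₁₂ : a₁ < a₂)
    (hβ₁I : β₁ ∈ Set.Icc S.gmin S.gmax) (hβ₂I : β₂ ∈ Set.Icc S.gmin S.gmax)
    (hεk : ∀ k, εk k ∈ Set.Ioo (0:ℝ) 1)
    (hεk0 : Filter.Tendsto εk Filter.atTop (nhds 0))
    (hk : ∀ k, a₁ ≤ μ k ∧ μ k < lam k ∧ lam k ≤ a₂)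
    (hβ₁ : ∀ k, u (εk k) 0 (Real.exp (μ k / εk k)) = β₁)
    (hβ₂ : ∀ k, u (εk k) 0 (Real.exp (lam k / εk k)) = β₂) :
    (β₁ < β₂ → β₂ ≤ S.Gp β₂) ∧ (β₂ < β₁ → S.Gm β₂ ≤ β₂) := by
  refine ⟨fun hβ => main_up S u hu μ lam εk a₁ β₁ β₂ ha₁ hεk hεk0
    (fun k => ⟨(hk k).1, (hk k).2.1⟩) hβ₁ hβ₂ hβ, fun hβ => ?_⟩
  have h := main_up S.flip (fun ε x t => - u ε x t)
    (fun ε hε => ⟨(hu ε hε).1.flip, (hu ε hε).2.flip⟩) μ lam εk a₁ (-β₁) (-β₂) ha₁ hεk hεk0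
    (fun k => ⟨(hk k).1, (hk k).2.1⟩) (fun k => congrArg Neg.neg (hβ₁ k))
    (fun k => congrArg Neg.neg (hβ₂ k)) (neg_lt_neg hβ)
  rw [SettingB.Gp_flip] at h
  linarith
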